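/- arXiv:2503.23648 — 3 statements merged into one kernel-verified Lean document; each statement's English description precedes it below -/
import Mathlib

section
/- There exists a constant C > 0 such that for every sufficiently large integer N the following holds: for all integers a, b with gcd(a,b) = 1, there exist a natural number t ≤ C·log N and exponents i₁, …, i_t ∈ {1, 2} such that, as vectors over ℤ/Nℤ, the column vector (a, b)ᵀ equals A^{i₁}·D·A^{i₂}·D·⋯·A^{i_t}·D applied to the column vector (1, 0)ᵀ, where the matrix product is taken over ℤ/Nℤ. -/
open Matrix

/-- The matrix `A = [[1,1],[0,1]]` over a commutative ring `R`. -/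
def matA (R : Type*) [CommRing R] : Matrix (Fin 2) (Fin 2) R := !![1, 1; 0, 1]

/-- The matrix `D = [[1,0],[1,1]]` over a commutative ring `R`. -/
def matD (R : Type*) [CommRing R] : Matrix (Fin 2) (Fin 2) R := !![1, 0; 1, 1]

theorem add_one_le_mul_two_rpow {ε : ℝ} (hε : 0 < ε) (v : ℕ) :
    (v : ℝ) + 1 ≤ (1 + 1 / (ε * Real.log 2)) * (2 : ℝ) ^ (ε * v) := by
  have hl : 0 < ε * Real.log 2 := mul_pos hε (Real.log_pos (by norm_num))
  have h1 : ε * Real.log 2 * v + 1 ≤ (2 : ℝ) ^ (ε * v) := by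
    rw [Real.rpow_def_of_pos (by norm_num)]
    calc ε * Real.log 2 * v + 1 = Real.log 2 * (ε * v) + 1 := by ring
      _ ≤ _ := Real.add_one_le_exp _
  have hv : (0 : ℝ) ≤ v := v.cast_nonneg
  calc (v : ℝ) + 1 ≤ (1 + 1 / (ε * Real.log 2)) * (ε * Real.log 2 * v + 1) := by
        have : (1 + 1 / (ε * Real.log 2)) * (ε * Real.log 2 * v + 1)
            = ε * Real.log 2 * v + 1 + v + 1 / (ε * Real.log 2) := by
          field_simp
          ring
        rw [this]
        have : 0 < 1 / (ε * Real.log 2) := by positivity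
        nlinarith [mul_nonneg hl.le hv]
    _ ≤ _ := by gcongr

/-- The divisor bound. -/
theorem exists_card_divisors_le {ε : ℝ} (hε : 0 < ε) :
    ∃ C : ℝ, 1 ≤ C ∧ ∀ n : ℕ, n ≠ 0 → (n.divisors.card : ℝ) ≤ C * (n : ℝ) ^ ε := by
  set C₀ : ℝ := 1 + 1 / (ε * Real.log 2) with hC₀
  have hl : 0 < ε * Real.log 2 := mul_pos hε (Real.log_pos (by norm_num))
  have hC₀1 : 1 ≤ C₀ := by
    rw [hC₀]
    have : 0 < 1 / (ε * Real.log 2) := by positivity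
    linarith
  obtain ⟨P, hP⟩ := exists_nat_gt ((2 : ℝ) ^ (1 / ε))
  refine ⟨C₀ ^ P, one_le_pow₀ hC₀1, fun n hn ↦ ?_⟩
  have hfac : ∀ p ∈ n.primeFactors, ((n.factorization p : ℝ) + 1) ≤
      (if p < P then C₀ else 1) * ((p : ℝ) ^ (n.factorization p)) ^ ε := by
    intro p hp
    have hp2 : (2 : ℝ) ≤ p := by exact_mod_cast (Nat.prime_of_mem_primeFactors hp).two_le
    have hp0 : (0 : ℝ) < p := by linarith
    rw [← Real.rpow_natCast, ← Real.rpow_mul hp0.le]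
    split_ifs with h
    · refine (add_one_le_mul_two_rpow hε _).trans ?_
      have h3 : (2 : ℝ) ^ (ε * (n.factorization p : ℝ)) ≤
          (p : ℝ) ^ ((n.factorization p : ℝ) * ε) := by
        rw [mul_comm ε]
        exact Real.rpow_le_rpow (by norm_num) hp2 (by positivity)
      exact mul_le_mul_of_nonneg_left h3 (by linarith)
    · have hpP : (2 : ℝ) ^ (1 / ε) ≤ p := hP.le.trans (by exact_mod_cast not_lt.1 h)
      have h2 : (2 : ℝ) ≤ (p : ℝ) ^ ε := by
        calc (2 : ℝ) = ((2 : ℝ) ^ (1 / ε)) ^ ε := by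
              rw [← Real.rpow_mul (by norm_num), one_div_mul_cancel hε.ne', Real.rpow_one]
          _ ≤ _ := by gcongr
      rw [one_mul, mul_comm, Real.rpow_mul hp0.le, Real.rpow_natCast]
      calc ((n.factorization p : ℝ) + 1) ≤ 2 ^ (n.factorization p) := by
            exact_mod_cast Nat.lt_two_pow_self
        _ ≤ _ := by gcongr
  have hn' : (n : ℝ) ^ ε = ∏ p ∈ n.primeFactors, ((p : ℝ) ^ (n.factorization p)) ^ ε := by
    rw [Real.finsetProd_rpow _ _ (fun i _ ↦ by positivity)]
    congr 1
    conv_lhs => rw [← Nat.prod_factorization_pow_eq_self hn]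
    rw [Finsupp.prod, Nat.support_factorization]
    push_cast
    rfl
  rw [Nat.card_divisors hn, hn']
  push_cast
  calc ∏ p ∈ n.primeFactors, ((n.factorization p : ℝ) + 1)
      ≤ ∏ p ∈ n.primeFactors, ((if p < P then C₀ else 1) *
          ((p : ℝ) ^ (n.factorization p)) ^ ε) :=
        Finset.prod_le_prod (fun _ _ ↦ by positivity) hfac
    _ = (∏ p ∈ n.primeFactors, (if p < P then C₀ else 1)) *
          ∏ p ∈ n.primeFactors, ((p : ℝ) ^ (n.factorization p)) ^ ε := Finset.prod_mul_distrib
    _ ≤ _ := by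
        gcongr
        rw [Finset.prod_ite, Finset.prod_const_one, mul_one, Finset.prod_const]
        refine pow_le_pow_right₀ hC₀1 ?_
        calc _ ≤ (Finset.range P).card := Finset.card_le_card fun p hp ↦ by
              simpa using (Finset.mem_filter.1 hp).2
          _ = P := Finset.card_range P

theorem le_totient_mul_card_divisors (n : ℕ) (hn : n ≠ 0) :
    n ≤ n.divisors.card * n.totient := by
  calc n = ∑ d ∈ n.divisors, d.totient := (Nat.sum_totient n).symm
    _ ≤ ∑ d ∈ n.divisors, n.totient := Finset.sum_le_sum fun d hd ↦
        Nat.le_of_dvd (Nat.totient_pos.2 (Nat.pos_of_ne_zero hn))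
          (Nat.totient_dvd_of_dvd (Nat.dvd_of_mem_divisors hd))
    _ = _ := by simp

theorem dvd_two_mul_sub_of_gcd_eq {N x y : ℤ} (hN : N ≠ 0) (hx : N ∣ (x - 1) * (x + 1))
    (hy : N ∣ (y - 1) * (y + 1)) (h : Int.gcd (x - 1) N = Int.gcd (y - 1) N) :
    N ∣ 2 * (x - y) := by
  have aux : ∀ z : ℤ, N ∣ (z - 1) * (z + 1) → N / (Int.gcd (z - 1) N : ℤ) ∣ z + 1 := by
    intro z hz
    have h0 : 0 < Int.gcd (z - 1) N := Int.gcd_pos_of_ne_zero_right _ hN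
    have hc := Int.isCoprime_iff_gcd_eq_one.2 (Int.gcd_div_gcd_div_gcd h0)
    refine hc.symm.dvd_of_dvd_mul_left ?_
    have h1 : (Int.gcd (z - 1) N : ℤ) ∣ z - 1 := Int.gcd_dvd_left _ _
    have h2 : (Int.gcd (z - 1) N : ℤ) ∣ N := Int.gcd_dvd_right _ _
    have h0' : (Int.gcd (z - 1) N : ℤ) ≠ 0 := by exact_mod_cast h0.ne'
    rw [← mul_dvd_mul_iff_left h0', ← mul_assoc, Int.mul_ediv_cancel' h2,
      Int.mul_ediv_cancel' h1]
    exact hz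
  have hex : (Int.gcd (x - 1) N : ℤ) ∣ x - 1 := Int.gcd_dvd_left _ _
  have hey : (Int.gcd (x - 1) N : ℤ) ∣ y - 1 := h ▸ Int.gcd_dvd_left _ _
  have heN : (Int.gcd (x - 1) N : ℤ) ∣ N := Int.gcd_dvd_right _ _
  have hfx := aux x hx
  have hfy := aux y hy
  rw [← h] at hfy
  clear h aux
  generalize (Int.gcd (x - 1) N : ℤ) = e at hex hey heN hfx hfy
  obtain ⟨f, rfl⟩ := heN
  have he0 : e ≠ 0 := left_ne_zero_of_mul hN
  rw [Int.mul_ediv_cancel_left _ he0] at hfx hfy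
  have h1 : e ∣ x - y := by simpa using dvd_sub hex hey
  have h2 : f ∣ x - y := by simpa using dvd_sub hfx hfy
  have h3 : (Int.gcd e f : ℤ) ∣ 2 := by
    have := dvd_sub ((Int.gcd_dvd_right e f).trans hfx) ((Int.gcd_dvd_left e f).trans hex)
    ring_nf at this
    exact this
  obtain ⟨r, s, hrs⟩ : ∃ r s : ℤ, (Int.gcd e f : ℤ) = e * r + f * s := ⟨_, _, Int.gcd_eq_gcd_ab e f⟩
  have h4 : e * f ∣ (Int.gcd e f : ℤ) * (x - y) := by
    rw [hrs]
    obtain ⟨c, hc⟩ := h1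
    obtain ⟨d, hd⟩ := h2
    exact ⟨r * d + s * c, by
      calc (e * r + f * s) * (x - y) = e * r * (x - y) + f * s * (x - y) := by ring
        _ = e * r * (f * d) + f * s * (e * c) := by rw [← hd, ← hc]
        _ = _ := by ring⟩
  exact h4.trans (mul_dvd_mul_right h3 _)

theorem card_two_mul_eq_zero_le (N : ℕ) [NeZero N] :
    (Finset.univ.filter fun w : ZMod N ↦ 2 * w = 0).card ≤ 2 := by
  have : (Finset.univ.filter fun w : ZMod N ↦ 2 * w = 0) ⊆
      ({0, ((N / 2 : ℕ) : ZMod N)} : Finset (ZMod N)) := by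
    intro w hw
    simp only [Finset.mem_filter, Finset.mem_univ, true_and] at hw
    have h1 : N ∣ 2 * w.val := by
      rw [← ZMod.natCast_eq_zero_iff]
      push_cast
      rw [ZMod.natCast_zmod_val, hw]
    have h2 := ZMod.val_lt w
    obtain ⟨c, hc⟩ := h1
    have hc2 : c < 2 := by
      by_contra! h
      nlinarith
    simp only [Finset.mem_insert, Finset.mem_singleton]
    interval_cases c
    · left
      rw [← ZMod.val_eq_zero]
      omega
    · right
      rw [← ZMod.natCast_zmod_val w]
      congr 1
      omega
  exact (Finset.card_le_card this).trans Finset.card_le_two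

theorem card_sq_eq_one_le (N : ℕ) [NeZero N] :
    (Finset.univ.filter fun u : (ZMod N)ˣ ↦ u ^ 2 = 1).card ≤ 2 * N.divisors.card := by
  classical
  have key : ∀ u : (ZMod N)ˣ, u ^ 2 = 1 → (N : ℤ) ∣ (((u : ZMod N).val : ℤ) - 1) *
      (((u : ZMod N).val : ℤ) + 1) := by
    intro u hu
    rw [← ZMod.intCast_zmod_eq_zero_iff_dvd]
    have : ((u : ZMod N)) ^ 2 = 1 := by
      rw [← Units.val_pow_eq_pow_val, hu, Units.val_one]
    push_cast
    rw [ZMod.natCast_zmod_val]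
    linear_combination this
  refine Finset.card_le_mul_card_image_of_maps_to
    (f := fun u : (ZMod N)ˣ ↦ Int.gcd (((u : ZMod N).val : ℤ) - 1) N) (t := N.divisors) ?_ 2 ?_
  · intro u _
    rw [Nat.mem_divisors]
    exact ⟨Int.natCast_dvd_natCast.1 (Int.gcd_dvd_right _ _), NeZero.ne N⟩
  · intro e he
    rw [Finset.filter_filter]
    rcases Finset.eq_empty_or_nonempty (Finset.univ.filter fun u : (ZMod N)ˣ ↦ u ^ 2 = 1 ∧
      Int.gcd (((u : ZMod N).val : ℤ) - 1) N = e) with h | ⟨u, hu⟩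
    · rw [h]; simp
    refine le_trans (Finset.card_le_card_of_injOn (fun v : (ZMod N)ˣ ↦ (v : ZMod N) - u)
      (t := Finset.univ.filter fun w : ZMod N ↦ 2 * w = 0) ?_ ?_) (card_two_mul_eq_zero_le N)
    · intro v hv
      simp only [Finset.coe_filter, Finset.mem_filter, Finset.mem_univ, true_and,
        Set.mem_ofPred_eq] at hu hv ⊢
      have := dvd_two_mul_sub_of_gcd_eq (by exact_mod_cast NeZero.ne N) (key v hv.1) (key u hu.1)
        (by rw [hu.2, hv.2])
      rw [← ZMod.intCast_zmod_eq_zero_iff_dvd] at this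
      push_cast at this
      rwa [ZMod.natCast_zmod_val, ZMod.natCast_zmod_val] at this
    · intro v _ w _ hvw
      exact Units.ext (sub_left_injective hvw)

theorem le_card_image_sq (N : ℕ) [NeZero N] :
    N ≤ 2 * N.divisors.card ^ 2 * (Finset.univ.image fun u : (ZMod N)ˣ ↦ u ^ 2).card := by
  classical
  have h1 := le_totient_mul_card_divisors N (NeZero.ne N)
  have h2 : N.totient ≤ (2 * N.divisors.card) *
      (Finset.univ.image fun u : (ZMod N)ˣ ↦ u ^ 2).card := by
    rw [← ZMod.card_units_eq_totient, ← Finset.card_univ]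
    refine Finset.card_le_mul_card_image _ _ fun s hs ↦ ?_
    obtain ⟨u, -, rfl⟩ := Finset.mem_image.1 hs
    refine le_trans (Finset.card_le_card_of_injOn (fun v ↦ v * u⁻¹) ?_ ?_) (card_sq_eq_one_le N)
    · intro v hv
      simp only [Finset.coe_filter, Finset.mem_univ, true_and, Set.mem_ofPred_eq] at hv ⊢
      rw [mul_pow, hv, ← mul_pow, mul_inv_cancel, one_pow]
    · intro v _ w _ h
      simpa using h
  calc N ≤ N.divisors.card * N.totient := h1
    _ ≤ N.divisors.card * ((2 * N.divisors.card) *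
      (Finset.univ.image fun u : (ZMod N)ˣ ↦ u ^ 2).card) := Nat.mul_le_mul_left _ h2
    _ = _ := by ring

/-- The group `SL₂(R)`. -/
abbrev SL₂ (R : Type*) [CommRing R] := Matrix.SpecialLinearGroup (Fin 2) R

section SLTwo

variable {R : Type*} [CommRing R]

theorem sl_ext {g h : SL₂ R} (h00 : g 0 0 = h 0 0) (h01 : g 0 1 = h 0 1) (h10 : g 1 0 = h 1 0)
    (h11 : g 1 1 = h 1 1) : g = h := by
  ext i j
  fin_cases i <;> fin_cases j <;> assumption

theorem sl_mul_apply (g h : SL₂ R) (i j : Fin 2) :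
    (g * h) i j = g i 0 * h 0 j + g i 1 * h 1 j := by
  rw [Matrix.SpecialLinearGroup.coe_mul, Matrix.mul_apply, Fin.sum_univ_two]

theorem sl_det (g : SL₂ R) : g 0 0 * g 1 1 - g 0 1 * g 1 0 = 1 := by
  rw [← Matrix.det_fin_two]
  exact g.det_coe

theorem sl_inv_00 (g : SL₂ R) : g⁻¹ 0 0 = g 1 1 := by
  rw [Matrix.SpecialLinearGroup.SL2_inv_expl]; rfl

theorem sl_inv_01 (g : SL₂ R) : g⁻¹ 0 1 = -g 0 1 := by
  rw [Matrix.SpecialLinearGroup.SL2_inv_expl]; rfl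

theorem sl_inv_10 (g : SL₂ R) : g⁻¹ 1 0 = -g 1 0 := by
  rw [Matrix.SpecialLinearGroup.SL2_inv_expl]; rfl

theorem sl_inv_11 (g : SL₂ R) : g⁻¹ 1 1 = g 0 0 := by
  rw [Matrix.SpecialLinearGroup.SL2_inv_expl]; rfl

/-- The element of `SL₂(R)` with given entries. -/
def slMk (a b c d : R) (h : a * d - b * c = 1) : SL₂ R :=
  ⟨!![a, b; c, d], by rw [Matrix.det_fin_two_of, h]⟩

@[simp] theorem slMk_00 (a b c d : R) (h) : slMk a b c d h 0 0 = a := rfl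
@[simp] theorem slMk_01 (a b c d : R) (h) : slMk a b c d h 0 1 = b := rfl
@[simp] theorem slMk_10 (a b c d : R) (h) : slMk a b c d h 1 0 = c := rfl
@[simp] theorem slMk_11 (a b c d : R) (h) : slMk a b c d h 1 1 = d := rfl

/-- The upper unipotent `[[1,x],[0,1]]`. -/
def slU (x : R) : SL₂ R := slMk 1 x 0 1 (by ring)

/-- The lower unipotent `[[1,0],[x,1]]`. -/
def slL (x : R) : SL₂ R := slMk 1 0 x 1 (by ring)

/-- The diagonal matrix with entries `u, u⁻¹`. -/
def slDiag (u : Rˣ) : SL₂ R := slMk u 0 0 (u⁻¹ : Rˣ) (by simp)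

@[simp] theorem slU_00 (x : R) : slU x 0 0 = 1 := rfl
@[simp] theorem slU_01 (x : R) : slU x 0 1 = x := rfl
@[simp] theorem slU_10 (x : R) : slU x 1 0 = 0 := rfl
@[simp] theorem slU_11 (x : R) : slU x 1 1 = 1 := rfl
@[simp] theorem slL_00 (x : R) : slL x 0 0 = 1 := rfl
@[simp] theorem slL_01 (x : R) : slL x 0 1 = 0 := rfl
@[simp] theorem slL_10 (x : R) : slL x 1 0 = x := rfl
@[simp] theorem slL_11 (x : R) : slL x 1 1 = 1 := rfl
@[simp] theorem slDiag_00 (u : Rˣ) : slDiag u 0 0 = u := rfl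
@[simp] theorem slDiag_01 (u : Rˣ) : slDiag u 0 1 = 0 := rfl
@[simp] theorem slDiag_10 (u : Rˣ) : slDiag u 1 0 = 0 := rfl
@[simp] theorem slDiag_11 (u : Rˣ) : slDiag u 1 1 = (u⁻¹ : Rˣ) := rfl

theorem sl_one_00 : (1 : SL₂ R) 0 0 = 1 := rfl
theorem sl_one_01 : (1 : SL₂ R) 0 1 = 0 := rfl
theorem sl_one_10 : (1 : SL₂ R) 1 0 = 0 := rfl
theorem sl_one_11 : (1 : SL₂ R) 1 1 = 1 := rfl

theorem slU_add (x y : R) : slU (x + y) = slU x * slU y := by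
  apply sl_ext <;> simp [sl_mul_apply, add_comm]

theorem slL_add (x y : R) : slL (x + y) = slL x * slL y := by
  apply sl_ext <;> simp [sl_mul_apply]

theorem slU_zero : slU (0 : R) = 1 := sl_ext rfl rfl rfl rfl

theorem slL_zero : slL (0 : R) = 1 := sl_ext rfl rfl rfl rfl

theorem slU_neg (x : R) : slU (-x) = (slU x)⁻¹ := by
  rw [eq_inv_iff_mul_eq_one, ← slU_add, neg_add_cancel, slU_zero]

theorem slL_neg (x : R) : slL (-x) = (slL x)⁻¹ := by
  rw [eq_inv_iff_mul_eq_one, ← slL_add, neg_add_cancel, slL_zero]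

theorem slU_natCast (n : ℕ) : slU (n : R) = slU 1 ^ n := by
  induction n with
  | zero => rw [Nat.cast_zero, slU_zero, pow_zero]
  | succ n ih => rw [Nat.cast_succ, slU_add, ih, pow_succ]

theorem slL_natCast (n : ℕ) : slL (n : R) = slL 1 ^ n := by
  induction n with
  | zero => rw [Nat.cast_zero, slL_zero, pow_zero]
  | succ n ih => rw [Nat.cast_succ, slL_add, ih, pow_succ]

/-- The factorization of an element with invertible upper left entry. -/
theorem sl_eq_lower_diag_upper (g : SL₂ R) (u : Rˣ) (hu : g 0 0 = u) :
    g = slL (g 1 0 * (u⁻¹ : Rˣ)) * slDiag u * slU ((u⁻¹ : Rˣ) * g 0 1) := by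
  have h := sl_det g
  rw [hu] at h
  apply sl_ext <;> simp only [sl_mul_apply, slL_00, slL_01, slL_10, slL_11, slDiag_00, slDiag_01,
    slDiag_10, slDiag_11, slU_00, slU_01, slU_10, slU_11]
  · simp [hu]
  · simp
  · simp
  · have h1 : (u : R) * (u⁻¹ : Rˣ) = 1 := u.mul_inv
    linear_combination (u⁻¹ : Rˣ) * h - (g 1 1 + g 1 0 * g 0 1 * ((u⁻¹ : Rˣ) : R)) * h1

theorem slDiag_eq (u : Rˣ) :
    slDiag u = slU (u : R) * slL (-((u⁻¹ : Rˣ) : R)) * slU (u : R) *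
      (slU (-1) * slL 1 * slU (-1)) := by
  apply sl_ext <;> simp [sl_mul_apply]

/-- A set of matrices over `ℤ/N` closed under multiplication and containing all unipotents is
everything. -/
theorem subgroup_eq_top_of_slU_slL {N : ℕ} [NeZero N] (H : Subgroup (SL₂ (ZMod N)))
    (hU : slU 1 ∈ H) (hL : slL 1 ∈ H) : H = ⊤ := by
  have hU' : ∀ x : ZMod N, slU x ∈ H := fun x ↦ by
    rw [← ZMod.natCast_zmod_val x, slU_natCast]
    exact H.pow_mem hU _
  have hL' : ∀ x : ZMod N, slL x ∈ H := fun x ↦ by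
    rw [← ZMod.natCast_zmod_val x, slL_natCast]
    exact H.pow_mem hL _
  have hD : ∀ u : (ZMod N)ˣ, slDiag u ∈ H := fun u ↦ by
    rw [slDiag_eq]
    exact H.mul_mem (H.mul_mem (H.mul_mem (hU' _) (hL' _)) (hU' _))
      (H.mul_mem (H.mul_mem (hU' _) (hL' _)) (hU' _))
  have key : ∀ (q : ℕ) (g : SL₂ (ZMod N)), g 1 0 = (q : ZMod N) → g ∈ H := by
    intro q
    induction q using Nat.strong_induction_on with
    | _ q ih =>
      intro g hg
      rcases Nat.eq_zero_or_pos q with rfl | hq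
      · have hd := sl_det g
        rw [hg, Nat.cast_zero, mul_zero, sub_zero] at hd
        rw [sl_eq_lower_diag_upper g (Units.mkOfMulEqOne _ _ hd) rfl]
        exact H.mul_mem (H.mul_mem (hL' _) (hD _)) (hU' _)
      · set p := (g 0 0).val
        have hp : g 0 0 = (p : ZMod N) := (ZMod.natCast_zmod_val _).symm
        set k := (slU (-1) * slL 1 * slU (-1)) * slU (-((p / q : ℕ) : ZMod N)) with hk
        have hkH : k ∈ H := H.mul_mem (H.mul_mem (H.mul_mem (hU' _) (hL' _)) (hU' _)) (hU' _)
        rw [← H.mul_mem_cancel_left hkH]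
        refine ih (p % q) (Nat.mod_lt _ hq) _ ?_
        have h1 : (p : ZMod N) =
            (q : ZMod N) * ((p / q : ℕ) : ZMod N) + ((p % q : ℕ) : ZMod N) := by
          exact_mod_cast congrArg (Nat.cast : ℕ → ZMod N) (Nat.div_add_mod p q).symm
        simp only [hk, sl_mul_apply, slL_00, slL_01, slL_10, slL_11, slU_00, slU_01, slU_10, slU_11,
          hp, hg]
        linear_combination h1
  rw [eq_top_iff]
  intro g _
  exact key (g 1 0).val g (ZMod.natCast_zmod_val _).symm

/-- Reduction modulo `N`. -/
def slRed (N : ℕ) : SL₂ ℤ →* SL₂ (ZMod N) :=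
  Matrix.SpecialLinearGroup.map (Int.castRingHom (ZMod N))

theorem slRed_apply (N : ℕ) (g : SL₂ ℤ) (i j : Fin 2) : slRed N g i j = (g i j : ZMod N) := rfl

theorem slRed_slU (N : ℕ) (x : ℤ) : slRed N (slU x) = slU (x : ZMod N) := by
  apply sl_ext <;> simp [slRed_apply]

theorem slRed_slL (N : ℕ) (x : ℤ) : slRed N (slL x) = slL (x : ZMod N) := by
  apply sl_ext <;> simp [slRed_apply]

theorem slRed_surjective (N : ℕ) [NeZero N] : Function.Surjective (slRed N) := by
  rw [← MonoidHom.range_eq_top]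
  refine subgroup_eq_top_of_slU_slL _ ⟨slU 1, ?_⟩ ⟨slL 1, ?_⟩
  · rw [slRed_slU, Int.cast_one]
  · rw [slRed_slL, Int.cast_one]

theorem subgroup_int_eq_top (H : Subgroup (SL₂ ℤ)) (hU : slU 1 ∈ H) (hL : slL 1 ∈ H) :
    H = ⊤ := by
  rw [eq_top_iff, ← SpecialLinearGroup.SL2Z_generators, Subgroup.closure_le]
  have hT : ModularGroup.T = slU 1 := by
    apply sl_ext <;> simp [ModularGroup.coe_T]
  have hS : ModularGroup.S = slU (-1) * slL 1 * slU (-1) := by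
    apply sl_ext <;> simp [ModularGroup.coe_S, sl_mul_apply]
  rintro _ (rfl | rfl)
  · rw [hS, slU_neg]
    exact H.mul_mem (H.mul_mem (H.inv_mem hU) hL) (H.inv_mem hU)
  · rw [hT]
    exact hU

theorem card_sl_le (N : ℕ) [NeZero N] : Fintype.card (SL₂ (ZMod N)) ≤ N ^ 3 := by
  classical
  have h := Finset.card_le_mul_card_image_of_maps_to
    (s := (Finset.univ : Finset (SL₂ (ZMod N))))
    (f := fun g ↦ (g 0 0, g 1 0)) (t := (Finset.univ : Finset (ZMod N × ZMod N)))
    (fun _ _ ↦ Finset.mem_univ _) N ?_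
  · rw [Finset.card_univ, Finset.card_univ, Fintype.card_prod, ZMod.card] at h
    linarith
  · rintro ⟨a, c⟩ -
    rcases Finset.eq_empty_or_nonempty
      (Finset.univ.filter fun g : SL₂ (ZMod N) ↦ (g 0 0, g 1 0) = (a, c)) with h | ⟨g, hg⟩
    · rw [h]; simp
    have := Finset.card_le_card_of_injOn
      (s := Finset.univ.filter fun g : SL₂ (ZMod N) ↦ (g 0 0, g 1 0) = (a, c))
      (t := (Finset.univ : Finset (ZMod N)))
      (fun h ↦ g 1 1 * h 0 1 - g 0 1 * h 1 1)
      (fun _ _ ↦ by simp) ?_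
    · simpa using this
    · intro x hx y hy hxy
      simp only [Finset.coe_filter, Finset.mem_filter, Finset.mem_univ, true_and,
        Set.mem_ofPred_eq, Prod.mk.injEq] at hg hx hy hxy
      have dg := sl_det g
      have dx := sl_det x
      have dy := sl_det y
      rw [hg.1, hg.2] at dg
      rw [hx.1, hx.2] at dx
      rw [hy.1, hy.2] at dy
      apply sl_ext
      · rw [hx.1, hy.1]
      · linear_combination (y 0 1 - x 0 1) * dg + a * hxy + g 0 1 * dx - g 0 1 * dy
      · rw [hx.2, hy.2]
      · linear_combination (y 1 1 - x 1 1) * dg + c * hxy + g 1 1 * dx - g 1 1 * dy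

end SLTwo

theorem finite_sl_ball (R : ℕ) : {g : SL₂ ℤ | ∀ i j, |g i j| ≤ (R : ℤ)}.Finite := by
  refine Set.Finite.of_finite_image (f := fun g : SL₂ ℤ ↦ (g : Matrix (Fin 2) (Fin 2) ℤ)) ?_
    (fun _ _ _ _ h ↦ Subtype.ext h)
  refine (Set.Finite.pi (fun _ : Fin 2 ↦ Set.Finite.pi
    (fun _ : Fin 2 ↦ Set.finite_Icc (-(R : ℤ)) R))).subset ?_
  rintro _ ⟨g, hg, rfl⟩ i - j -
  exact abs_le.1 (hg i j)

/-- The elements of `SL₂(ℤ)` with all entries bounded by `R`. -/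
noncomputable def slBall (R : ℕ) : Finset (SL₂ ℤ) := (finite_sl_ball R).toFinset

theorem mem_slBall {R : ℕ} {g : SL₂ ℤ} : g ∈ slBall R ↔ ∀ i j, |g i j| ≤ (R : ℤ) := by
  simp [slBall]

theorem inv_mem_slBall {R : ℕ} {g : SL₂ ℤ} (hg : g ∈ slBall R) : g⁻¹ ∈ slBall R := by
  rw [mem_slBall] at *
  intro i j
  fin_cases i <;> fin_cases j <;>
    simp only [Fin.zero_eta, Fin.mk_one, sl_inv_00, sl_inv_01, sl_inv_10, sl_inv_11, abs_neg] <;>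
    apply hg

theorem abs_add_add_le_twelve {T P a b σ n n' : ℝ} (hT : 0 < T) (hP : |P| ≤ 4 * T)
    (ha : |a| ≤ 4 * T) (hb : |b| ≤ 4 * T) (hσ : |σ| ≤ 1 / T) (hn : T ≤ n) (hn' : T ≤ n') :
    |P * σ + a / n + b / n'| ≤ 12 := by
  have h1 : |P * σ| ≤ 4 := by
    rw [abs_mul]
    calc |P| * |σ| ≤ (4 * T) * (1 / T) := by gcongr
      _ = 4 := by field_simp
  have h2 : ∀ a n : ℝ, |a| ≤ 4 * T → T ≤ n → |a / n| ≤ 4 := by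
    intro a n ha hn
    rw [abs_div, abs_of_pos (hT.trans_le hn), div_le_iff₀ (hT.trans_le hn)]
    linarith
  calc |P * σ + a / n + b / n'| ≤ |P * σ| + |a / n| + |b / n'| := abs_add_three _ _ _
    _ ≤ 4 + 4 + 4 := by gcongr; exacts [h2 _ _ ha hn, h2 _ _ hb hn']
    _ = 12 := by norm_num

theorem abs_mul_le_of_sq_le {p q T : ℝ} (hp : p ^ 2 ≤ T) (hq : q ^ 2 ≤ T) : |p * q| ≤ T := by
  rw [abs_le]
  constructor <;> nlinarith [sq_nonneg (p + q), sq_nonneg (p - q)]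

section Action

variable (x y : ℤ) (b : SL₂ ℤ)

/-- The squared length of `b (x, y)`. -/
def slN : ℝ := ((b 0 0 * x + b 0 1 * y : ℤ) : ℝ) ^ 2 + ((b 1 0 * x + b 1 1 * y : ℤ) : ℝ) ^ 2

/-- The inner product of `b (x, y)` and `b (-y, x)`, normalized. -/
noncomputable def slTau : ℝ :=
  (((b 0 0 * x + b 0 1 * y : ℤ) : ℝ) * ((b 0 1 * x - b 0 0 * y : ℤ) : ℝ) +
    ((b 1 0 * x + b 1 1 * y : ℤ) : ℝ) * ((b 1 1 * x - b 1 0 * y : ℤ) : ℝ)) /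
    (slN x y b * ((x : ℝ) ^ 2 + (y : ℝ) ^ 2))

variable {x y}

theorem slN_le {R : ℕ} (hb : b ∈ slBall R) :
    slN x y b ≤ 4 * R ^ 2 * ((x : ℝ) ^ 2 + (y : ℝ) ^ 2) := by
  rw [mem_slBall] at hb
  have aux : ∀ p q : ℤ, |p| ≤ (R : ℤ) → |q| ≤ (R : ℤ) →
      ((p * x + q * y : ℤ) : ℝ) ^ 2 ≤ 2 * R ^ 2 * ((x : ℝ) ^ 2 + (y : ℝ) ^ 2) := by
    intro p q hp hq
    have hp' : (p : ℝ) ^ 2 ≤ (R : ℝ) ^ 2 := by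
      have : p ^ 2 ≤ (R : ℤ) ^ 2 := sq_le_sq.2 (by simpa using hp)
      exact_mod_cast this
    have hq' : (q : ℝ) ^ 2 ≤ (R : ℝ) ^ 2 := by
      have : q ^ 2 ≤ (R : ℤ) ^ 2 := sq_le_sq.2 (by simpa using hq)
      exact_mod_cast this
    push_cast
    nlinarith [sq_nonneg ((p : ℝ) * y - q * x), sq_nonneg (x : ℝ), sq_nonneg (y : ℝ)]
  have h1 := aux _ _ (hb 0 0) (hb 0 1)
  have h2 := aux _ _ (hb 1 0) (hb 1 1)
  rw [slN]
  linarith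

theorem sl_det_real : (b 0 0 : ℝ) * b 1 1 - b 0 1 * b 1 0 = 1 := by
  exact_mod_cast sl_det b

theorem le_slN {R : ℕ} (hb : b ∈ slBall R) :
    (x : ℝ) ^ 2 + (y : ℝ) ^ 2 ≤ 4 * R ^ 2 * slN x y b := by
  have h := slN_le (x := b 0 0 * x + b 0 1 * y) (y := b 1 0 * x + b 1 1 * y) b⁻¹ (inv_mem_slBall hb)
  have hd := sl_det b
  have e : slN (b 0 0 * x + b 0 1 * y) (b 1 0 * x + b 1 1 * y) b⁻¹ = (x : ℝ) ^ 2 + (y : ℝ) ^ 2 := by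
    rw [slN, sl_inv_00, sl_inv_01, sl_inv_10, sl_inv_11]
    congr 3
    · linear_combination x * hd
    · linear_combination y * hd
  rw [e] at h
  exact h

theorem one_le_slN (hxy : x ^ 2 + y ^ 2 ≠ 0) : 1 ≤ slN x y b := by
  have hd := sl_det b
  have : (1 : ℤ) ≤ (b 0 0 * x + b 0 1 * y) ^ 2 + (b 1 0 * x + b 1 1 * y) ^ 2 := by
    by_contra! h
    have h1 : b 0 0 * x + b 0 1 * y = 0 := by nlinarith
    have h2 : b 1 0 * x + b 1 1 * y = 0 := by nlinarith
    apply hxy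
    have hx : x = 0 := by linear_combination (-x) * hd + b 1 1 * h1 - b 0 1 * h2
    have hy : y = 0 := by linear_combination (-y) * hd - b 1 0 * h1 + b 0 0 * h2
    rw [hx, hy]
    norm_num
  rw [slN]
  exact_mod_cast this

theorem abs_slTau_le {R : ℕ} (hxy : x ^ 2 + y ^ 2 ≠ 0) (hb : b ∈ slBall R) :
    |slTau x y b| ≤ 2 * R / (√(slN x y b) * √((x : ℝ) ^ 2 + (y : ℝ) ^ 2)) := by
  have h0 := one_le_slN b hxy
  have hv : (0 : ℝ) < (x : ℝ) ^ 2 + (y : ℝ) ^ 2 := by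
    have : 0 < x ^ 2 + y ^ 2 := lt_of_le_of_ne (by positivity) hxy.symm
    exact_mod_cast this
  have hu := slN_le (x := -y) (y := x) b hb
  have hcs : |((b 0 0 * x + b 0 1 * y : ℤ) : ℝ) * ((b 0 1 * x - b 0 0 * y : ℤ) : ℝ) +
      ((b 1 0 * x + b 1 1 * y : ℤ) : ℝ) * ((b 1 1 * x - b 1 0 * y : ℤ) : ℝ)| ≤
      2 * R * (√(slN x y b) * √((x : ℝ) ^ 2 + (y : ℝ) ^ 2)) := by
    apply abs_le_of_sq_le_sq _ (by positivity)
    rw [mul_pow, mul_pow, mul_pow, Real.sq_sqrt (by linarith), Real.sq_sqrt hv.le]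
    have h1 : (((b 0 0 * x + b 0 1 * y : ℤ) : ℝ) * ((b 0 1 * x - b 0 0 * y : ℤ) : ℝ) +
      ((b 1 0 * x + b 1 1 * y : ℤ) : ℝ) * ((b 1 1 * x - b 1 0 * y : ℤ) : ℝ)) ^ 2 ≤
      slN x y b * slN (-y) x b := by
      rw [slN, slN]
      push_cast
      nlinarith [sq_nonneg (((b 0 0 : ℝ) * x + b 0 1 * y) * (b 1 1 * x - b 1 0 * y) -
        (b 1 0 * x + b 1 1 * y) * (b 0 1 * x - b 0 0 * y))]
    refine h1.trans ?_
    push_cast at hu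
    nlinarith
  rw [slTau, abs_div, abs_of_pos (mul_pos (by linarith) hv), div_le_div_iff₀
    (mul_pos (by linarith) hv) (by positivity)]
  calc _ ≤ 2 * R * (√(slN x y b) * √((x : ℝ) ^ 2 + (y : ℝ) ^ 2)) *
      (√(slN x y b) * √((x : ℝ) ^ 2 + (y : ℝ) ^ 2)) := by gcongr
    _ = 2 * R * (√(slN x y b) ^ 2 * √((x : ℝ) ^ 2 + (y : ℝ) ^ 2) ^ 2) := by ring
    _ = _ := by rw [Real.sq_sqrt (by linarith), Real.sq_sqrt hv.le]

theorem mul_inv_mem_slBall {b b' : SL₂ ℤ} {T : ℝ} (hT : 0 < T) (hxy : x ^ 2 + y ^ 2 ≠ 0)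
    (h1 : T ≤ slN x y b) (h2 : slN x y b ≤ 4 * T) (h1' : T ≤ slN x y b') (h2' : slN x y b' ≤ 4 * T)
    (hτ : |slTau x y b - slTau x y b'| ≤ 1 / T) : b' * b⁻¹ ∈ slBall 12 := by
  have hv : (0 : ℝ) < (x : ℝ) ^ 2 + (y : ℝ) ^ 2 := by
    have : 0 < x ^ 2 + y ^ 2 := lt_of_le_of_ne (by positivity) hxy.symm
    exact_mod_cast this
  have hu : ∀ b : SL₂ ℤ, 0 < slN x y b →
      ((b 0 1 : ℝ) * x - b 0 0 * y) / ((x : ℝ) ^ 2 + (y : ℝ) ^ 2) =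
        slTau x y b * (b 0 0 * x + b 0 1 * y) - (b 1 0 * x + b 1 1 * y) / slN x y b ∧
      ((b 1 1 : ℝ) * x - b 1 0 * y) / ((x : ℝ) ^ 2 + (y : ℝ) ^ 2) =
        slTau x y b * (b 1 0 * x + b 1 1 * y) + (b 0 0 * x + b 0 1 * y) / slN x y b := by
    intro b hb
    have hd := sl_det_real b
    have hN : slN x y b =
        ((b 0 0 : ℝ) * x + b 0 1 * y) ^ 2 + ((b 1 0 : ℝ) * x + b 1 1 * y) ^ 2 := by
      rw [slN]; push_cast; rfl
    constructor
    · rw [slTau]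
      field_simp
      rw [hN]
      push_cast
      linear_combination (-((x : ℝ) ^ 2 + (y : ℝ) ^ 2) * (b 1 0 * x + b 1 1 * y)) * hd
    · rw [slTau]
      field_simp
      rw [hN]
      push_cast
      linear_combination (((x : ℝ) ^ 2 + (y : ℝ) ^ 2) * (b 0 0 * x + b 0 1 * y)) * hd
  obtain ⟨u1, u2⟩ := hu b (hT.trans_le h1)
  obtain ⟨u1', u2'⟩ := hu b' (hT.trans_le h1')
  have hw : ∀ b : SL₂ ℤ, slN x y b ≤ 4 * T → ((b 0 0 : ℝ) * x + b 0 1 * y) ^ 2 ≤ 4 * T ∧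
      ((b 1 0 : ℝ) * x + b 1 1 * y) ^ 2 ≤ 4 * T := by
    intro b hb
    rw [slN] at hb
    push_cast at hb
    constructor <;> nlinarith [sq_nonneg ((b 0 0 : ℝ) * x + b 0 1 * y),
      sq_nonneg ((b 1 0 : ℝ) * x + b 1 1 * y)]
  obtain ⟨w1, w2⟩ := hw b h2
  obtain ⟨w1', w2'⟩ := hw b' h2'
  have hid : ∀ p q r s : ℝ, r * q - s * p = (r * x + s * y) * ((q * x - p * y) /
      ((x : ℝ) ^ 2 + (y : ℝ) ^ 2)) - ((s * x - r * y) / ((x : ℝ) ^ 2 + (y : ℝ) ^ 2)) *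
        (p * x + q * y) := by
    intro p q r s
    field_simp
    ring
  have fin : ∀ z : ℤ, |(z : ℝ)| ≤ 12 → |z| ≤ ((12 : ℕ) : ℤ) := fun z hz ↦ by exact_mod_cast hz
  rw [mem_slBall]
  intro i j
  fin_cases i <;> fin_cases j <;> apply fin <;>
    simp only [Fin.zero_eta, Fin.mk_one, sl_mul_apply, sl_inv_00, sl_inv_01, sl_inv_10, sl_inv_11]
    <;> push_cast
  · have := abs_add_add_le_twelve hT (abs_mul_le_of_sq_le w1' w2) (abs_mul_le_of_sq_le w1' w1)
      (abs_mul_le_of_sq_le w2' w2) hτ h1 h1'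
    convert this using 2
    have e := hid (b 1 0) (b 1 1) (b' 0 0) (b' 0 1)
    rw [u1', u2] at e
    linear_combination e
  · have := abs_add_add_le_twelve hT (P := -_) (b := -_)
      ((abs_neg _).trans_le (abs_mul_le_of_sq_le w1' w1)) (abs_mul_le_of_sq_le w1' w2)
      ((abs_neg _).trans_le (abs_mul_le_of_sq_le w2' w1)) hτ h1 h1'
    convert this using 2
    have e := hid (b 0 0) (b 0 1) (b' 0 0) (b' 0 1)
    rw [u1', u1] at e
    linear_combination -e
  · have := abs_add_add_le_twelve hT (b := -_) (abs_mul_le_of_sq_le w2' w2)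
      (abs_mul_le_of_sq_le w2' w1)
      ((abs_neg _).trans_le (abs_mul_le_of_sq_le w1' w2)) hτ h1 h1'
    convert this using 2
    have e := hid (b 1 0) (b 1 1) (b' 1 0) (b' 1 1)
    rw [u2', u2] at e
    linear_combination e
  · have := abs_add_add_le_twelve hT (P := -_)
      ((abs_neg _).trans_le (abs_mul_le_of_sq_le w2' w1)) (abs_mul_le_of_sq_le w2' w2)
      (abs_mul_le_of_sq_le w1' w1) hτ h1 h1'
    convert this using 2
    have e := hid (b 0 0) (b 0 1) (b' 1 0) (b' 1 1)
    rw [u2', u1] at e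
    linear_combination -e

end Action

/-- The number of dyadic scales met by `‖b v‖²`, `b ∈ slBall R`. -/
def slScales (R : ℕ) : ℕ := Nat.log 4 (64 * R ^ 4) + 1

/-- The bound for the growth of `Σ 1/‖b v‖` over `b ∈ slBall R`. -/
noncomputable def slLam (R : ℕ) : ℝ := 12 * (slBall 12).card * R * slScales R

theorem card_slice_le {R : ℕ} {x y : ℤ} (hxy : x ^ 2 + y ^ 2 ≠ 0) (i : ℕ)
    (S : Finset (SL₂ ℤ)) (hS : S ⊆ slBall R)
    (h1 : ∀ b ∈ S, (4 : ℝ) ^ i ≤ slN x y b) (h2 : ∀ b ∈ S, slN x y b < 4 * 4 ^ i) :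
    (S.card : ℝ) ≤ (slBall 12).card * (4 * R * 2 ^ i / √((x : ℝ) ^ 2 + (y : ℝ) ^ 2) + 2) := by
  classical
  set V := √((x : ℝ) ^ 2 + (y : ℝ) ^ 2) with hV
  have hVpos : 0 < V := by
    rw [hV, Real.sqrt_pos]
    have : 0 < x ^ 2 + y ^ 2 := lt_of_le_of_ne (by positivity) hxy.symm
    exact_mod_cast this
  set X : ℝ := 2 * R * 2 ^ i / V with hX
  have hX0 : 0 ≤ X := by positivity
  have h4 : (4 : ℝ) ^ i = 2 ^ i * 2 ^ i := by rw [← mul_pow]; norm_num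
  have hcard := Finset.card_le_mul_card_image_of_maps_to (s := S)
    (f := fun b ↦ ⌊(4 : ℝ) ^ i * slTau x y b⌋) (t := Finset.Icc ⌊-X⌋ ⌊X⌋) ?_ (slBall 12).card ?_
  · have hcard' : (S.card : ℝ) ≤ (slBall 12).card * (Finset.Icc ⌊-X⌋ ⌊X⌋).card := by
      exact_mod_cast hcard
    refine hcard'.trans ?_
    gcongr
    have hle : ⌊-X⌋ ≤ ⌊X⌋ + 1 := (Int.floor_mono (by linarith : -X ≤ X)).trans (by linarith)
    have : ((Finset.Icc ⌊-X⌋ ⌊X⌋).card : ℝ) = ⌊X⌋ + 1 - ⌊-X⌋ := by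
      rw [Int.card_Icc]
      have : (((⌊X⌋ + 1 - ⌊-X⌋).toNat : ℤ) : ℝ) = ((⌊X⌋ + 1 - ⌊-X⌋ : ℤ) : ℝ) := by
        rw [Int.toNat_of_nonneg (by linarith)]
      push_cast at this
      exact this
    rw [this]
    have e : 4 * R * 2 ^ i / V = 2 * X := by rw [hX]; ring
    rw [e]
    linarith [Int.floor_le X, Int.lt_floor_add_one (-X)]
  · intro b hb
    have hb1 := abs_slTau_le b hxy (hS hb)
    rw [← hV] at hb1
    have hn : (2 : ℝ) ^ i ≤ √(slN x y b) := by
      apply Real.le_sqrt_of_sq_le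
      rw [sq, ← h4]
      exact h1 b hb
    have hb2 : |(4 : ℝ) ^ i * slTau x y b| ≤ X := by
      rw [abs_mul, abs_of_pos (by positivity), hX]
      calc (4 : ℝ) ^ i * |slTau x y b| ≤ 4 ^ i * (2 * R / (√(slN x y b) * V)) := by gcongr
        _ ≤ 4 ^ i * (2 * R / (2 ^ i * V)) := by gcongr
        _ = 2 * R * 2 ^ i / V := by rw [h4]; field_simp
    rw [abs_le] at hb2
    exact Finset.mem_Icc.2 ⟨Int.floor_mono hb2.1, Int.floor_mono hb2.2⟩
  · intro j _
    rcases Finset.eq_empty_or_nonempty (S.filter fun b ↦ ⌊(4 : ℝ) ^ i * slTau x y b⌋ = j)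
      with h | ⟨b, hb⟩
    · rw [h]; simp
    refine Finset.card_le_card_of_injOn (fun b' ↦ b' * b⁻¹) ?_ (fun _ _ _ _ h ↦ by simpa using h)
    intro b' hb'
    simp only [Finset.coe_filter, Finset.mem_filter, Set.mem_ofPred_eq] at hb hb'
    refine mul_inv_mem_slBall (T := 4 ^ i) (by positivity) hxy (h1 b hb.1) (h2 b hb.1).le
      (h1 b' hb'.1) (h2 b' hb'.1).le ?_
    have := Int.abs_sub_lt_one_of_floor_eq_floor (hb.2.trans hb'.2.symm)
    rw [← mul_sub, abs_mul, abs_of_pos (by positivity)] at this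
    rw [le_div_iff₀ (by positivity)]
    linarith

theorem sum_inv_sqrt_slN_le {R : ℕ} {x y : ℤ} (hxy : x ^ 2 + y ^ 2 ≠ 0) :
    ∑ b ∈ slBall R, 1 / √(slN x y b) ≤ slLam R * (1 / √((x : ℝ) ^ 2 + (y : ℝ) ^ 2)) := by
  classical
  set V := √((x : ℝ) ^ 2 + (y : ℝ) ^ 2) with hV
  have hV2 : V ^ 2 = (x : ℝ) ^ 2 + (y : ℝ) ^ 2 := Real.sq_sqrt (by positivity)
  have hVpos : 0 < V := by
    rw [hV, Real.sqrt_pos]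
    have : 0 < x ^ 2 + y ^ 2 := lt_of_le_of_ne (by positivity) hxy.symm
    exact_mod_cast this
  set I : SL₂ ℤ → ℕ := fun b ↦ Nat.log 4 ⌊slN x y b⌋₊ with hI
  have hI1 : ∀ b, (4 : ℝ) ^ I b ≤ slN x y b := by
    intro b
    have h1 := one_le_slN b hxy
    have : 4 ^ I b ≤ ⌊slN x y b⌋₊ := Nat.pow_log_le_self 4 (Nat.floor_pos.2 h1).ne'
    calc (4 : ℝ) ^ I b ≤ ⌊slN x y b⌋₊ := by exact_mod_cast this
      _ ≤ _ := Nat.floor_le (by linarith)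
  have hI2 : ∀ b, slN x y b < 4 * 4 ^ I b := by
    intro b
    have : ⌊slN x y b⌋₊ < 4 ^ (I b + 1) := Nat.lt_pow_succ_log_self (by norm_num) _
    calc slN x y b < ⌊slN x y b⌋₊ + 1 := Nat.lt_floor_add_one _
      _ ≤ 4 ^ (I b + 1) := by exact_mod_cast this
      _ = _ := by ring
  set J := (slBall R).image I with hJ
  have hJcard : J.card ≤ slScales R := by
    rcases J.eq_empty_or_nonempty with h | h
    · rw [h]; simp
    have : J ⊆ Finset.Icc (J.min' h) (J.min' h + Nat.log 4 (64 * R ^ 4)) := by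
      intro j hj
      rw [Finset.mem_Icc]
      refine ⟨J.min'_le j hj, ?_⟩
      obtain ⟨b, hb, hbj⟩ := Finset.mem_image.1 hj
      obtain ⟨c, hc, hcj⟩ := Finset.mem_image.1 (J.min'_mem h)
      rw [← hcj, ← hbj]
      have h3 : (4 : ℝ) ^ I b ≤ ((64 * R ^ 4 : ℕ) : ℝ) * 4 ^ I c := by
        calc (4 : ℝ) ^ I b ≤ slN x y b := hI1 b
          _ ≤ 4 * R ^ 2 * ((x : ℝ) ^ 2 + (y : ℝ) ^ 2) := slN_le b hb
          _ ≤ 4 * R ^ 2 * (4 * R ^ 2 * slN x y c) := by gcongr; exact le_slN c hc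
          _ ≤ 4 * R ^ 2 * (4 * R ^ 2 * (4 * 4 ^ I c)) := by gcongr; exact (hI2 c).le
          _ = _ := by push_cast; ring
      have h3' : 4 ^ I b ≤ (64 * R ^ 4) * 4 ^ I c := by exact_mod_cast h3
      rcases le_total (I b) (I c) with hle | hle
      · exact hle.trans (Nat.le_add_right _ _)
      · obtain ⟨k, hk⟩ := Nat.exists_eq_add_of_le hle
        rw [hk]
        rw [hk, pow_add, mul_comm] at h3'
        have h4 : 4 ^ k ≤ 64 * R ^ 4 := Nat.le_of_mul_le_mul_right h3' (by positivity)
        have h5 : 64 * R ^ 4 ≠ 0 := (lt_of_lt_of_le (by positivity) h4).ne'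
        have := Nat.le_log_of_pow_le (by norm_num) h4
        omega
    calc J.card ≤ _ := Finset.card_le_card this
      _ = slScales R := by rw [Nat.card_Icc, slScales]; omega
  have hslice : ∀ i ∈ J, ∑ b ∈ (slBall R).filter (fun b ↦ I b = i), 1 / √(slN x y b) ≤
      12 * (slBall 12).card * R * (1 / V) := by
    intro i hi
    obtain ⟨c, hc, hci⟩ := Finset.mem_image.1 hi
    have hm : ∀ b ∈ (slBall R).filter (fun b ↦ I b = i), b ∈ slBall R ∧ I b = i :=
      fun b hb ↦ Finset.mem_filter.1 hb
    have h4 : (4 : ℝ) ^ i = 2 ^ i * 2 ^ i := by rw [← mul_pow]; norm_num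
    have hcnt := card_slice_le hxy i ((slBall R).filter (fun b ↦ I b = i))
      (Finset.filter_subset _ _) (fun b hb ↦ (hm b hb).2 ▸ hI1 b) (fun b hb ↦ (hm b hb).2 ▸ hI2 b)
    rw [← hV] at hcnt
    have hVR : V ≤ 4 * R * 2 ^ i := by
      refine abs_le_of_sq_le_sq' ?_ (by positivity) |>.2
      rw [hV2]
      calc (x : ℝ) ^ 2 + (y : ℝ) ^ 2 ≤ 4 * R ^ 2 * slN x y c := le_slN c hc
        _ ≤ 4 * R ^ 2 * (4 * 4 ^ i) := by gcongr; rw [← hci]; exact (hI2 c).le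
        _ = (4 * R * 2 ^ i) ^ 2 := by rw [h4]; ring
    calc ∑ b ∈ (slBall R).filter (fun b ↦ I b = i), 1 / √(slN x y b)
        ≤ ∑ b ∈ (slBall R).filter (fun b ↦ I b = i), 1 / (2 : ℝ) ^ i := by
          refine Finset.sum_le_sum fun b hb ↦ ?_
          gcongr
          apply Real.le_sqrt_of_sq_le
          rw [sq, ← h4, ← (hm b hb).2]
          exact hI1 b
      _ = (((slBall R).filter (fun b ↦ I b = i)).card : ℝ) * (1 / 2 ^ i) := by
          rw [Finset.sum_const, nsmul_eq_mul]
      _ ≤ ((slBall 12).card * (4 * R * 2 ^ i / V + 2)) * (1 / 2 ^ i) := by gcongr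
      _ ≤ ((slBall 12).card * (4 * R * 2 ^ i / V + 2 * (4 * R * 2 ^ i / V))) * (1 / 2 ^ i) := by
          gcongr
          have : 1 ≤ 4 * R * 2 ^ i / V := by rwa [le_div_iff₀ hVpos, one_mul]
          linarith
      _ = _ := by field_simp; ring
  calc ∑ b ∈ slBall R, 1 / √(slN x y b)
      = ∑ i ∈ J, ∑ b ∈ (slBall R).filter (fun b ↦ I b = i), 1 / √(slN x y b) :=
        (Finset.sum_fiberwise_of_maps_to (fun b hb ↦ Finset.mem_image_of_mem I hb) _).symm
    _ ≤ ∑ i ∈ J, 12 * (slBall 12).card * R * (1 / V) := Finset.sum_le_sum hslice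
    _ = J.card * (12 * (slBall 12).card * R * (1 / V)) := by rw [Finset.sum_const, nsmul_eq_mul]
    _ ≤ slScales R * (12 * (slBall 12).card * R * (1 / V)) := by gcongr
    _ = _ := by rw [slLam]; ring

theorem exists_sl_of_coprime {a c : ℕ} (ha : 0 < a) (hc : c < a) (h : a.Coprime c) :
    ∃ g ∈ slBall a, g 0 0 = a ∧ g 1 0 = c := by
  obtain ⟨x, y, hxy⟩ := Nat.isCoprime_iff_coprime.2 h
  have ha' : (0 : ℤ) < a := by exact_mod_cast ha
  have hc' : (c : ℤ) + 1 ≤ a := by exact_mod_cast hc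
  set b : ℤ := (-y) % a with hb
  have hb0 : 0 ≤ b := Int.emod_nonneg _ ha'.ne'
  have hba : b + 1 ≤ a := Int.emod_lt_of_pos _ ha'
  obtain ⟨d, hd⟩ : (a : ℤ) ∣ 1 + b * c := by
    have : b = -y - a * (-y / a) := by rw [hb, Int.emod_def]
    exact ⟨x - c * (-y / a), by rw [this]; linear_combination -hxy⟩
  have hc0 : (0 : ℤ) ≤ c := by positivity
  have hd0 : 0 ≤ d := by
    by_contra! hlt
    nlinarith
  have hda : d ≤ a := by
    by_contra! hlt
    nlinarith
  refine ⟨slMk a b c d (by linarith), ?_, rfl, rfl⟩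
  rw [mem_slBall]
  intro i j
  fin_cases i <;> fin_cases j <;>
    simp only [Fin.zero_eta, Fin.mk_one, slMk_00, slMk_01, slMk_10, slMk_11] <;>
    rw [abs_of_nonneg (by linarith)] <;> linarith

theorem slBall_mono {R S : ℕ} (h : R ≤ S) : slBall R ⊆ slBall S := by
  intro g hg
  rw [mem_slBall] at *
  exact fun i j ↦ (hg i j).trans (by exact_mod_cast h)

theorem sum_totient_le_card_slBall (R : ℕ) :
    ∑ a ∈ Finset.Icc 1 R, a.totient ≤ (slBall R).card := by
  classical
  set T : Finset (Σ _ : ℕ, ℕ) := (Finset.Icc 1 R).sigma fun a ↦ (Finset.range a).filter a.Coprime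
  have hT : T.card = ∑ a ∈ Finset.Icc 1 R, a.totient := by
    rw [Finset.card_sigma]
    rfl
  rw [← hT]
  refine le_trans (Finset.card_le_card (t := (slBall R).image
    fun g ↦ (⟨(g 0 0).natAbs, (g 1 0).natAbs⟩ : Σ _ : ℕ, ℕ)) ?_) Finset.card_image_le
  rintro ⟨a, c⟩ hac
  simp only [T, Finset.mem_sigma, Finset.mem_Icc, Finset.mem_filter, Finset.mem_range] at hac
  obtain ⟨g, hg, h1, h2⟩ := exists_sl_of_coprime (by omega) hac.2.1 hac.2.2
  refine Finset.mem_image.2 ⟨g, slBall_mono hac.1.2 hg, ?_⟩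
  rw [h1, h2]
  simp

theorem exists_le_card_slBall {ε : ℝ} (hε : 0 < ε) :
    ∃ c : ℝ, 0 < c ∧ ∀ R : ℕ, 1 ≤ R → c * (R : ℝ) ^ (2 - ε) ≤ (slBall R).card := by
  obtain ⟨C, hC, h⟩ := exists_card_divisors_le hε
  refine ⟨1 / (2 * C), by positivity, fun R hR ↦ ?_⟩
  have hR0 : (0 : ℝ) < R := by exact_mod_cast hR
  have h1 : ∀ a ∈ Finset.Icc 1 R, (a : ℝ) / (C * (R : ℝ) ^ ε) ≤ a.totient := by
    intro a ha
    rw [Finset.mem_Icc] at ha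
    rw [div_le_iff₀ (by positivity)]
    have := le_totient_mul_card_divisors a (by omega)
    have hd : (a.divisors.card : ℝ) ≤ C * (R : ℝ) ^ ε := by
      refine (h a (by omega)).trans ?_
      have : (a : ℝ) ≤ R := by exact_mod_cast ha.2
      gcongr
    calc (a : ℝ) ≤ a.divisors.card * a.totient := by exact_mod_cast this
      _ ≤ (C * (R : ℝ) ^ ε) * a.totient := by gcongr
      _ = _ := mul_comm _ _
  have h2 : (R : ℝ) ^ 2 / 2 ≤ ∑ a ∈ Finset.Icc 1 R, (a : ℝ) := by
    clear h1
    induction R, hR using Nat.le_induction with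
    | base => norm_num
    | succ n hn ih =>
      rw [Finset.sum_Icc_succ_top (by omega)]
      have := ih (by positivity)
      push_cast
      nlinarith
  calc 1 / (2 * C) * (R : ℝ) ^ (2 - ε) = (R : ℝ) ^ 2 / 2 / (C * (R : ℝ) ^ ε) := by
        rw [Real.rpow_sub hR0, Real.rpow_two]
        field_simp
    _ ≤ (∑ a ∈ Finset.Icc 1 R, (a : ℝ)) / (C * (R : ℝ) ^ ε) := by gcongr
    _ = ∑ a ∈ Finset.Icc 1 R, (a : ℝ) / (C * (R : ℝ) ^ ε) := Finset.sum_div _ _ _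
    _ ≤ ∑ a ∈ Finset.Icc 1 R, (a.totient : ℝ) := Finset.sum_le_sum h1
    _ ≤ _ := by exact_mod_cast sum_totient_le_card_slBall R

theorem slScales_le {R : ℕ} (hR : 1 ≤ R) :
    (slScales R : ℝ) ≤ 12801 * (R : ℝ) ^ (1 / 50 : ℝ) := by
  have hR0 : (1 : ℝ) ≤ R := by exact_mod_cast hR
  have h1 : (Nat.log 4 (64 * R ^ 4) : ℝ) ≤ Real.log (64 * R ^ 4) := by
    have h2 := Nat.pow_log_le_self 4 (x := 64 * R ^ 4) (by positivity)
    have h3 : ((4 : ℝ)) ^ (Nat.log 4 (64 * R ^ 4)) ≤ 64 * R ^ 4 := by exact_mod_cast h2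
    rw [Real.le_log_iff_exp_le (by positivity)]
    refine le_trans ?_ h3
    rw [← mul_one (Nat.log 4 (64 * R ^ 4) : ℝ), Real.exp_nat_mul]
    gcongr
    exact (Real.exp_one_lt_d9.le).trans (by norm_num)
  have h2 : Real.log (64 * R ^ 4) ≤ 12800 * (R : ℝ) ^ (1 / 50 : ℝ) := by
    refine (Real.log_le_rpow_div (by positivity) (ε := 1 / 200) (by norm_num)).trans ?_
    rw [Real.mul_rpow (by norm_num) (by positivity), ← Real.rpow_natCast, ← Real.rpow_mul
      (by positivity)]
    norm_num
    have : (64 : ℝ) ^ (1 / 200 : ℝ) ≤ 64 ^ (1 : ℝ) :=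
      Real.rpow_le_rpow_of_exponent_le (by norm_num) (by norm_num)
    rw [Real.rpow_one] at this
    have h0 : 0 ≤ (R : ℝ) ^ (1 / 50 : ℝ) := by positivity
    nlinarith
  have h3 : 1 ≤ (R : ℝ) ^ (1 / 50 : ℝ) := Real.one_le_rpow hR0 (by norm_num)
  rw [slScales]
  push_cast
  linarith

/-- For some radius `R`, the average of `‖v‖/‖b v‖` over `slBall R` is almost as small as
`1/R`. -/
theorem exists_slLam_le :
    ∃ R : ℕ, 1 ≤ R ∧ slLam R ≤ (slBall R).card * (2 * R : ℝ) ^ (-(19 / 20) : ℝ) := by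
  obtain ⟨c, hc, h⟩ := exists_le_card_slBall (ε := 1 / 100) (by norm_num)
  set K : ℝ := 12 * (slBall 12).card * 12801 * 2 / c
  have ht : Filter.Tendsto (fun n : ℕ ↦ (n : ℝ) ^ (1 / 50 : ℝ)) Filter.atTop Filter.atTop :=
    (tendsto_rpow_atTop (by norm_num)).comp tendsto_natCast_atTop_atTop
  obtain ⟨R, hRK, hR⟩ := ((ht.eventually_ge_atTop K).and (Filter.eventually_ge_atTop 1)).exists
  have hR0 : (0 : ℝ) < R := by exact_mod_cast hR
  refine ⟨R, hR, ?_⟩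
  have h1 := h R hR
  have h2 : (1 / 2 : ℝ) ≤ 2 ^ (-(19 / 20) : ℝ) := by
    rw [show (1 / 2 : ℝ) = 2 ^ (-1 : ℝ) by norm_num [Real.rpow_neg_one]]
    exact Real.rpow_le_rpow_of_exponent_le (by norm_num) (by norm_num)
  rw [Real.mul_rpow (by norm_num) hR0.le]
  calc slLam R ≤ 12 * (slBall 12).card * R * (12801 * (R : ℝ) ^ (1 / 50 : ℝ)) := by
        rw [slLam]; gcongr; exact slScales_le hR
    _ = c / 2 * K * (R * (R : ℝ) ^ (1 / 50 : ℝ)) := by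
        simp only [K]; field_simp
    _ ≤ c / 2 * (R : ℝ) ^ (1 / 50 : ℝ) * (R * (R : ℝ) ^ (1 / 50 : ℝ)) := by gcongr
    _ = c / 2 * ((R : ℝ) ^ (1 / 50 : ℝ) * ((R : ℝ) ^ (1 : ℝ) * (R : ℝ) ^ (1 / 50 : ℝ))) := by
        rw [Real.rpow_one]; ring
    _ = c / 2 * (R : ℝ) ^ (1 / 50 + (1 + 1 / 50) : ℝ) := by
        rw [Real.rpow_add hR0, Real.rpow_add hR0]
    _ ≤ c / 2 * (R : ℝ) ^ (2 - 1 / 100 + -(19 / 20) : ℝ) := by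
        exact mul_le_mul_of_nonneg_left (Real.rpow_le_rpow_of_exponent_le
          (by exact_mod_cast hR) (by norm_num)) (by positivity)
    _ = (c * (R : ℝ) ^ (2 - 1 / 100 : ℝ)) * (1 / 2 * (R : ℝ) ^ (-(19 / 20) : ℝ)) := by
        rw [Real.rpow_add hR0]; ring
    _ ≤ (slBall R).card * (2 ^ (-(19 / 20) : ℝ) * (R : ℝ) ^ (-(19 / 20) : ℝ)) := by gcongr

theorem sum_le_two_mul_sum_fibers {ι : Type*} (S : Finset ι) (w : ι → ℝ) (α : ι → ℤ) (A : ℕ)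
    (F : ℕ → ℝ) {W : ℝ} (hW : 0 ≤ W) (hα : ∀ h ∈ S, α h ≠ 0 ∧ (α h).natAbs ≤ A)
    (hF : ∀ z : ℤ, z ≠ 0 → ((S.filter fun h ↦ α h = z).card : ℝ) ≤ F z.natAbs)
    (hw : ∀ h ∈ S, w h ≤ W / (α h).natAbs) :
    ∑ h ∈ S, w h ≤ 2 * ∑ k ∈ Finset.Icc 1 A, F k * (W / k) := by
  classical
  rw [← Finset.sum_fiberwise_of_maps_to (g := fun h ↦ (α h).natAbs) (t := Finset.Icc 1 A)
    (fun h hh ↦ Finset.mem_Icc.2 ⟨Int.natAbs_pos.2 (hα h hh).1, (hα h hh).2⟩), Finset.mul_sum]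
  refine Finset.sum_le_sum fun k hk ↦ ?_
  have hk1 : 1 ≤ k := (Finset.mem_Icc.1 hk).1
  have hcard : ((S.filter fun h ↦ (α h).natAbs = k).card : ℝ) ≤ 2 * F k := by
    have h1 : (S.filter fun h ↦ (α h).natAbs = k) ⊆
        (S.filter fun h ↦ α h = k) ∪ (S.filter fun h ↦ α h = -k) := by
      intro h hh
      simp only [Finset.mem_union, Finset.mem_filter] at hh ⊢
      rcases Int.natAbs_eq (α h) with e | e <;> rw [hh.2] at e
      · exact Or.inl ⟨hh.1, e⟩
      · exact Or.inr ⟨hh.1, e⟩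
    have h2 := hF k (by exact_mod_cast Nat.one_le_iff_ne_zero.1 hk1)
    have h3 := hF (-k) (by simpa using Nat.one_le_iff_ne_zero.1 hk1)
    rw [Int.natAbs_neg] at h3
    rw [Int.natAbs_natCast] at h2 h3
    have h4 : ((S.filter fun h ↦ (α h).natAbs = k).card : ℝ) ≤
        (S.filter fun h ↦ α h = k).card + (S.filter fun h ↦ α h = -k).card := by
      exact_mod_cast (Finset.card_le_card h1).trans (Finset.card_union_le _ _)
    linarith
  calc ∑ h ∈ S.filter (fun h ↦ (α h).natAbs = k), w h
      ≤ ∑ h ∈ S.filter (fun h ↦ (α h).natAbs = k), W / k := by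
        refine Finset.sum_le_sum fun h hh ↦ ?_
        rw [Finset.mem_filter] at hh
        exact hh.2 ▸ hw h hh.1
    _ = (S.filter fun h ↦ (α h).natAbs = k).card * (W / k) := by
        rw [Finset.sum_const, nsmul_eq_mul]
    _ ≤ 2 * F k * (W / k) := by gcongr
    _ = _ := by ring

theorem sum_Icc_inv_le {A Y : ℕ} (hA : A ≤ Y) :
    ∑ k ∈ Finset.Icc 1 A, (1 : ℝ) / k ≤ 1 + Real.log Y := by
  have h1 : ∑ k ∈ Finset.Icc 1 A, (1 : ℝ) / k ≤ ∑ k ∈ Finset.Icc 1 Y, (1 : ℝ) / k :=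
    Finset.sum_le_sum_of_subset_of_nonneg (Finset.Icc_subset_Icc_right hA)
      fun _ _ _ ↦ by positivity
  have h2 := harmonic_le_one_add_log Y
  rw [harmonic_eq_sum_Icc] at h2
  push_cast at h2
  simp only [one_div] at h1 ⊢
  exact h1.trans h2

theorem card_int_divisors_le (S : Finset ℤ) {m : ℤ} (hm : m ≠ 0) (hS : ∀ z ∈ S, z ∣ m) :
    S.card ≤ 2 * m.natAbs.divisors.card := by
  classical
  have : S ⊆ (m.natAbs.divisors.image fun d : ℕ ↦ (d : ℤ)) ∪
      (m.natAbs.divisors.image fun d : ℕ ↦ -(d : ℤ)) := by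
    intro z hz
    have h1 : z.natAbs ∈ m.natAbs.divisors := by
      rw [Nat.mem_divisors]
      exact ⟨Int.natAbs_dvd_natAbs.2 (hS z hz), Int.natAbs_ne_zero.2 hm⟩
    rw [Finset.mem_union, Finset.mem_image, Finset.mem_image]
    rcases Int.natAbs_eq z with e | e
    · exact Or.inl ⟨_, h1, e.symm⟩
    · exact Or.inr ⟨_, h1, e.symm⟩
  refine (Finset.card_le_card this).trans ((Finset.card_union_le _ _).trans ?_)
  rw [two_mul]
  exact add_le_add Finset.card_image_le Finset.card_image_le

theorem exists_of_slRed_eq_one {N : ℕ} {h : SL₂ ℤ} (hh : slRed N h = 1) :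
    ∃ a b c d : ℤ, h 0 0 = 1 + N * a ∧ h 0 1 = N * b ∧ h 1 0 = N * c ∧ h 1 1 = 1 + N * d := by
  have key : ∀ i j, (N : ℤ) ∣ h i j - (1 : SL₂ ℤ) i j := by
    intro i j
    rw [← ZMod.intCast_zmod_eq_zero_iff_dvd]
    have := slRed_apply N h i j
    have h1 := slRed_apply N 1 i j
    rw [map_one] at h1
    rw [hh] at this
    push_cast
    rw [← this, ← h1, sub_self]
  obtain ⟨a, ha⟩ := key 0 0
  obtain ⟨b, hb⟩ := key 0 1
  obtain ⟨c, hc⟩ := key 1 0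
  obtain ⟨d, hd⟩ := key 1 1
  rw [sl_one_00] at ha
  rw [sl_one_01, sub_zero] at hb
  rw [sl_one_10, sub_zero] at hc
  rw [sl_one_11] at hd
  exact ⟨a, b, c, d, by linarith, hb, hc, by linarith⟩

theorem diag_eq_one_of_mul_eq_zero {N : ℕ} (hN : 3 ≤ N) {h : SL₂ ℤ} (hh : slRed N h = 1)
    (h0 : h 0 1 * h 1 0 = 0) : h 0 0 = 1 ∧ h 1 1 = 1 := by
  obtain ⟨a, b, c, d, ha, hb, hc, hd⟩ := exists_of_slRed_eq_one hh
  have hdet := sl_det h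
  rw [h0, sub_zero] at hdet
  have hN' : (3 : ℤ) ≤ N := by exact_mod_cast hN
  rcases Int.eq_one_or_neg_one_of_mul_eq_one' hdet with h1 | h1
  · exact h1
  · exfalso
    rw [h1.1] at ha
    have : (N : ℤ) ∣ 2 := ⟨-a, by linarith⟩
    have := Int.le_of_dvd (by norm_num) this
    linarith

section Weight

variable {N Y : ℕ} {w : SL₂ ℤ → ℝ} {S : Finset (SL₂ ℤ)}

theorem sum_upper_le (hN : 3 ≤ N) (hw : ∀ h i j, w h * |(h i j : ℝ)| ≤ 1)
    (hS : ∀ h ∈ S, h ∈ slBall Y ∧ slRed N h = 1 ∧ h 1 0 = 0 ∧ h 0 1 ≠ 0) :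
    ∑ h ∈ S, w h ≤ 2 * ((1 + Real.log Y) / N) := by
  have hN0 : (0 : ℝ) < N := by exact_mod_cast (by omega : 0 < N)
  have hNz : (N : ℤ) ≠ 0 := by exact_mod_cast (by omega : N ≠ 0)
  have key : ∀ h ∈ S, h 0 1 = N * (h 0 1 / N) := by
    intro h hh
    obtain ⟨a, b, c, d, ha, hb, hc, hd⟩ := exists_of_slRed_eq_one (hS h hh).2.1
    rw [hb, Int.mul_ediv_cancel_left _ hNz]
  have hne : ∀ h ∈ S, h 0 1 / (N : ℤ) ≠ 0 := by
    intro h hh h0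
    have := key h hh
    rw [h0, mul_zero] at this
    exact (hS h hh).2.2.2 this
  have := sum_le_two_mul_sum_fibers S w (fun h ↦ h 0 1 / N) Y (fun _ ↦ 1) (W := 1 / N)
    (by positivity) ?_ ?_ ?_
  · refine this.trans ?_
    have h1 := sum_Icc_inv_le (le_refl Y)
    calc 2 * ∑ k ∈ Finset.Icc 1 Y, 1 * (1 / (N : ℝ) / k)
        = 2 * ((∑ k ∈ Finset.Icc 1 Y, (1 : ℝ) / k) / N) := by
          rw [Finset.sum_div]
          congr 1
          refine Finset.sum_congr rfl fun k _ ↦ ?_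
          rw [one_mul, div_right_comm]
      _ ≤ _ := by gcongr
  · intro h hh
    refine ⟨hne h hh, ?_⟩
    have h1 := mem_slBall.1 (hS h hh).1 0 1
    rw [Int.abs_eq_natAbs] at h1
    exact (Int.natAbs_ediv_le_natAbs _ _).trans (by exact_mod_cast h1)
  · intro z hz
    have : (S.filter fun h ↦ h 0 1 / (N : ℤ) = z).card ≤ 1 := by
      rw [Finset.card_le_one]
      intro g hg h hh
      rw [Finset.mem_filter] at hg hh
      obtain ⟨-, g1, g2, -⟩ := hS g hg.1
      obtain ⟨-, h1, h2, -⟩ := hS h hh.1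
      have g3 := diag_eq_one_of_mul_eq_zero hN g1 (by rw [g2, mul_zero])
      have h3 := diag_eq_one_of_mul_eq_zero hN h1 (by rw [h2, mul_zero])
      apply sl_ext
      · rw [g3.1, h3.1]
      · rw [key g hg.1, key h hh.1, hg.2, hh.2]
      · rw [g2, h2]
      · rw [g3.2, h3.2]
    exact_mod_cast this
  · intro h hh
    have hpos : (0 : ℝ) < (h 0 1 / (N : ℤ)).natAbs := by
      exact_mod_cast Int.natAbs_pos.2 (hne h hh)
    rw [le_div_iff₀ hpos, le_div_iff₀ hN0]
    refine le_trans (le_of_eq ?_) (hw h 0 1)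
    conv_rhs => rw [key h hh]
    push_cast
    rw [abs_mul, abs_of_pos hN0, Nat.cast_natAbs, Int.cast_abs]
    ring

end Weight

/-- The transpose. -/
def slTr (h : SL₂ ℤ) : SL₂ ℤ := slMk (h 0 0) (h 1 0) (h 0 1) (h 1 1) (by
  have := sl_det h
  linarith)

theorem slTr_slTr (h : SL₂ ℤ) : slTr (slTr h) = h := sl_ext rfl rfl rfl rfl

theorem slTr_apply (h : SL₂ ℤ) (i j : Fin 2) : slTr h i j = h j i := by
  fin_cases i <;> fin_cases j <;> rfl

theorem slTr_mem_slBall {Y : ℕ} {h : SL₂ ℤ} (hh : h ∈ slBall Y) : slTr h ∈ slBall Y := by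
  rw [mem_slBall] at *
  intro i j
  rw [slTr_apply]
  exact hh j i

theorem slRed_slTr {N : ℕ} {h : SL₂ ℤ} (hh : slRed N h = 1) : slRed N (slTr h) = 1 := by
  have key : ∀ i j, slRed N (slTr h) i j = (1 : SL₂ (ZMod N)) j i := by
    intro i j
    rw [slRed_apply, slTr_apply, ← hh, slRed_apply]
  exact sl_ext (key 0 0) (key 0 1) (key 1 0) (key 1 1)

/-- The parameters `(a, b; c, d)` of `1 + N (a, b; c, d)`. -/
theorem slRed_eq_one_params {N : ℕ} (hN : N ≠ 0) {h : SL₂ ℤ} (hh : slRed N h = 1) :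
    h 0 0 = 1 + N * ((h 0 0 - 1) / N) ∧ h 0 1 = N * (h 0 1 / N) ∧ h 1 0 = N * (h 1 0 / N) ∧
      h 1 1 = 1 + N * ((h 1 1 - 1) / N) ∧ ((h 0 0 - 1) / N) + ((h 1 1 - 1) / N) =
        (N : ℤ) * ((h 0 1 / N) * (h 1 0 / N) - ((h 0 0 - 1) / N) * ((h 1 1 - 1) / N)) := by
  have hNz : (N : ℤ) ≠ 0 := by exact_mod_cast hN
  obtain ⟨a, b, c, d, ha, hb, hc, hd⟩ := exists_of_slRed_eq_one hh
  have hdet := sl_det h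
  rw [ha, hb, hc, hd, add_sub_cancel_left, add_sub_cancel_left, Int.mul_ediv_cancel_left _ hNz,
    Int.mul_ediv_cancel_left _ hNz, Int.mul_ediv_cancel_left _ hNz, Int.mul_ediv_cancel_left _ hNz]
  refine ⟨rfl, rfl, rfl, rfl, ?_⟩
  rw [ha, hb, hc, hd] at hdet
  have : (N : ℤ) * (a + d - N * (b * c - a * d)) = 0 := by linear_combination hdet
  have := (mul_eq_zero.1 this).resolve_left hNz
  linarith

section Weight

variable {N Y : ℕ} {w : SL₂ ℤ → ℝ} {S : Finset (SL₂ ℤ)}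

theorem sum_lower_le (hN : 3 ≤ N) (hw : ∀ h i j, w h * |(h i j : ℝ)| ≤ 1)
    (hS : ∀ h ∈ S, h ∈ slBall Y ∧ slRed N h = 1 ∧ h 0 1 = 0 ∧ h 1 0 ≠ 0) :
    ∑ h ∈ S, w h ≤ 2 * ((1 + Real.log Y) / N) := by
  classical
  have := sum_upper_le (S := S.image slTr) (w := fun h ↦ w (slTr h)) hN (Y := Y) ?_ ?_
  · rw [Finset.sum_image fun x _ y _ hxy ↦ (Function.LeftInverse.injective slTr_slTr) hxy] at this
    simpa only [slTr_slTr] using this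
  · intro h i j
    rw [← slTr_apply]
    exact hw _ _ _
  · intro h hh
    obtain ⟨g, hg, rfl⟩ := Finset.mem_image.1 hh
    obtain ⟨h1, h2, h3, h4⟩ := hS g hg
    exact ⟨slTr_mem_slBall h1, slRed_slTr h2, h3, h4⟩

theorem card_fiber_le {D : ℕ} (hN : N ≠ 0)
    (hD : ∀ m : ℕ, m ≠ 0 → m ≤ Y ^ 2 → m.divisors.card ≤ D)
    (hS : ∀ h ∈ S, h ∈ slBall Y ∧ slRed N h = 1 ∧ h 0 1 * h 1 0 ≠ 0)
    (p q : ℤ) (hpq : ∀ h ∈ S, (h 0 0 - 1) / N = p ∧ (h 1 1 - 1) / N = q) :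
    S.card ≤ 2 * D := by
  classical
  rcases S.eq_empty_or_nonempty with rfl | ⟨h₀, hh₀⟩
  · simp
  have hNz : (N : ℤ) ≠ 0 := by exact_mod_cast hN
  set m : ℤ := (h₀ 0 1 / N) * (h₀ 1 0 / N) with hm
  have hmul : ∀ h ∈ S, (h 0 1 / N) * (h 1 0 / N) = m := by
    intro h hh
    obtain ⟨-, -, -, -, e⟩ := slRed_eq_one_params hN (hS h hh).2.1
    obtain ⟨-, -, -, -, e₀⟩ := slRed_eq_one_params hN (hS h₀ hh₀).2.1
    rw [(hpq h hh).1, (hpq h hh).2] at e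
    rw [(hpq h₀ hh₀).1, (hpq h₀ hh₀).2, ← hm] at e₀
    have := mul_left_cancel₀ hNz (e.symm.trans e₀)
    linarith
  obtain ⟨-, hb, hc, -, -⟩ := slRed_eq_one_params hN (hS h₀ hh₀).2.1
  have hm0 : m ≠ 0 := by
    intro h0
    apply (hS h₀ hh₀).2.2
    rw [hb, hc]
    linear_combination (N : ℤ) ^ 2 * h0
  have hmY : m.natAbs ≤ Y ^ 2 := by
    have h1 := mem_slBall.1 (hS h₀ hh₀).1 0 1
    have h2 := mem_slBall.1 (hS h₀ hh₀).1 1 0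
    rw [Int.abs_eq_natAbs] at h1 h2
    rw [hm, Int.natAbs_mul, sq]
    exact Nat.mul_le_mul ((Int.natAbs_ediv_le_natAbs _ _).trans (by exact_mod_cast h1))
      ((Int.natAbs_ediv_le_natAbs _ _).trans (by exact_mod_cast h2))
  have hinj : Set.InjOn (fun h : SL₂ ℤ ↦ h 0 1 / (N : ℤ)) S := by
    intro g hg h hh hgh
    simp only at hgh
    obtain ⟨ga, gb, gc, gd, -⟩ := slRed_eq_one_params hN (hS g hg).2.1
    obtain ⟨ha, hb, hc, hd, -⟩ := slRed_eq_one_params hN (hS h hh).2.1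
    have e : g 1 0 / (N : ℤ) = h 1 0 / N := by
      have h1 := (hmul g hg).trans (hmul h hh).symm
      rw [hgh] at h1
      refine mul_left_cancel₀ ?_ h1
      intro h0
      apply hm0
      rw [← hmul h hh, h0, zero_mul]
    apply sl_ext
    · rw [ga, ha, (hpq g hg).1, (hpq h hh).1]
    · rw [gb, hb, hgh]
    · rw [gc, hc, e]
    · rw [gd, hd, (hpq g hg).2, (hpq h hh).2]
  rw [← Finset.card_image_of_injOn hinj]
  refine (card_int_divisors_le _ hm0 ?_).trans
    (Nat.mul_le_mul_left 2 (hD _ (Int.natAbs_ne_zero.2 hm0) hmY))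
  intro z hz
  obtain ⟨h, hh, rfl⟩ := Finset.mem_image.1 hz
  exact ⟨_, (hmul h hh).symm⟩

theorem sum_generic_le {D : ℕ} (hN : 3 ≤ N) (hY : 1 ≤ Y)
    (hD : ∀ m : ℕ, m ≠ 0 → m ≤ Y ^ 2 → m.divisors.card ≤ D)
    (hw : ∀ h i j, w h * |(h i j : ℝ)| ≤ 1) (hw0 : ∀ h, 0 ≤ w h)
    (hS : ∀ h ∈ S, h ∈ slBall Y ∧ slRed N h = 1 ∧ h 0 1 * h 1 0 ≠ 0 ∧
      ((h 1 1 - 1) / N).natAbs ≤ ((h 0 0 - 1) / N).natAbs) :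
    ∑ h ∈ S, w h ≤ 8 * D * (8 * Y / N ^ 3 + (1 + Real.log (2 * Y)) / N) := by
  classical
  have hN0 : (0 : ℝ) < N := by exact_mod_cast (by omega : 0 < N)
  have hNn : N ≠ 0 := by omega
  have hNz : (0 : ℤ) < N := by exact_mod_cast (by omega : 0 < N)
  have hne : ∀ h ∈ S, (h 0 0 - 1) / (N : ℤ) ≠ 0 := by
    intro h hh h0
    obtain ⟨h1, h2, h3, h4⟩ := hS h hh
    rw [h0] at h4
    have h5 : (h 1 1 - 1) / (N : ℤ) = 0 := by simpa using h4
    obtain ⟨ha, hb, hc, hd, -⟩ := slRed_eq_one_params hNn h2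
    rw [h0, mul_zero, add_zero] at ha
    rw [h5, mul_zero, add_zero] at hd
    have hdet := sl_det h
    rw [ha, hd] at hdet
    exact h3 (by linarith)
  have hAabs : ∀ h ∈ S, N * ((h 0 0 - 1) / (N : ℤ)).natAbs ≤ 2 * Y := by
    intro h hh
    obtain ⟨ha, -⟩ := slRed_eq_one_params hNn (hS h hh).2.1
    have h1 := mem_slBall.1 (hS h hh).1 0 0
    have h2 : (N * ((h 0 0 - 1) / (N : ℤ)).natAbs : ℕ) = (h 0 0 - 1).natAbs := by
      rw [show h 0 0 - 1 = N * ((h 0 0 - 1) / N) by linarith, Int.natAbs_mul, Int.natAbs_natCast,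
        Int.mul_ediv_cancel_left _ hNz.ne']
    rw [h2]
    rw [abs_le] at h1
    omega
  have := sum_le_two_mul_sum_fibers S w (fun h ↦ (h 0 0 - 1) / N) (2 * Y / N)
    (fun k ↦ 2 * D * (4 * k / N + 1)) (W := 2 / N) (by positivity) ?_ ?_ ?_
  · refine this.trans ?_
    have h1 := sum_Icc_inv_le (Nat.div_le_self (2 * Y) N)
    push_cast at h1
    have h2 : ((2 * Y / N : ℕ) : ℝ) ≤ 2 * Y / N := by
      have := Nat.cast_div_le (α := ℝ) (m := 2 * Y) (n := N)
      push_cast at this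
      exact this
    calc 2 * ∑ k ∈ Finset.Icc 1 (2 * Y / N), 2 * (D : ℝ) * (4 * k / N + 1) * (2 / N / k)
        = 2 * ∑ k ∈ Finset.Icc 1 (2 * Y / N), (16 * D / N ^ 2 + 4 * D / N * (1 / (k : ℝ))) := by
          congr 1
          refine Finset.sum_congr rfl fun k hk ↦ ?_
          have : (0 : ℝ) < k := by exact_mod_cast (Finset.mem_Icc.1 hk).1
          field_simp
          ring
      _ = 2 * (((2 * Y / N : ℕ) : ℝ) * (16 * D / N ^ 2) +
          4 * D / N * ∑ k ∈ Finset.Icc 1 (2 * Y / N), 1 / (k : ℝ)) := by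
          rw [Finset.sum_add_distrib, ← Finset.mul_sum, Finset.sum_const, nsmul_eq_mul,
            Nat.card_Icc, Nat.add_sub_cancel]
      _ ≤ 2 * ((2 * Y / N) * (16 * D / N ^ 2) + 4 * D / N * (1 + Real.log (2 * Y))) := by gcongr
      _ = _ := by field_simp; ring
  · intro h hh
    refine ⟨hne h hh, ?_⟩
    rw [Nat.le_div_iff_mul_le (by omega), mul_comm]
    exact hAabs h hh
  · intro z hz
    set q := 2 * z.natAbs / N with hq
    have hcard := Finset.card_le_mul_card_image_of_maps_to
      (s := S.filter fun h ↦ (h 0 0 - 1) / (N : ℤ) = z)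
      (f := fun h : SL₂ ℤ ↦ (h 0 1 / (N : ℤ)) * (h 1 0 / (N : ℤ)) -
        ((h 0 0 - 1) / (N : ℤ)) * ((h 1 1 - 1) / (N : ℤ)))
      (t := Finset.Icc (-(q : ℤ)) (q : ℤ)) ?_ (2 * D) ?_
    · rw [Int.card_Icc] at hcard
      have h1 : ((q : ℤ) + 1 - -q).toNat = 2 * q + 1 := by omega
      rw [h1] at hcard
      have h2 : (q : ℝ) ≤ 2 * z.natAbs / N := by
        have := Nat.cast_div_le (α := ℝ) (m := 2 * z.natAbs) (n := N)
        push_cast at this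
        exact this
      calc ((S.filter fun h ↦ (h 0 0 - 1) / (N : ℤ) = z).card : ℝ)
          ≤ 2 * D * (2 * q + 1) := by exact_mod_cast hcard
        _ ≤ 2 * D * (2 * (2 * z.natAbs / N) + 1) := by gcongr
        _ = _ := by ring
    · intro h hh
      rw [Finset.mem_filter] at hh
      obtain ⟨-, -, -, -, e⟩ := slRed_eq_one_params hNn (hS h hh.1).2.1
      have h4 := (hS h hh.1).2.2.2
      set k := (h 0 1 / N) * (h 1 0 / N) - ((h 0 0 - 1) / N) * ((h 1 1 - 1) / N)
      rw [hh.2] at e h4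
      have h5 : N * k.natAbs ≤ 2 * z.natAbs := by
        have := congrArg Int.natAbs e
        rw [Int.natAbs_mul, Int.natAbs_natCast] at this
        rw [← this]
        have := Int.natAbs_add_le z ((h 1 1 - 1) / N)
        omega
      have h6 : k.natAbs ≤ q := by
        rw [hq, Nat.le_div_iff_mul_le (by omega), mul_comm]
        exact h5
      rw [Finset.mem_Icc]
      omega
    · intro k _
      refine card_fiber_le hNn hD (fun h hh ↦ ?_) z (N * k - z) fun h hh ↦ ?_
      · have h1 := hS h (Finset.mem_filter.1 (Finset.mem_filter.1 hh).1).1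
        exact ⟨h1.1, h1.2.1, h1.2.2.1⟩
      · rw [Finset.mem_filter, Finset.mem_filter] at hh
        obtain ⟨⟨h1, h2⟩, h3⟩ := hh
        obtain ⟨-, -, -, -, e⟩ := slRed_eq_one_params hNn (hS h h1).2.1
        rw [h3, h2] at e
        exact ⟨h2, by linarith⟩
  · intro h hh
    have hz := Int.natAbs_pos.2 (hne h hh)
    obtain ⟨ha, -⟩ := slRed_eq_one_params hNn (hS h hh).2.1
    have h1 := hw h 0 0
    rw [← Int.cast_abs, Int.abs_eq_natAbs, Int.cast_natCast] at h1
    set z := (h 0 0 - 1) / (N : ℤ)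
    have hz' : (0 : ℝ) < z.natAbs := by exact_mod_cast hz
    have h2 : N * z.natAbs ≤ 2 * (h 0 0).natAbs := by
      have h3 : (N * z).natAbs = N * z.natAbs := by rw [Int.natAbs_mul, Int.natAbs_natCast]
      have h4 : 3 * 1 ≤ N * z.natAbs := Nat.mul_le_mul hN hz
      omega
    have h2' : (N : ℝ) * z.natAbs ≤ 2 * (h 0 0).natAbs := by exact_mod_cast h2
    rw [le_div_iff₀ hz', le_div_iff₀ hN0]
    have := mul_le_mul_of_nonneg_left h2' (hw0 h)
    linarith

theorem sum_congruence_le {D : ℕ} (hN : 3 ≤ N) (hY : 1 ≤ Y) (hD1 : 1 ≤ D)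
    (hD : ∀ m : ℕ, m ≠ 0 → m ≤ Y ^ 2 → m.divisors.card ≤ D)
    (hw : ∀ h i j, w h * |(h i j : ℝ)| ≤ 1) (hw0 : ∀ h, 0 ≤ w h) :
    ∑ h ∈ (slBall Y).filter (fun h ↦ slRed N h = 1), w h ≤
      1 + 20 * D * (8 * Y / N ^ 3 + (1 + Real.log (2 * Y)) / N) := by
  classical
  have hN0 : (0 : ℝ) < N := by exact_mod_cast (by omega : 0 < N)
  have hY0 : (1 : ℝ) ≤ Y := by exact_mod_cast hY
  set S := (slBall Y).filter (fun h ↦ slRed N h = 1) with hSdef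
  have hS : ∀ h ∈ S, h ∈ slBall Y ∧ slRed N h = 1 := fun h hh ↦ Finset.mem_filter.1 hh
  set S₁ := S.filter fun h ↦ h 1 0 = 0 ∧ h 0 1 ≠ 0
  set S₂ := S.filter fun h ↦ h 0 1 = 0 ∧ h 1 0 ≠ 0
  set S₃ := S.filter fun h ↦ h 0 1 * h 1 0 ≠ 0 ∧
      ((h 1 1 - 1) / (N : ℤ)).natAbs ≤ ((h 0 0 - 1) / (N : ℤ)).natAbs
  set S₄ := S.filter fun h ↦ h 0 1 * h 1 0 ≠ 0 ∧
      ((h 0 0 - 1) / (N : ℤ)).natAbs ≤ ((h 1 1 - 1) / (N : ℤ)).natAbs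
  have hcov : S ⊆ {1} ∪ (S₁ ∪ (S₂ ∪ (S₃ ∪ S₄))) := by
    intro h hh
    simp only [Finset.mem_union, Finset.mem_singleton, S₁, S₂, S₃, S₄, Finset.mem_filter, hh,
      true_and]
    by_cases h1 : h 1 0 = 0
    · by_cases h2 : h 0 1 = 0
      · left
        have := diag_eq_one_of_mul_eq_zero hN (hS h hh).2 (by rw [h1, mul_zero])
        exact sl_ext this.1 h2 h1 this.2
      · exact Or.inr (Or.inl ⟨h1, h2⟩)
    · by_cases h2 : h 0 1 = 0
      · exact Or.inr (Or.inr (Or.inl ⟨h2, h1⟩))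
      · have h3 := mul_ne_zero h2 h1
        rcases le_total ((h 1 1 - 1) / (N : ℤ)).natAbs ((h 0 0 - 1) / (N : ℤ)).natAbs with h4 | h4
        · exact Or.inr (Or.inr (Or.inr (Or.inl ⟨h3, h4⟩)))
        · exact Or.inr (Or.inr (Or.inr (Or.inr ⟨h3, h4⟩)))
  have hunion : ∀ A B : Finset (SL₂ ℤ), ∑ h ∈ A ∪ B, w h ≤ ∑ h ∈ A, w h + ∑ h ∈ B, w h := by
    intro A B
    rw [← Finset.sum_union_inter]
    exact le_add_of_nonneg_right (Finset.sum_nonneg fun h _ ↦ hw0 h)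
  have e0 : ∑ h ∈ ({1} : Finset (SL₂ ℤ)), w h ≤ 1 := by
    rw [Finset.sum_singleton]
    have := hw 1 0 0
    rw [sl_one_00] at this
    simpa using this
  have e1 : ∑ h ∈ S₁, w h ≤ 2 * ((1 + Real.log Y) / N) := by
    refine sum_upper_le hN hw fun h hh ↦ ?_
    obtain ⟨h1, h2⟩ := Finset.mem_filter.1 hh
    exact ⟨(hS h h1).1, (hS h h1).2, h2⟩
  have e2 : ∑ h ∈ S₂, w h ≤ 2 * ((1 + Real.log Y) / N) := by
    refine sum_lower_le hN hw fun h hh ↦ ?_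
    obtain ⟨h1, h2⟩ := Finset.mem_filter.1 hh
    exact ⟨(hS h h1).1, (hS h h1).2, h2⟩
  have e3 : ∑ h ∈ S₃, w h ≤ 8 * D * (8 * Y / N ^ 3 + (1 + Real.log (2 * Y)) / N) := by
    refine sum_generic_le hN hY hD hw hw0 fun h hh ↦ ?_
    obtain ⟨h1, h2⟩ := Finset.mem_filter.1 hh
    exact ⟨(hS h h1).1, (hS h h1).2, h2⟩
  have e4 : ∑ h ∈ S₄, w h ≤ 8 * D * (8 * Y / N ^ 3 + (1 + Real.log (2 * Y)) / N) := by
    have := sum_generic_le (S := S₄.image (·⁻¹)) (w := fun h ↦ w h⁻¹) hN hY hD ?_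
      (fun h ↦ hw0 _) ?_
    · rw [Finset.sum_image fun x _ y _ hxy ↦ inv_injective hxy] at this
      simpa only [inv_inv] using this
    · intro h i j
      have h1 := fun i j ↦ hw h⁻¹ i j
      fin_cases i <;> fin_cases j <;> simp only [Fin.zero_eta, Fin.mk_one]
      · simpa only [sl_inv_11] using h1 1 1
      · simpa only [sl_inv_01, Int.cast_neg, abs_neg] using h1 0 1
      · simpa only [sl_inv_10, Int.cast_neg, abs_neg] using h1 1 0
      · simpa only [sl_inv_00] using h1 0 0
    · intro h hh
      obtain ⟨g, hg, rfl⟩ := Finset.mem_image.1 hh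
      obtain ⟨h1, h2, h3⟩ := Finset.mem_filter.1 hg
      refine ⟨inv_mem_slBall (hS g h1).1, by rw [map_inv, (hS g h1).2, inv_one], ?_, ?_⟩
      · rw [sl_inv_01, sl_inv_10, neg_mul_neg]
        exact h2
      · rw [sl_inv_00, sl_inv_11]
        exact h3
  have hlog : Real.log Y ≤ Real.log (2 * Y) := Real.log_le_log (by linarith) (by linarith)
  have hlog0 : 0 ≤ Real.log Y := Real.log_nonneg hY0
  have hD1' : (1 : ℝ) ≤ D := by exact_mod_cast hD1
  have e5 : (1 + Real.log Y) / N ≤ D * (8 * Y / N ^ 3 + (1 + Real.log (2 * Y)) / N) := by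
    calc (1 + Real.log Y) / N ≤ 1 * (0 + (1 + Real.log (2 * Y)) / N) := by
          rw [one_mul, zero_add]; gcongr
      _ ≤ _ := by
        have : 0 ≤ 1 + Real.log (2 * Y) := by linarith
        gcongr
        positivity
  calc ∑ h ∈ S, w h ≤ ∑ h ∈ {1} ∪ (S₁ ∪ (S₂ ∪ (S₃ ∪ S₄))), w h :=
        Finset.sum_le_sum_of_subset_of_nonneg hcov fun h _ _ ↦ hw0 h
    _ ≤ ∑ h ∈ {1}, w h + (∑ h ∈ S₁, w h + (∑ h ∈ S₂, w h + (∑ h ∈ S₃, w h + ∑ h ∈ S₄, w h))) := by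
        refine (hunion _ _).trans (add_le_add le_rfl ((hunion _ _).trans (add_le_add le_rfl
          ((hunion _ _).trans (add_le_add le_rfl (hunion _ _))))))
    _ ≤ _ := by linarith

end Weight

/-- The number of ways of writing `h` as a product of `n` elements of `slBall R`. -/
noncomputable def slCount (R : ℕ) : ℕ → SL₂ ℤ → ℝ
  | 0, h => if h = 1 then 1 else 0
  | n + 1, h => ∑ b ∈ slBall R, slCount R n (b * h)

theorem slCount_nonneg (R n : ℕ) (h : SL₂ ℤ) : 0 ≤ slCount R n h := by
  induction n generalizing h with
  | zero => rw [slCount]; split_ifs <;> norm_num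
  | succ n ih => exact Finset.sum_nonneg fun b _ ↦ ih _

theorem mul_mem_slBall {R S : ℕ} {g h : SL₂ ℤ} (hg : g ∈ slBall R) (hh : h ∈ slBall S) :
    g * h ∈ slBall (2 * R * S) := by
  rw [mem_slBall] at *
  intro i j
  rw [sl_mul_apply]
  have aux : ∀ k, |g i k * h k j| ≤ (R : ℤ) * S := fun k ↦ by
    rw [abs_mul]
    exact mul_le_mul (hg i k) (hh k j) (abs_nonneg _) (by positivity)
  calc |g i 0 * h 0 j + g i 1 * h 1 j| ≤ R * S + R * S :=
        (abs_add_le _ _).trans (add_le_add (aux 0) (aux 1))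
    _ = _ := by push_cast; ring

theorem mem_slBall_of_slCount_ne_zero {R n : ℕ} {h : SL₂ ℤ} (hh : slCount R n h ≠ 0) :
    h ∈ slBall ((2 * R) ^ n) := by
  induction n generalizing h with
  | zero =>
    rw [slCount] at hh
    have : h = 1 := by
      by_contra h1
      exact hh (if_neg h1)
    rw [this, mem_slBall]
    intro i j
    fin_cases i <;> fin_cases j <;> simp
  | succ n ih =>
    obtain ⟨b, hb, hbh⟩ := Finset.exists_ne_zero_of_sum_ne_zero hh
    have := mul_mem_slBall (inv_mem_slBall hb) (ih hbh)
    rwa [inv_mul_cancel_left, ← pow_succ'] at this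

theorem slCount_le (R n : ℕ) (h : SL₂ ℤ) (j : Fin 2) :
    slCount R n h ≤ slLam R ^ n * (1 / √((h 0 j : ℝ) ^ 2 + (h 1 j : ℝ) ^ 2)) := by
  have hΛ : 0 ≤ slLam R := by rw [slLam]; positivity
  induction n generalizing h with
  | zero =>
    rw [slCount]
    split_ifs with h1
    · subst h1
      fin_cases j <;> simp
    · positivity
  | succ n ih =>
    have hne : h 0 j ^ 2 + h 1 j ^ 2 ≠ 0 := by
      intro h0
      have h1 : h 0 j = 0 := by nlinarith [sq_nonneg (h 0 j), sq_nonneg (h 1 j)]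
      have h2 : h 1 j = 0 := by nlinarith [sq_nonneg (h 0 j), sq_nonneg (h 1 j)]
      have hd := sl_det h
      fin_cases j <;> simp_all
    rw [slCount]
    calc ∑ b ∈ slBall R, slCount R n (b * h)
        ≤ ∑ b ∈ slBall R, slLam R ^ n * (1 / √(slN (h 0 j) (h 1 j) b)) := by
          refine Finset.sum_le_sum fun b _ ↦ (ih _).trans (le_of_eq ?_)
          rw [sl_mul_apply, sl_mul_apply, slN]
      _ = slLam R ^ n * ∑ b ∈ slBall R, 1 / √(slN (h 0 j) (h 1 j) b) := by rw [Finset.mul_sum]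
      _ ≤ slLam R ^ n * (slLam R * (1 / √((h 0 j : ℝ) ^ 2 + (h 1 j : ℝ) ^ 2))) := by
          gcongr
          exact sum_inv_sqrt_slN_le hne
      _ = _ := by rw [pow_succ (slLam R), mul_assoc]

theorem slCount_mul_abs_le (R n : ℕ) (h : SL₂ ℤ) (i j : Fin 2) :
    slCount R n h * |(h i j : ℝ)| ≤ slLam R ^ n := by
  have hΛ : 0 ≤ slLam R := by rw [slLam]; positivity
  set s := √((h 0 j : ℝ) ^ 2 + (h 1 j : ℝ) ^ 2) with hs
  have h1 : |(h i j : ℝ)| ≤ s := by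
    apply Real.abs_le_sqrt
    fin_cases i <;> simp <;> positivity
  have hs0 : 0 ≤ s := Real.sqrt_nonneg _
  calc slCount R n h * |(h i j : ℝ)| ≤ slLam R ^ n * (1 / s) * s :=
        mul_le_mul (slCount_le R n h j) h1 (abs_nonneg _) (by positivity)
    _ ≤ slLam R ^ n * 1 := by
        rw [mul_assoc, one_div]
        gcongr
        exact inv_mul_le_one
    _ = _ := mul_one _

/-- The sum of the left translates of a function on `SL₂(ℤ/N)` by `slBall R`. -/
noncomputable def slOp (N R : ℕ) : (SL₂ (ZMod N) → ℂ) →ₗ[ℂ] (SL₂ (ZMod N) → ℂ) where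
  toFun f g := ∑ b ∈ slBall R, f (slRed N b * g)
  map_add' f f' := by
    ext g
    simp [Finset.sum_add_distrib]
  map_smul' c f := by
    ext g
    simp [Finset.mul_sum]

theorem slOp_apply (N R : ℕ) (f : SL₂ (ZMod N) → ℂ) (g : SL₂ (ZMod N)) :
    slOp N R f g = ∑ b ∈ slBall R, f (slRed N b * g) := rfl

theorem sum_slBall_inv {M : Type*} [AddCommMonoid M] (R : ℕ) (F : SL₂ ℤ → M) :
    ∑ b ∈ slBall R, F b⁻¹ = ∑ b ∈ slBall R, F b :=
  Finset.sum_nbij' (·⁻¹) (·⁻¹) (fun _ h ↦ inv_mem_slBall h) (fun _ h ↦ inv_mem_slBall h)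
    (fun _ _ ↦ inv_inv _) (fun _ _ ↦ inv_inv _) (fun _ _ ↦ rfl)

theorem slOp_pow_apply (N R n : ℕ) (f : SL₂ (ZMod N) → ℂ) (g : SL₂ (ZMod N)) :
    (slOp N R ^ n) f g =
      ∑ h ∈ slBall ((2 * R) ^ n), (slCount R n h : ℂ) * f (slRed N h * g) := by
  induction n generalizing f with
  | zero =>
    rw [pow_zero, Module.End.one_apply, Finset.sum_eq_single 1]
    · simp [slCount]
    · intro h _ h1
      simp [slCount, h1]
    · intro h1
      exfalso
      apply h1
      rw [mem_slBall]
      intro i j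
      fin_cases i <;> fin_cases j <;> simp
  | succ n ih =>
    rw [pow_succ, Module.End.mul_apply, ih]
    calc ∑ h ∈ slBall ((2 * R) ^ n), (slCount R n h : ℂ) * slOp N R f (slRed N h * g)
        = ∑ b ∈ slBall R, ∑ h ∈ slBall ((2 * R) ^ n),
            (slCount R n h : ℂ) * f (slRed N (b * h) * g) := by
          rw [Finset.sum_comm]
          refine Finset.sum_congr rfl fun h _ ↦ ?_
          rw [slOp_apply, Finset.mul_sum]
          simp only [map_mul, mul_assoc]
      _ = ∑ b ∈ slBall R, ∑ h ∈ slBall ((2 * R) ^ (n + 1)),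
            (slCount R n (b⁻¹ * h) : ℂ) * f (slRed N h * g) := by
          refine Finset.sum_congr rfl fun b hb ↦ ?_
          refine Finset.sum_bij_ne_zero (fun h _ _ ↦ b * h) ?_ ?_ ?_ ?_
          · intro h hh _
            rw [pow_succ']
            exact mul_mem_slBall hb hh
          · intro h _ _ h' _ _ e
            exact mul_left_cancel e
          · intro h hh hne
            refine ⟨b⁻¹ * h, mem_slBall_of_slCount_ne_zero fun h0 ↦ hne (by simp [h0]), ?_, ?_⟩
            · rwa [mul_inv_cancel_left]
            · rw [mul_inv_cancel_left]
          · intro h _ _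
            rw [inv_mul_cancel_left]
      _ = ∑ b ∈ slBall R, ∑ h ∈ slBall ((2 * R) ^ (n + 1)),
            (slCount R n (b * h) : ℂ) * f (slRed N h * g) :=
          sum_slBall_inv R fun b ↦ ∑ h ∈ slBall ((2 * R) ^ (n + 1)),
            (slCount R n (b * h) : ℂ) * f (slRed N h * g)
      _ = _ := by
          rw [Finset.sum_comm]
          refine Finset.sum_congr rfl fun h _ ↦ ?_
          rw [slCount, Complex.ofReal_sum, Finset.sum_mul]

theorem slOp_pow_single (N R n : ℕ) (g : SL₂ (ZMod N)) :
    (slOp N R ^ n) (Pi.single g 1) g =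
      ((∑ h ∈ (slBall ((2 * R) ^ n)).filter (fun h ↦ slRed N h = 1), slCount R n h : ℝ) : ℂ) := by
  rw [slOp_pow_apply, Finset.sum_filter, Complex.ofReal_sum]
  refine Finset.sum_congr rfl fun h _ ↦ ?_
  rw [Pi.single_apply]
  simp only [mul_eq_right]
  split_ifs <;> simp

theorem sum_slCount_le {R n N D : ℕ} (hR : 1 ≤ R) (hN : 3 ≤ N) (hD1 : 1 ≤ D)
    (hD : ∀ m : ℕ, m ≠ 0 → m ≤ ((2 * R) ^ n) ^ 2 → m.divisors.card ≤ D) :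
    ∑ h ∈ (slBall ((2 * R) ^ n)).filter (fun h ↦ slRed N h = 1), slCount R n h ≤
      slLam R ^ n * (1 + 20 * D * (8 * ((2 * R) ^ n : ℕ) / N ^ 3 +
        (1 + Real.log (2 * ((2 * R) ^ n : ℕ))) / N)) := by
  have hB : 1 ≤ (slBall 12).card := Finset.card_pos.2 ⟨1, by
    rw [mem_slBall]
    intro i j
    fin_cases i <;> fin_cases j <;> simp⟩
  have hΛ : 0 < slLam R := by
    rw [slLam, slScales]
    have : (0 : ℝ) < (slBall 12).card := by exact_mod_cast hB
    have : (0 : ℝ) < R := by exact_mod_cast hR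
    positivity
  have hΛn := pow_pos hΛ n
  have := sum_congruence_le (w := fun h ↦ slCount R n h / slLam R ^ n) hN
    (Nat.one_le_pow n (2 * R) (by omega)) hD1 hD ?_ ?_
  · rwa [← Finset.sum_div, div_le_iff₀' hΛn] at this
  · intro h i j
    rw [div_mul_eq_mul_div, div_le_one hΛn]
    exact slCount_mul_abs_le R n h i j
  · intro h
    exact div_nonneg (slCount_nonneg R n h) hΛn.le

/-- The bound for the return probability at scale `N ^ (5 / 2)`. -/
theorem exists_sum_slCount_le {R : ℕ} (hR : 1 ≤ R) : ∃ C : ℝ, 1 ≤ C ∧ ∀ N n : ℕ, 3 ≤ N →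
    N ^ 5 ≤ ((2 * R) ^ n) ^ 2 → ((2 * R) ^ n) ^ 2 ≤ (2 * R) ^ 4 * N ^ 5 →
    ∑ h ∈ (slBall ((2 * R) ^ n)).filter (fun h ↦ slRed N h = 1), slCount R n h ≤
      C * slLam R ^ n := by
  obtain ⟨C₁, hC₁, hdiv⟩ := exists_card_divisors_le (ε := 1 / 20) (by norm_num)
  have hΛ : 0 ≤ slLam R := by rw [slLam]; positivity
  set Q : ℝ := 2 * R with hQ
  have hQ1 : 1 ≤ Q := by
    have : (1 : ℝ) ≤ R := by exact_mod_cast hR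
    linarith
  refine ⟨1 + 20 * (C₁ * (8 * Q ^ 3 + 21 * Q)), ?_, fun N n hN h1 h2 ↦ ?_⟩
  · have : 0 ≤ 20 * (C₁ * (8 * Q ^ 3 + 21 * Q)) := by positivity
    linarith
  set Y : ℕ := (2 * R) ^ n with hY
  have hY1 : 1 ≤ Y := Nat.one_le_pow _ _ (by omega)
  have hY1' : (1 : ℝ) ≤ Y := by exact_mod_cast hY1
  have hY0 : (0 : ℝ) < Y := by linarith
  have hN0 : (0 : ℝ) < N := by exact_mod_cast (by omega : 0 < N)
  have hD : ∀ m : ℕ, m ≠ 0 → m ≤ Y ^ 2 →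
      m.divisors.card ≤ ⌊C₁ * (Y : ℝ) ^ (1 / 10 : ℝ)⌋₊ := by
    intro m hm hmY
    apply Nat.le_floor
    refine (hdiv m hm).trans ?_
    gcongr
    calc (m : ℝ) ^ (1 / 20 : ℝ) ≤ ((Y : ℝ) ^ 2) ^ (1 / 20 : ℝ) := by
          gcongr
          exact_mod_cast hmY
      _ = _ := by
          rw [← Real.rpow_natCast, ← Real.rpow_mul hY0.le]
          norm_num
  have hD1 : 1 ≤ ⌊C₁ * (Y : ℝ) ^ (1 / 10 : ℝ)⌋₊ := by
    apply Nat.le_floor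
    rw [Nat.cast_one]
    exact one_le_mul_of_one_le_of_one_le hC₁ (Real.one_le_rpow hY1' (by norm_num))
  refine (sum_slCount_le hR hN hD1 hD).trans ?_
  rw [mul_comm]
  refine mul_le_mul_of_nonneg_right ?_ (pow_nonneg hΛ n)
  have hDle : ((⌊C₁ * (Y : ℝ) ^ (1 / 10 : ℝ)⌋₊ : ℕ) : ℝ) ≤ C₁ * (Y : ℝ) ^ (1 / 10 : ℝ) :=
    Nat.floor_le (by positivity)
  have hNY : (Y : ℝ) ^ (2 / 5 : ℝ) ≤ Q * N := by
    have h2' : ((Y : ℝ)) ^ 2 ≤ (Q * N) ^ 5 := by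
      calc ((Y : ℝ)) ^ 2 ≤ Q ^ 4 * N ^ 5 := by rw [hQ]; exact_mod_cast h2
        _ ≤ Q ^ 5 * N ^ 5 := by gcongr; norm_num
        _ = _ := by ring
    have h3 := Real.rpow_le_rpow (by positivity) h2' (by norm_num : (0 : ℝ) ≤ 1 / 5)
    rw [← Real.rpow_natCast, ← Real.rpow_natCast, ← Real.rpow_mul hY0.le,
      ← Real.rpow_mul (by positivity)] at h3
    norm_num at h3 ⊢
    exact h3
  have hNinv : 1 / (N : ℝ) ≤ Q * (Y : ℝ) ^ (-(2 / 5) : ℝ) := by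
    rw [Real.rpow_neg hY0.le, div_le_iff₀ hN0, mul_right_comm, ← div_eq_mul_inv,
      le_div_iff₀ (by positivity), one_mul]
    exact hNY
  have e1 : 8 * (Y : ℝ) / N ^ 3 ≤ 8 * Q ^ 3 * (Y : ℝ) ^ (-(1 / 10) : ℝ) := by
    calc 8 * (Y : ℝ) / N ^ 3 = 8 * Y * (1 / (N : ℝ)) ^ 3 := by field_simp
      _ ≤ 8 * Y * (Q * (Y : ℝ) ^ (-(2 / 5) : ℝ)) ^ 3 := by gcongr
      _ = 8 * Q ^ 3 * ((Y : ℝ) ^ (1 : ℝ) * (Y : ℝ) ^ (-(6 / 5) : ℝ)) := by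
          rw [mul_pow, ← Real.rpow_natCast ((Y : ℝ) ^ (-(2 / 5) : ℝ)), ← Real.rpow_mul hY0.le,
            Real.rpow_one]
          norm_num
          ring
      _ ≤ 8 * Q ^ 3 * (Y : ℝ) ^ (-(1 / 10) : ℝ) := by
          rw [← Real.rpow_add hY0]
          gcongr ?_ * ?_
          exact Real.rpow_le_rpow_of_exponent_le hY1' (by norm_num)
  have e2 : (1 + Real.log (2 * Y)) / N ≤ 21 * Q * (Y : ℝ) ^ (-(1 / 10) : ℝ) := by
    have hl : 1 + Real.log (2 * Y) ≤ 21 * (Y : ℝ) ^ (1 / 10 : ℝ) := by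
      have h3 := Real.log_le_rpow_div (x := 2 * Y) (by positivity) (by norm_num : (0 : ℝ) < 1 / 10)
      have h4 : (2 * (Y : ℝ)) ^ (1 / 10 : ℝ) ≤ 2 * (Y : ℝ) ^ (1 / 10 : ℝ) := by
        rw [Real.mul_rpow (by norm_num) hY0.le]
        gcongr
        exact Real.rpow_le_self_of_one_le (by norm_num) (by norm_num)
      have h5 : 1 ≤ (Y : ℝ) ^ (1 / 10 : ℝ) := Real.one_le_rpow hY1' (by norm_num)
      rw [div_div_eq_mul_div, div_one] at h3
      linarith
    calc (1 + Real.log (2 * Y)) / N = (1 + Real.log (2 * Y)) * (1 / N) := by ring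
      _ ≤ (21 * (Y : ℝ) ^ (1 / 10 : ℝ)) * (Q * (Y : ℝ) ^ (-(2 / 5) : ℝ)) := by gcongr
      _ = 21 * Q * ((Y : ℝ) ^ (1 / 10 : ℝ) * (Y : ℝ) ^ (-(2 / 5) : ℝ)) := by ring
      _ ≤ 21 * Q * (Y : ℝ) ^ (-(1 / 10) : ℝ) := by
          rw [← Real.rpow_add hY0]
          gcongr ?_ * ?_
          exact Real.rpow_le_rpow_of_exponent_le hY1' (by norm_num)
  have e3 : (Y : ℝ) ^ (1 / 10 : ℝ) * (Y : ℝ) ^ (-(1 / 10) : ℝ) = 1 := by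
    rw [← Real.rpow_add hY0]
    norm_num
  have hlog : 0 ≤ Real.log (2 * Y) := Real.log_nonneg (by linarith)
  rw [mul_assoc 20]
  refine add_le_add le_rfl (mul_le_mul_of_nonneg_left ?_ (by norm_num))
  calc ((⌊C₁ * (Y : ℝ) ^ (1 / 10 : ℝ)⌋₊ : ℕ) : ℝ) * (8 * Y / N ^ 3 + (1 + Real.log (2 * Y)) / N)
      ≤ (C₁ * (Y : ℝ) ^ (1 / 10 : ℝ)) * (8 * Q ^ 3 * (Y : ℝ) ^ (-(1 / 10) : ℝ) +
          21 * Q * (Y : ℝ) ^ (-(1 / 10) : ℝ)) := by gcongr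
    _ = C₁ * (8 * Q ^ 3 + 21 * Q) * ((Y : ℝ) ^ (1 / 10 : ℝ) * (Y : ℝ) ^ (-(1 / 10) : ℝ)) := by ring
    _ = _ := by rw [e3, mul_one]

theorem exists_rpow_le_card_image_sq : ∃ c : ℝ, 0 < c ∧ ∀ (N : ℕ) [NeZero N],
    c * (N : ℝ) ^ (3 / 4 : ℝ) ≤ ((Finset.univ.image fun u : (ZMod N)ˣ ↦ u ^ 2).card : ℝ) := by
  obtain ⟨C, hC, hdiv⟩ := exists_card_divisors_le (ε := 1 / 8) (by norm_num)
  refine ⟨1 / (2 * C ^ 2), by positivity, fun N _ ↦ ?_⟩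
  have hN0 : (0 : ℝ) < N := by exact_mod_cast Nat.pos_of_ne_zero (NeZero.ne N)
  set q := (Finset.univ.image fun u : (ZMod N)ˣ ↦ u ^ 2).card with hq
  have h1 : (N : ℝ) ≤ 2 * N.divisors.card ^ 2 * q := by exact_mod_cast le_card_image_sq N
  have h2 := hdiv N (NeZero.ne N)
  have h3 : (N : ℝ) ≤ 2 * C ^ 2 * q * (N : ℝ) ^ (1 / 4 : ℝ) := by
    calc (N : ℝ) ≤ 2 * N.divisors.card ^ 2 * q := h1
      _ ≤ 2 * (C * (N : ℝ) ^ (1 / 8 : ℝ)) ^ 2 * q := by gcongr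
      _ = _ := by
        rw [mul_pow, ← Real.rpow_natCast ((N : ℝ) ^ (1 / 8 : ℝ)), ← Real.rpow_mul hN0.le]
        norm_num
        ring
  have h4 : (N : ℝ) = (N : ℝ) ^ (3 / 4 : ℝ) * (N : ℝ) ^ (1 / 4 : ℝ) := by
    rw [← Real.rpow_add hN0]
    norm_num
  rw [h4] at h3
  have h5 : (N : ℝ) ^ (3 / 4 : ℝ) ≤ 2 * C ^ 2 * q :=
    le_of_mul_le_mul_right (by rw [← h4] at h3 ⊢; exact h3)
      (by positivity : 0 < (N : ℝ) ^ (1 / 4 : ℝ))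
  rw [one_div, inv_mul_le_iff₀ (by positivity)]
  exact h5

/-- For large `N`, an eigenvalue `x` of `slOp N R` of multiplicity at least the number of squares
of units, in the sense of the trace inequality below, is at most `θ * #(slBall R)`. -/
theorem exists_trace_bound : ∃ R : ℕ, 1 ≤ R ∧ ∃ θ : ℝ, 0 < θ ∧ θ < 1 ∧ ∃ N₁ : ℕ, ∀ (N : ℕ)
    [NeZero N], N₁ ≤ N → ∃ n : ℕ, n ≠ 0 ∧ ∀ x : ℝ, 0 ≤ x →
      x ^ (2 * n) * (Finset.univ.image fun u : (ZMod N)ˣ ↦ u ^ 2).card ≤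
        N ^ 3 * ∑ h ∈ (slBall ((2 * R) ^ (2 * n))).filter (fun h ↦ slRed N h = 1),
          slCount R (2 * n) h → x ≤ θ * (slBall R).card := by
  obtain ⟨R, hR, hΛ⟩ := exists_slLam_le
  obtain ⟨C, hC, hsum⟩ := exists_sum_slCount_le hR
  obtain ⟨c, hc, hsq⟩ := exists_rpow_le_card_image_sq
  have hΛ0 : 0 ≤ slLam R := by rw [slLam]; positivity
  set Q : ℝ := 2 * R with hQ
  have hQ2 : 2 ≤ Q := by
    have : (1 : ℝ) ≤ R := by exact_mod_cast hR
    linarith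
  have hQ0 : 0 < Q := by linarith
  refine ⟨R, hR, Q ^ (-(1 / 40) : ℝ), by positivity,
    Real.rpow_lt_one_of_one_lt_of_neg (by linarith) (by norm_num), ?_⟩
  obtain ⟨N₁, hN₁⟩ := exists_nat_ge ((C / c) ^ (40 : ℕ))
  refine ⟨max 3 N₁, fun N _ hN ↦ ?_⟩
  have hN3 : 3 ≤ N := (le_max_left _ _).trans hN
  have hNN₁ : N₁ ≤ N := (le_max_right _ _).trans hN
  have hN0 : (0 : ℝ) < N := by exact_mod_cast (by omega : 0 < N)
  have hex : ∃ n : ℕ, N ^ 5 ≤ ((2 * R) ^ (2 * n)) ^ 2 := by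
    refine ⟨N ^ 5, ?_⟩
    rw [← pow_mul]
    exact (Nat.lt_pow_self (by omega)).le.trans (Nat.pow_le_pow_right (by omega) (by omega))
  classical
  obtain ⟨n, h1, hmin⟩ : ∃ n, N ^ 5 ≤ ((2 * R) ^ (2 * n)) ^ 2 ∧
      ∀ m < n, ¬ N ^ 5 ≤ ((2 * R) ^ (2 * m)) ^ 2 :=
    ⟨Nat.find hex, Nat.find_spec hex, fun m hm ↦ Nat.find_min hex hm⟩
  have hn : n ≠ 0 := by
    rintro rfl
    have : 3 ^ 5 ≤ N ^ 5 := Nat.pow_le_pow_left hN3 5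
    norm_num at h1
    omega
  have h2 : ((2 * R) ^ (2 * n)) ^ 2 ≤ (2 * R) ^ 4 * N ^ 5 := by
    obtain ⟨m, rfl⟩ := Nat.exists_eq_succ_of_ne_zero hn
    have := (not_le.1 (hmin m (Nat.lt_succ_self m))).le
    calc ((2 * R) ^ (2 * (m + 1))) ^ 2 = (2 * R) ^ 4 * ((2 * R) ^ (2 * m)) ^ 2 := by ring
      _ ≤ _ := Nat.mul_le_mul_left _ this
  refine ⟨n, hn, fun x hx hxle ↦ ?_⟩
  set Y : ℝ := Q ^ (2 * n) with hY
  have hY1 : 1 ≤ Y := one_le_pow₀ (by linarith)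
  have hY0 : 0 < Y := by linarith
  set k : ℝ := ((slBall R).card : ℝ) with hk
  have hsum' := hsum N (2 * n) hN3 h1 h2
  have h3 : (N : ℝ) ^ (9 / 4 : ℝ) ≤ Y ^ (9 / 10 : ℝ) := by
    have h4 : (N : ℝ) ^ 5 ≤ Y ^ 2 := by rw [hY, hQ]; exact_mod_cast h1
    have h5 := Real.rpow_le_rpow (by positivity) h4 (by norm_num : (0 : ℝ) ≤ 9 / 20)
    rw [← Real.rpow_natCast, ← Real.rpow_natCast, ← Real.rpow_mul hY0.le,
      ← Real.rpow_mul hN0.le] at h5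
    norm_num at h5 ⊢
    exact h5
  have h4 : slLam R ^ (2 * n) ≤ k ^ (2 * n) * Y ^ (-(19 / 20) : ℝ) := by
    calc slLam R ^ (2 * n) ≤ (k * Q ^ (-(19 / 20) : ℝ)) ^ (2 * n) := by gcongr
      _ = _ := by
        rw [mul_pow, hY, ← Real.rpow_natCast (Q ^ (-(19 / 20) : ℝ)), ← Real.rpow_mul hQ0.le,
          ← Real.rpow_natCast Q, ← Real.rpow_mul hQ0.le, mul_comm (-(19 / 20) : ℝ)]
  have h5 : C / c ≤ Y ^ (1 / 40 : ℝ) := by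
    have h6 : (C / c) ^ 40 ≤ Y := by
      have h7 : (N : ℝ) ≤ Y := by
        have h8 : (N : ℝ) ^ 5 ≤ Y ^ 2 := by rw [hY, hQ]; exact_mod_cast h1
        have h9 : (1 : ℝ) ≤ N := by exact_mod_cast (by omega : 1 ≤ N)
        have : (N : ℝ) ^ 2 ≤ Y ^ 2 := (pow_le_pow_right₀ h9 (by norm_num)).trans h8
        exact le_of_sq_le_sq this hY0.le
      have : (N₁ : ℝ) ≤ N := by exact_mod_cast hNN₁
      linarith
    have h7 := Real.rpow_le_rpow (by positivity) h6 (by norm_num : (0 : ℝ) ≤ 1 / 40)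
    rw [← Real.rpow_natCast, ← Real.rpow_mul (by positivity)] at h7
    norm_num at h7 ⊢
    exact h7
  have h6 : x ^ (2 * n) ≤ (Q ^ (-(1 / 40) : ℝ) * k) ^ (2 * n) := by
    have e1 : x ^ (2 * n) * (c * (N : ℝ) ^ (3 / 4 : ℝ)) ≤
        N ^ 3 * (C * (k ^ (2 * n) * Y ^ (-(19 / 20) : ℝ))) := by
      calc x ^ (2 * n) * (c * (N : ℝ) ^ (3 / 4 : ℝ)) ≤ _ :=
            mul_le_mul_of_nonneg_left (hsq N) (by positivity)
        _ ≤ _ := hxle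
        _ ≤ _ := by
          gcongr
          exact hsum'.trans (by gcongr)
    have e2 : (N : ℝ) ^ 3 = (N : ℝ) ^ (3 / 4 : ℝ) * (N : ℝ) ^ (9 / 4 : ℝ) := by
      rw [← Real.rpow_add hN0, ← Real.rpow_natCast]
      norm_num
    have e3 : x ^ (2 * n) ≤
        C / c * (N : ℝ) ^ (9 / 4 : ℝ) * (k ^ (2 * n) * Y ^ (-(19 / 20) : ℝ)) := by
      have hpos : 0 < c * (N : ℝ) ^ (3 / 4 : ℝ) := by positivity
      refine le_of_mul_le_mul_right (e1.trans (le_of_eq ?_)) hpos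
      rw [e2]
      field_simp
    calc x ^ (2 * n) ≤ _ := e3
      _ ≤ Y ^ (1 / 40 : ℝ) * Y ^ (9 / 10 : ℝ) * (k ^ (2 * n) * Y ^ (-(19 / 20) : ℝ)) := by gcongr
      _ = k ^ (2 * n) * (Y ^ (1 / 40 : ℝ) * Y ^ (9 / 10 : ℝ) * Y ^ (-(19 / 20) : ℝ)) := by ring
      _ = k ^ (2 * n) * Y ^ (-(1 / 40) : ℝ) := by
          rw [← Real.rpow_add hY0, ← Real.rpow_add hY0]
          norm_num
      _ = (Q ^ (-(1 / 40) : ℝ) * k) ^ (2 * n) := by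
          rw [mul_pow, hY, ← Real.rpow_natCast (Q ^ (-(1 / 40) : ℝ)), ← Real.rpow_mul hQ0.le,
            ← Real.rpow_natCast Q, ← Real.rpow_mul hQ0.le, mul_comm (-(1 / 40) : ℝ), mul_comm]
  exact le_of_pow_le_pow_left₀ (by omega) (by positivity) h6

section Arithmetic

variable {N : ℕ}

theorem cast_div_mul_cast_eq_zero {p m : ℕ} (hp : p ∣ N) (hm : p ∣ m) :
    (((N / p : ℕ) : ZMod N)) * (m : ZMod N) = 0 := by
  obtain ⟨r, rfl⟩ := hm
  rw [← Nat.cast_mul, ← mul_assoc, Nat.div_mul_cancel hp, Nat.cast_mul, ZMod.natCast_self, zero_mul]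

theorem isUnit_of_forall_mul_ne_zero [NeZero N] {k : ZMod N}
    (hk : ∀ p ∈ N.primeFactors, k * ((N / p : ℕ) : ZMod N) ≠ 0) : IsUnit k := by
  rw [← ZMod.natCast_zmod_val k, ZMod.isUnit_iff_coprime]
  refine Nat.Coprime.symm (Nat.coprime_of_dvd fun p hp h1 h2 ↦ ?_)
  refine hk p (Nat.mem_primeFactors.2 ⟨hp, h1, NeZero.ne N⟩) ?_
  rw [← ZMod.natCast_zmod_val k, mul_comm]
  exact cast_div_mul_cast_eq_zero h1 h2

theorem isUnit_one_add_mul [NeZero N] {p : ℕ} (hp : p.Prime) (hpN : p ∣ N) (s : ZMod N)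
    (hs : ZMod.castHom hpN (ZMod p) (1 + ((N / p : ℕ) : ZMod N) * s) ≠ 0) :
    IsUnit (1 + ((N / p : ℕ) : ZMod N) * s) := by
  set u := 1 + ((N / p : ℕ) : ZMod N) * s with hu
  rw [← ZMod.natCast_zmod_val u, ZMod.isUnit_iff_coprime]
  refine Nat.Coprime.symm (Nat.coprime_of_dvd fun q hq h1 h2 ↦ ?_)
  have h3 : ZMod.castHom h1 (ZMod q) u = 0 := by
    rw [← ZMod.natCast_zmod_val u, map_natCast, ZMod.natCast_eq_zero_iff]
    exact h2
  by_cases hqp : q = p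
  · subst hqp
    exact hs h3
  · have h4 : q ∣ N / p := by
      rw [← Nat.mul_div_cancel' hpN] at h1
      exact (hq.dvd_mul.1 h1).resolve_left fun h ↦ hqp ((Nat.prime_dvd_prime_iff_eq hq hp).1 h)
    rw [hu, map_add, map_mul, map_one, map_natCast, (ZMod.natCast_eq_zero_iff _ _).2 h4, zero_mul,
      add_zero] at h3
    have := Fact.mk hq
    exact one_ne_zero h3

theorem exists_idempotent [NeZero N] {p : ℕ} (hp : p.Prime) (hpN : p ∣ N) :
    ∃ e : ZMod N, e * e = e ∧ e * ((N / p : ℕ) : ZMod N) = ((N / p : ℕ) : ZMod N) ∧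
      ∀ q ∈ N.primeFactors, q ≠ p → e * ((N / q : ℕ) : ZMod N) = 0 := by
  obtain ⟨a, M, hM, hNM⟩ := Nat.exists_eq_pow_mul_and_not_dvd (NeZero.ne N) p hp.ne_one
  have ha : a ≠ 0 := by
    rintro rfl
    rw [pow_zero, one_mul] at hNM
    exact hM (hNM ▸ hpN)
  have hcop : Nat.Coprime (p ^ a) M := Nat.Coprime.pow_left a ((hp.coprime_iff_not_dvd).2 hM)
  obtain ⟨x, y, hxy⟩ := Nat.isCoprime_iff_coprime.2 hcop
  have hxy' : (x : ZMod N) * (p ^ a : ℕ) + y * (M : ℕ) = 1 := by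
    have := congrArg (Int.cast : ℤ → ZMod N) hxy
    push_cast at this ⊢
    exact this
  have h0 : ((p ^ a : ℕ) : ZMod N) * (M : ℕ) = 0 := by
    rw [← Nat.cast_mul, ← hNM, ZMod.natCast_self]
  have hμ : (((N / p : ℕ) : ZMod N)) * ((p ^ a : ℕ) : ZMod N) = 0 :=
    cast_div_mul_cast_eq_zero hpN (dvd_pow_self p ha)
  refine ⟨y * (M : ℕ), ?_, ?_, fun q hq hqp ↦ ?_⟩
  · linear_combination (y * (M : ℕ) : ZMod N) * hxy' - x * y * h0
  · linear_combination ((N / p : ℕ) : ZMod N) * hxy' - x * hμ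
  · obtain ⟨hq1, hq2, -⟩ := Nat.mem_primeFactors.1 hq
    have hqM : q ∣ M := by
      rw [hNM] at hq2
      refine (hq1.dvd_mul.1 hq2).resolve_left fun h ↦ ?_
      exact hqp ((Nat.prime_dvd_prime_iff_eq hq1 hp).1 (hq1.dvd_of_dvd_pow h))
    have := cast_div_mul_cast_eq_zero hq2 hqM
    linear_combination (y : ZMod N) * this

end Arithmetic

section Kernel

variable {N : ℕ} [NeZero N]

/-- The conjugate of `slU t` by an element with lower row `(c, d)`. -/
def slConj {R : Type*} [CommRing R] (t c d : R) : SL₂ R :=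
  slMk (1 + t * d * c) (t * d * d) (-(t * c * c)) (1 - t * c * d) (by ring)

theorem slU_mul_eq {R : Type*} [CommRing R] (t : R) (h : SL₂ R) :
    slU t * h = h * slConj t (h 1 0) (h 1 1) := by
  have hd := sl_det h
  apply sl_ext <;> simp only [sl_mul_apply, slConj, slMk_00, slMk_01, slMk_10, slMk_11, slU_00,
    slU_01, slU_10, slU_11]
  · linear_combination -t * h 1 0 * hd
  · linear_combination -t * h 1 1 * hd
  · ring
  · ring

/-- The congruence subgroup of level `N / p` is generated by conjugates of unipotents. -/
theorem mem_of_congruence {p : ℕ} (hp : p.Prime) (hpN : p ∣ N) (H : Subgroup (SL₂ (ZMod N)))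
    (hU : ∀ z, slU (((N / p : ℕ) : ZMod N) * z) ∈ H)
    (hL : ∀ z, slL (((N / p : ℕ) : ZMod N) * z) ∈ H)
    (hE : ∀ z, slConj (((N / p : ℕ) : ZMod N) * z) 1 1 ∈ H) {κ : SL₂ (ZMod N)} {a b c d : ZMod N}
    (ha : κ 0 0 = 1 + ((N / p : ℕ) : ZMod N) * a) (hb : κ 0 1 = ((N / p : ℕ) : ZMod N) * b)
    (hc : κ 1 0 = ((N / p : ℕ) : ZMod N) * c) (hd : κ 1 1 = 1 + ((N / p : ℕ) : ZMod N) * d) :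
    κ ∈ H := by
  set μ : ZMod N := ((N / p : ℕ) : ZMod N) with hμ
  have hdiag : ∀ (u : (ZMod N)ˣ) z, (u : ZMod N) = 1 + μ * z → slDiag u ∈ H := by
    intro u z hu
    have h1 := sl_eq_lower_diag_upper (slConj (μ * z) 1 1) u (by simp [slConj, hu])
    have h2 : slDiag u = (slL (slConj (μ * z) 1 1 1 0 * ((u⁻¹ : (ZMod N)ˣ) : ZMod N)))⁻¹ *
        slConj (μ * z) 1 1 * (slU (((u⁻¹ : (ZMod N)ˣ) : ZMod N) * slConj (μ * z) 1 1 0 1))⁻¹ := by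
      rw [eq_mul_inv_iff_mul_eq, eq_inv_mul_iff_mul_eq, ← mul_assoc]
      exact h1.symm
    rw [h2]
    refine H.mul_mem (H.mul_mem (H.inv_mem ?_) (hE z)) (H.inv_mem ?_)
    · have : slConj (μ * z) 1 1 1 0 * ((u⁻¹ : (ZMod N)ˣ) : ZMod N) =
        μ * (-z * ((u⁻¹ : (ZMod N)ˣ) : ZMod N)) := by simp [slConj]; ring
      rw [this]
      exact hL _
    · have : ((u⁻¹ : (ZMod N)ˣ) : ZMod N) * slConj (μ * z) 1 1 0 1 =
        μ * (((u⁻¹ : (ZMod N)ˣ) : ZMod N) * z) := by simp [slConj]; ring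
      rw [this]
      exact hU _
  have hunit : ∀ (κ : SL₂ (ZMod N)) (a b c : ZMod N), κ 0 0 = 1 + μ * a → κ 0 1 = μ * b →
      κ 1 0 = μ * c → IsUnit (1 + μ * a) → κ ∈ H := by
    intro κ a b c ha hb hc ⟨u, hu⟩
    rw [sl_eq_lower_diag_upper κ u (by rw [ha, hu]), hb, hc]
    refine H.mul_mem (H.mul_mem ?_ (hdiag u a hu)) ?_
    · rw [mul_assoc]
      exact hL _
    · rw [mul_left_comm]
      exact hU _
  have := Fact.mk hp
  by_cases h1 : ZMod.castHom hpN (ZMod p) (1 + μ * a) = 0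
  · have h2 : ZMod.castHom hpN (ZMod p) (1 + μ * (a + μ * c)) ≠ 0 := by
      intro h2
      have hdet := sl_det κ
      rw [ha, hb, hc, hd] at hdet
      have h3 := congrArg (ZMod.castHom hpN (ZMod p)) hdet
      rw [map_sub, map_mul, h1, zero_mul, map_mul, map_one, zero_sub] at h3
      rw [mul_add, ← add_assoc, map_add, h1, zero_add, map_mul] at h2
      rcases mul_eq_zero.1 h2 with h4 | h4
      · rw [map_mul, h4, zero_mul, zero_mul, neg_zero] at h3
        exact zero_ne_one h3
      · rw [h4, mul_zero, neg_zero] at h3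
        exact zero_ne_one h3
    have h3 : slU (μ * 1) * κ ∈ H := by
      refine hunit _ (a + μ * c) (b + 1 + μ * d) c ?_ ?_ ?_ (isUnit_one_add_mul hp hpN _ h2) <;>
        simp only [sl_mul_apply, slU_00, slU_01, slU_10, slU_11, ha, hb, hc, hd] <;> ring
    exact (H.mul_mem_cancel_left (hU 1)).1 h3
  · exact hunit κ a b c ha hb hc (isUnit_one_add_mul hp hpN _ h1)

end Kernel

section Primitive

variable {N : ℕ} [NeZero N]

/-- The part of `f` on which right translation by `slU y` acts by the character `e(k y)`. -/
noncomputable def slProj (k : ZMod N) (f : SL₂ (ZMod N) → ℂ) (x : SL₂ (ZMod N)) : ℂ :=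
  (N : ℂ)⁻¹ * ∑ y : ZMod N, ZMod.stdAddChar (-(k * y)) * f (x * slU y)

theorem slProj_mul_slU (k : ZMod N) (f : SL₂ (ZMod N) → ℂ) (x : SL₂ (ZMod N)) (z : ZMod N) :
    slProj k f (x * slU z) = ZMod.stdAddChar (k * z) * slProj k f x := by
  rw [slProj, slProj, mul_left_comm]
  congr 1
  rw [Finset.mul_sum]
  conv_rhs => rw [← Equiv.sum_comp (Equiv.addLeft z)]
  refine Finset.sum_congr rfl fun y _ ↦ ?_
  rw [← mul_assoc, ← AddChar.map_add_eq_mul]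
  simp only [Equiv.coe_addLeft]
  rw [mul_assoc x, ← slU_add]
  congr 2
  ring_nf

theorem sum_slProj (f : SL₂ (ZMod N) → ℂ) (x : SL₂ (ZMod N)) : ∑ k, slProj k f x = f x := by
  have hN : (N : ℂ) ≠ 0 := Nat.cast_ne_zero.2 (NeZero.ne N)
  simp only [slProj]
  rw [← Finset.mul_sum, Finset.sum_comm]
  have h : ∀ y : ZMod N, ∑ k : ZMod N, ZMod.stdAddChar (-(k * y)) * f (x * slU y) =
      if y = 0 then (N : ℂ) * f x else 0 := by
    intro y
    rw [← Finset.sum_mul]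
    have h1 := AddChar.sum_mulShift (-y) (ZMod.isPrimitive_stdAddChar N)
    simp only [mul_neg] at h1
    rw [h1]
    rcases eq_or_ne y 0 with rfl | hy
    · simp [slU_zero]
    · simp [hy]
  rw [Finset.sum_congr rfl fun y _ ↦ h y]
  simp [hN]

variable {V : Submodule ℂ (SL₂ (ZMod N) → ℂ)}

theorem slProj_mem (hV : ∀ f ∈ V, ∀ g, (fun x ↦ f (x * g)) ∈ V) (k : ZMod N)
    {f : SL₂ (ZMod N) → ℂ} (hf : f ∈ V) : slProj k f ∈ V := by
  have : slProj k f = (N : ℂ)⁻¹ • ∑ y : ZMod N, (ZMod.stdAddChar (-(k * y)) : ℂ) •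
      (fun x ↦ f (x * slU y)) := by
    ext x
    simp [slProj]
  rw [this]
  exact V.smul_mem _ (V.sum_mem fun y _ ↦ V.smul_mem _ (hV f hf _))

theorem exists_slProj_ne_zero {f : SL₂ (ZMod N) → ℂ} (hf : f ≠ 0) : ∃ k, slProj k f ≠ 0 := by
  by_contra! h
  apply hf
  ext x
  rw [← sum_slProj f x]
  simp [h]

/-- If `f` has character `k` and all components of the right translate by `h` have characters
killing `t`, then `f` is invariant under the conjugate of `slU t` by `h`. -/
theorem right_invariant_slConj {f : SL₂ (ZMod N) → ℂ} (h : SL₂ (ZMod N)) (t : ZMod N)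
    (hk : ∀ k, slProj k (fun x ↦ f (x * h)) ≠ 0 → k * t = 0) (x : SL₂ (ZMod N)) :
    f (x * slConj t (h 1 0) (h 1 1)) = f x := by
  have h1 : ∀ y, f (y * slU t * h) = f (y * h) := by
    intro y
    rw [← sum_slProj (fun x ↦ f (x * h)) (y * slU t), ← sum_slProj (fun x ↦ f (x * h)) y]
    refine Finset.sum_congr rfl fun k _ ↦ ?_
    rw [slProj_mul_slU]
    by_cases h0 : slProj k (fun x ↦ f (x * h)) = 0
    · rw [h0]
      simp
    · rw [hk k h0, AddChar.map_zero_eq_one, one_mul]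
  have h2 := h1 (x * h⁻¹)
  rw [inv_mul_cancel_right, mul_assoc, slU_mul_eq, mul_assoc, inv_mul_cancel_left] at h2
  exact h2

theorem char_eq_of_slProj_ne_zero {f : SL₂ (ZMod N) → ℂ} {k k' e : ZMod N}
    (hf : ∀ x y, f (x * slU y) = ZMod.stdAddChar (k * y) * f x) (h : SL₂ (ZMod N))
    (hcomm : ∀ y, slU ((1 - e) * y) * h = h * slU ((1 - e) * y))
    (hk' : slProj k' (fun x ↦ f (x * h)) ≠ 0) : k' * (1 - e) = k * (1 - e) := by
  obtain ⟨x, hx⟩ := Function.ne_iff.1 hk'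
  have h1 : ∀ y, ZMod.stdAddChar (k' * ((1 - e) * y)) =
      (ZMod.stdAddChar (k * ((1 - e) * y)) : ℂ) := by
    intro y
    have h2 := slProj_mul_slU k' (fun x ↦ f (x * h)) x ((1 - e) * y)
    have h3 : slProj k' (fun x ↦ f (x * h)) (x * slU ((1 - e) * y)) =
        ZMod.stdAddChar (k * ((1 - e) * y)) * slProj k' (fun x ↦ f (x * h)) x := by
      rw [slProj, slProj, mul_left_comm]
      congr 1
      rw [Finset.mul_sum]
      refine Finset.sum_congr rfl fun z _ ↦ ?_
      rw [mul_assoc x, ← slU_add, add_comm ((1 - e) * y), slU_add, ← mul_assoc x,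
        mul_assoc _ _ h, hcomm,
        ← mul_assoc, hf]
      ring
    exact mul_right_cancel₀ hx (h2.symm.trans h3)
  have h4 : ((k' - k) * (1 - e)) = 0 := by
    by_contra h5
    refine ZMod.isPrimitive_stdAddChar N h5 ?_
    ext y
    rw [AddChar.mulShift_apply, AddChar.one_apply, show (k' - k) * (1 - e) * y =
      k' * ((1 - e) * y) - k * ((1 - e) * y) by ring, AddChar.map_sub_eq_div, h1]
    refine div_self fun h0 ↦ ?_
    have h6 := AddChar.map_add_eq_mul (ZMod.stdAddChar (N := N)) (k * ((1 - e) * y))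
      (-(k * ((1 - e) * y)))
    rw [add_neg_cancel, AddChar.map_zero_eq_one, h0, zero_mul] at h6
    exact one_ne_zero h6
  linear_combination h4

/-- The element acting as `h` on the image of the idempotent `e` and trivially on its
complement. -/
def slPart {e : ZMod N} (he : e * e = e) (h : SL₂ (ZMod N)) : SL₂ (ZMod N) :=
  slMk (e * h 0 0 + (1 - e)) (e * h 0 1) (e * h 1 0) (e * h 1 1 + (1 - e)) (by
    have hd := sl_det h
    linear_combination e * e * hd + (1 + 1 - h 0 0 - h 1 1) * he)

theorem exists_primitive (hV : ∀ f ∈ V, ∀ g, (fun x ↦ f (x * g)) ∈ V) (hne : V ≠ ⊥)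
    (hprim : ∀ p ∈ N.primeFactors, ∀ f ∈ V, (∀ (κ : SL₂ (ZMod N)) (a b c d : ZMod N),
      κ 0 0 = 1 + ((N / p : ℕ) : ZMod N) * a → κ 0 1 = ((N / p : ℕ) : ZMod N) * b →
      κ 1 0 = ((N / p : ℕ) : ZMod N) * c → κ 1 1 = 1 + ((N / p : ℕ) : ZMod N) * d →
      ∀ x, f (x * κ) = f x) → f = 0) :
    ∃ f ∈ V, f ≠ 0 ∧ ∃ k : ZMod N, IsUnit k ∧
      ∀ x y, f (x * slU y) = ZMod.stdAddChar (k * y) * f x := by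
  classical
  set T : Finset (ZMod N) := Finset.univ.filter fun k ↦ ∃ f ∈ V, f ≠ 0 ∧
    ∀ x y, f (x * slU y) = ZMod.stdAddChar (k * y) * f x with hT
  have hTne : T.Nonempty := by
    obtain ⟨f, hf, hf0⟩ := V.ne_bot_iff.1 hne
    obtain ⟨k, hk⟩ := exists_slProj_ne_zero hf0
    exact ⟨k, Finset.mem_filter.2 ⟨Finset.mem_univ _, _, slProj_mem hV k hf, hk,
      slProj_mul_slU k f⟩⟩
  obtain ⟨k, hk, hmax⟩ := T.exists_max_image
    (fun k ↦ (N.primeFactors.filter fun p ↦ k * ((N / p : ℕ) : ZMod N) ≠ 0).card) hTne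
  obtain ⟨-, f, hf, hf0, hfk⟩ := Finset.mem_filter.1 hk
  refine ⟨f, hf, hf0, k, isUnit_of_forall_mul_ne_zero fun p hp hkp ↦ hf0 (hprim p hp f hf ?_), hfk⟩
  obtain ⟨hp1, hp2, -⟩ := Nat.mem_primeFactors.1 hp
  obtain ⟨e, hee, hep, heq⟩ := exists_idempotent hp1 hp2
  set μ : ZMod N := ((N / p : ℕ) : ZMod N) with hμ
  have hkill : ∀ (h : SL₂ (ZMod N)) k', slProj k' (fun x ↦ f (x * slPart hee h)) ≠ 0 →
      k' * μ = 0 := by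
    intro h k' hk'
    by_contra hne
    have h1 := char_eq_of_slProj_ne_zero (e := e) hfk (slPart hee h) ?_ hk'
    · have h2 : k' ∈ T := Finset.mem_filter.2 ⟨Finset.mem_univ _, _,
        slProj_mem hV k' (hV f hf _), hk', slProj_mul_slU k' _⟩
      refine (hmax k' h2).not_gt (Finset.card_lt_card (Finset.ssubset_iff_of_subset ?_ |>.2
        ⟨p, Finset.mem_filter.2 ⟨hp, hne⟩, fun h3 ↦ (Finset.mem_filter.1 h3).2 hkp⟩))
      intro q hq
      obtain ⟨hq1, hq2⟩ := Finset.mem_filter.1 hq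
      refine Finset.mem_filter.2 ⟨hq1, fun h3 ↦ hq2 ?_⟩
      have hqp : q ≠ p := by
        rintro rfl
        exact hq2 hkp
      have := heq q hq1 hqp
      linear_combination h3 - ((N / q : ℕ) : ZMod N) * h1 + (k - k') * this
    · intro y
      apply sl_ext <;> simp only [sl_mul_apply, slPart, slMk_00, slMk_01, slMk_10, slMk_11, slU_00,
        slU_01, slU_10, slU_11]
      · linear_combination -y * h 1 0 * hee
      · linear_combination (-y * h 1 1 + y * h 0 0) * hee
      · ring
      · linear_combination y * h 1 0 * hee
  have hinv : ∀ (h : SL₂ (ZMod N)) z x, f (x * slConj (μ * z) (h 1 0) (h 1 1)) = f x := by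
    intro h z x
    have h1 := right_invariant_slConj (f := f) (slPart hee h) (μ * z)
      (fun k' hk' ↦ by rw [← mul_assoc, hkill h k' hk', zero_mul]) x
    rw [← h1]
    congr 2
    have e1 : μ * z * slPart hee h 1 0 = μ * z * h 1 0 := by
      simp only [slPart, slMk_10]
      linear_combination z * h 1 0 * hep
    have e2 : μ * z * slPart hee h 1 1 = μ * z * h 1 1 := by
      simp only [slPart, slMk_11]
      linear_combination (z * h 1 1 - z) * hep
    apply sl_ext <;> simp only [slConj, slMk_00, slMk_01, slMk_10, slMk_11]
    · linear_combination -slPart hee h 1 0 * e2 - h 1 1 * e1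
    · linear_combination -slPart hee h 1 1 * e2 - h 1 1 * e2
    · linear_combination slPart hee h 1 0 * e1 + h 1 0 * e1
    · linear_combination slPart hee h 1 1 * e1 + h 1 0 * e2
  let H : Subgroup (SL₂ (ZMod N)) :=
    { carrier := {g | ∀ x, f (x * g) = f x}
      mul_mem' := fun {a b} ha hb x ↦ by
        rw [← mul_assoc, hb, ha]
      one_mem' := fun x ↦ by rw [mul_one]
      inv_mem' := fun {a} ha x ↦ by
        rw [← ha (x * a⁻¹), inv_mul_cancel_right] }
  intro κ a b c d ha hb hc hd
  refine mem_of_congruence hp1 hp2 H (fun z x ↦ ?_) (fun z x ↦ ?_) (fun z x ↦ ?_) ha hb hc hd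
  · rw [← hinv 1 z x]
    congr 2
    apply sl_ext <;> simp [slConj, sl_one_10, sl_one_11, hμ]
  · rw [← hinv (slMk 0 (-1) 1 0 (by ring)) (-z) x]
    congr 2
    apply sl_ext <;> simp [slConj, hμ]
  · exact hinv (slL 1) z x

end Primitive

section Operator

variable {N : ℕ} (R : ℕ)

theorem slOp_pow_eq_of_eq {f : SL₂ (ZMod N) → ℂ} {y : ℂ} (hf : slOp N R f = y • f) (n : ℕ) :
    (slOp N R ^ n) f = y ^ n • f := by
  induction n with
  | zero => simp
  | succ n ih => rw [pow_succ, Module.End.mul_apply, hf, map_smul, ih, smul_smul, pow_succ']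

theorem slOp_right_translate (f : SL₂ (ZMod N) → ℂ) (g : SL₂ (ZMod N)) :
    slOp N R (fun x ↦ f (x * g)) = fun x ↦ slOp N R f (x * g) := by
  ext x
  simp only [slOp_apply, mul_assoc]

theorem slU_mul_slDiag (u : (ZMod N)ˣ) (y : ZMod N) :
    slU y * slDiag u = slDiag u * slU (((u⁻¹ : (ZMod N)ˣ) : ZMod N) ^ 2 * y) := by
  have h : (u : ZMod N) * ((u⁻¹ : (ZMod N)ˣ) : ZMod N) = 1 := u.mul_inv
  apply sl_ext <;> simp only [sl_mul_apply, slU_00, slU_01, slU_10, slU_11, slDiag_00, slDiag_01,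
    slDiag_10, slDiag_11]
  · ring
  · linear_combination (-((u⁻¹ : (ZMod N)ˣ) : ZMod N) * y) * h
  · ring
  · ring

variable [NeZero N]

open ComplexConjugate in
theorem slOp_symm (f g : SL₂ (ZMod N) → ℂ) :
    ∑ x, conj (slOp N R f x) * g x = ∑ x, conj (f x) * slOp N R g x := by
  simp only [slOp_apply, map_sum, Finset.sum_mul, Finset.mul_sum]
  rw [Finset.sum_comm, Finset.sum_comm (s := Finset.univ),
    ← sum_slBall_inv R fun b ↦ ∑ x, conj (f x) * g (slRed N b * x)]
  refine Finset.sum_congr rfl fun b _ ↦ ?_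
  rw [← Equiv.sum_comp (Equiv.mulLeft (slRed N b)) fun x ↦ conj (f x) * g (slRed N b⁻¹ * x)]
  simp [map_inv]

/-- The operator `slOp` on the Euclidean space of functions. -/
noncomputable def slOpE (N R : ℕ) :
    EuclideanSpace ℂ (SL₂ (ZMod N)) →ₗ[ℂ] EuclideanSpace ℂ (SL₂ (ZMod N)) :=
  (WithLp.linearEquiv 2 ℂ (SL₂ (ZMod N) → ℂ)).symm.conj (slOp N R)

theorem slOpE_toLp (N R : ℕ) (f : SL₂ (ZMod N) → ℂ) :
    slOpE N R (WithLp.toLp 2 f) = WithLp.toLp 2 (slOp N R f) := rfl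

open ComplexConjugate in
theorem inner_euclidean_eq {ι : Type*} [Fintype ι] (v w : EuclideanSpace ℂ ι) :
    inner ℂ v w = ∑ x, conj (v x) * w x := by
  rw [PiLp.inner_apply]
  refine Finset.sum_congr rfl fun x _ ↦ ?_
  rw [RCLike.inner_apply, mul_comm]

theorem slOpE_isSymmetric : (slOpE N R).IsSymmetric := fun v w ↦ by
  rw [inner_euclidean_eq, inner_euclidean_eq]
  exact slOp_symm R v.ofLp w.ofLp

open ComplexConjugate in
theorem sum_conj_mul_eq_zero {f g : SL₂ (ZMod N) → ℂ} {k l : ZMod N} (hkl : k ≠ l)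
    (hf : ∀ x y, f (x * slU y) = ZMod.stdAddChar (k * y) * f x)
    (hg : ∀ x y, g (x * slU y) = ZMod.stdAddChar (l * y) * g x) :
    ∑ x, conj (f x) * g x = 0 := by
  have h1 := ZMod.isPrimitive_stdAddChar N (sub_ne_zero.2 hkl.symm)
  rw [AddChar.ne_one_iff] at h1
  obtain ⟨z, hz⟩ := h1
  rw [AddChar.mulShift_apply, sub_mul, AddChar.map_sub_eq_div] at hz
  have h2 : ∑ x, conj (f x) * g x =
      (ZMod.stdAddChar (l * z) / ZMod.stdAddChar (k * z)) * ∑ x, conj (f x) * g x := by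
    conv_lhs => rw [← Equiv.sum_comp (Equiv.mulRight (slU z))]
    rw [Finset.mul_sum]
    refine Finset.sum_congr rfl fun x _ ↦ ?_
    simp only [Equiv.coe_mulRight]
    rw [hf, hg, map_mul, ← AddChar.map_neg_eq_conj, AddChar.map_neg_eq_inv]
    ring
  by_contra h3
  exact hz (mul_right_cancel₀ h3 (h2.symm.trans (one_mul _).symm))

/-- The trace inequality for a primitive eigenfunction. -/
theorem trace_le {f : SL₂ (ZMod N) → ℂ} (hf0 : f ≠ 0) {k : ZMod N} (hk : IsUnit k)
    (hfk : ∀ x y, f (x * slU y) = ZMod.stdAddChar (k * y) * f x) {y : ℝ}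
    (hf : slOp N R f = (y : ℂ) • f) (n : ℕ) :
    y ^ (2 * n) * (Finset.univ.image fun u : (ZMod N)ˣ ↦ u ^ 2).card ≤
        N ^ 3 * ∑ h ∈ (slBall ((2 * R) ^ (2 * n))).filter (fun h ↦ slRed N h = 1),
          slCount R (2 * n) h := by
  set S := Finset.univ.image fun u : (ZMod N)ˣ ↦ u ^ 2 with hS
  set M := ∑ h ∈ (slBall ((2 * R) ^ (2 * n))).filter (fun h ↦ slRed N h = 1),
    slCount R (2 * n) h with hM
  have hM0 : 0 ≤ M := Finset.sum_nonneg fun h _ ↦ slCount_nonneg _ _ _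
  have hroot : ∀ s : S, ∃ u : (ZMod N)ˣ, u ^ 2 = s.1 := fun s ↦ by
    obtain ⟨u, -, hu⟩ := Finset.mem_image.1 s.2
    exact ⟨u, hu⟩
  choose r hr using hroot
  set F : ℝ := ∑ x, ‖f x‖ ^ 2 with hF
  have hF0 : 0 < F := by
    obtain ⟨x, hx⟩ := Function.ne_iff.1 hf0
    exact Finset.sum_pos' (fun _ _ ↦ by positivity) ⟨x, Finset.mem_univ _, by
      have := norm_pos_iff.2 hx
      positivity⟩
  have hFs : ∀ g : SL₂ (ZMod N), ∑ x, ‖f (x * g)‖ ^ 2 = F := fun g ↦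
    Equiv.sum_comp (Equiv.mulRight g) fun x ↦ ‖f x‖ ^ 2
  set v : S → EuclideanSpace ℂ (SL₂ (ZMod N)) := fun s ↦
    ((√F)⁻¹ : ℂ) • WithLp.toLp 2 (fun x ↦ f (x * slDiag (r s))) with hv
  have hchar : ∀ s x z, f (x * slU z * slDiag (r s)) =
      ZMod.stdAddChar (k * (((r s)⁻¹ : (ZMod N)ˣ) : ZMod N) ^ 2 * z) * f (x * slDiag (r s)) := by
    intro s x z
    rw [mul_assoc x, slU_mul_slDiag, ← mul_assoc x, hfk, mul_assoc k]
  have hortho : Orthonormal ℂ v := by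
    constructor
    · intro s
      rw [hv, norm_smul, EuclideanSpace.norm_eq]
      simp only
      rw [hFs, norm_inv, Complex.norm_real, Real.norm_of_nonneg (Real.sqrt_nonneg F),
        inv_mul_cancel₀ (Real.sqrt_pos.2 hF0).ne']
    · intro s t hst
      simp only [hv]
      rw [inner_smul_left, inner_smul_right, inner_euclidean_eq]
      simp only
      rw [sum_conj_mul_eq_zero (k := k * (((r s)⁻¹ : (ZMod N)ˣ) : ZMod N) ^ 2)
        (l := k * (((r t)⁻¹ : (ZMod N)ˣ) : ZMod N) ^ 2) ?_ (hchar s) (hchar t), mul_zero, mul_zero]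
      intro h
      apply hst
      have h1 := hk.mul_left_cancel h
      have h2 : (r s)⁻¹ ^ 2 = (r t)⁻¹ ^ 2 := Units.ext (by push_cast; exact h1)
      rw [inv_pow, inv_pow, hr, hr] at h2
      exact Subtype.ext (inv_injective h2)
  have hpt : ∀ g, y ^ (2 * n) * ∑ s : S, ‖f (g * slDiag (r s))‖ ^ 2 ≤ F * M := by
    intro g
    set u : EuclideanSpace ℂ (SL₂ (ZMod N)) :=
      WithLp.toLp 2 ((slOp N R ^ n) (Pi.single g 1)) with hu
    have hsymm : ∀ (m : ℕ) (a b : EuclideanSpace ℂ (SL₂ (ZMod N))),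
        inner ℂ ((slOpE N R ^ m) a) b = inner ℂ a ((slOpE N R ^ m) b) :=
      fun m ↦ (slOpE_isSymmetric R).pow m
    have hpow : ∀ (m : ℕ) (h : SL₂ (ZMod N) → ℂ),
        (slOpE N R ^ m) (WithLp.toLp 2 h) = WithLp.toLp 2 ((slOp N R ^ m) h) := by
      intro m h
      induction m generalizing h with
      | zero => rfl
      | succ m ih => rw [pow_succ, pow_succ, Module.End.mul_apply, Module.End.mul_apply, slOpE_toLp,
          ih]
    have hunorm : ‖u‖ ^ 2 = M := by
      have h1 : inner ℂ u u = (M : ℂ) := by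
        rw [hu, ← hpow, hsymm, ← Module.End.mul_apply, ← pow_add, ← two_mul, hpow,
          inner_euclidean_eq, hM, ← slOp_pow_single N R (2 * n) g]
        simp [Pi.single_apply, apply_ite]
      rw [inner_self_eq_norm_sq_to_K] at h1
      exact Complex.ofReal_injective (by push_cast; exact h1)
    have hin : ∀ s, ‖inner ℂ (v s) u‖ ^ 2 = F⁻¹ * (y ^ (2 * n) * ‖f (g * slDiag (r s))‖ ^ 2) := by
      intro s
      have heig : slOp N R (fun x ↦ f (x * slDiag (r s))) =
          (y : ℂ) • fun x ↦ f (x * slDiag (r s)) := by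
        rw [slOp_right_translate, hf]
        rfl
      have h1 : inner ℂ (v s) u =
          (starRingEnd ℂ) (((√F)⁻¹ : ℂ) * ((y : ℂ) ^ n * f (g * slDiag (r s)))) := by
        rw [hu, ← hpow, ← hsymm]
        simp only [hv]
        rw [map_smul, hpow, slOp_pow_eq_of_eq R heig, inner_smul_left, inner_euclidean_eq]
        simp [Pi.single_apply]
      rw [h1, RCLike.norm_conj, norm_mul, norm_mul, norm_inv, norm_pow, Complex.norm_real,
        Complex.norm_real, Real.norm_of_nonneg (Real.sqrt_nonneg F), mul_pow, mul_pow, inv_pow,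
        Real.sq_sqrt hF0.le, Real.norm_eq_abs, ← pow_mul, mul_comm n 2, pow_mul, pow_mul, sq_abs]
    have hb := hortho.sum_inner_products_le (s := Finset.univ) (x := u)
    rw [hunorm, Finset.sum_congr rfl fun s _ ↦ hin s, ← Finset.mul_sum, ← Finset.mul_sum,
      inv_mul_le_iff₀ hF0] at hb
    exact hb
  have hsum := Finset.sum_le_sum fun g (_ : g ∈ (Finset.univ : Finset (SL₂ (ZMod N)))) ↦ hpt g
  rw [← Finset.mul_sum, Finset.sum_comm, Finset.sum_congr rfl fun s _ ↦ hFs _, Finset.sum_const,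
    Finset.sum_const, Finset.card_univ, Finset.card_univ, Fintype.card_coe, nsmul_eq_mul,
    nsmul_eq_mul] at hsum
  have hcard : (Fintype.card (SL₂ (ZMod N)) : ℝ) ≤ N ^ 3 := by exact_mod_cast card_sl_le N
  have h3 : (y ^ (2 * n) * S.card) * F ≤ (N ^ 3 * M) * F := by
    calc (y ^ (2 * n) * S.card) * F ≤ (Fintype.card (SL₂ (ZMod N))) * (F * M) := by linarith
      _ ≤ N ^ 3 * (F * M) := by gcongr
      _ = _ := by ring
  exact le_of_mul_le_mul_right h3 hF0

end Operator

theorem re_inner_le_of_eigenvalues_le {E : Type*} [NormedAddCommGroup E] [InnerProductSpace ℂ E]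
    [FiniteDimensional ℂ E] {T : E →ₗ[ℂ] E} (hT : T.IsSymmetric) {c : ℝ}
    (hc : ∀ (x : ℝ) (v : E), v ≠ 0 → T v = (x : ℂ) • v → x ≤ c) (w : E) :
    (inner ℂ w (T w)).re ≤ c * ‖w‖ ^ 2 := by
  set b := hT.eigenvectorBasis rfl with hb
  have h1 : ∀ i, inner ℂ w (b i) * inner ℂ (b i) (T w) =
      ((hT.eigenvalues rfl i * ‖inner ℂ w (b i)‖ ^ 2 : ℝ) : ℂ) := by
    intro i
    rw [← hT (b i) w, hb, hT.apply_eigenvectorBasis, inner_smul_left, ← hb,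
      ← inner_conj_symm (b i) w, mul_left_comm, RCLike.mul_conj]
    simp
  have h2 : (inner ℂ w (T w)).re = ∑ i, hT.eigenvalues rfl i * ‖inner ℂ w (b i)‖ ^ 2 := by
    rw [← b.sum_inner_mul_inner w (T w), Finset.sum_congr rfl fun i _ ↦ h1 i, ← Complex.ofReal_sum,
      Complex.ofReal_re]
  have h3 : ‖w‖ ^ 2 = ∑ i, ‖inner ℂ w (b i)‖ ^ 2 := (b.sum_sq_norm_inner_left w).symm
  rw [h2, h3, Finset.mul_sum]
  refine Finset.sum_le_sum fun i _ ↦ mul_le_mul_of_nonneg_right ?_ (by positivity)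
  exact hc _ (b i) (b.orthonormal.ne_zero i) (hT.apply_eigenvectorBasis rfl i)

section Gap

variable {N : ℕ} [NeZero N] {R : ℕ}

open ComplexConjugate in
theorem dirichlet_eq (f : SL₂ (ZMod N) → ℂ) :
    ∑ x, ∑ b ∈ slBall R, ‖f (slRed N b * x) - f x‖ ^ 2 =
      2 * (slBall R).card * ∑ x, ‖f x‖ ^ 2 - 2 * (∑ x, conj (f x) * slOp N R f x).re := by
  have h1 : ∀ a b : ℂ, ‖a - b‖ ^ 2 = ‖a‖ ^ 2 + ‖b‖ ^ 2 - 2 * (conj b * a).re := by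
    intro a b
    rw [← Complex.normSq_eq_norm_sq, ← Complex.normSq_eq_norm_sq, ← Complex.normSq_eq_norm_sq,
      Complex.normSq_sub, mul_comm a]
  simp only [h1, slOp_apply]
  rw [Finset.sum_comm]
  simp only [Finset.sum_sub_distrib, Finset.sum_add_distrib, ← Finset.mul_sum]
  have h2 : ∀ b : SL₂ ℤ, ∑ x, ‖f (slRed N b * x)‖ ^ 2 = ∑ x, ‖f x‖ ^ 2 := fun b ↦
    Equiv.sum_comp (Equiv.mulLeft (slRed N b)) fun x ↦ ‖f x‖ ^ 2
  simp only [h2, Finset.sum_const, nsmul_eq_mul]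
  have h3 : ∑ x, conj (f x) * ∑ b ∈ slBall R, f (slRed N b * x) =
      ∑ b ∈ slBall R, ∑ x, conj (f x) * f (slRed N b * x) := by
    simp only [Finset.mul_sum]
    rw [Finset.sum_comm]
  rw [h3]
  simp only [Complex.re_sum]
  ring

theorem slU_mem_slBall (hR : 1 ≤ R) : slU 1 ∈ slBall R := by
  rw [mem_slBall]
  have : (1 : ℤ) ≤ R := by exact_mod_cast hR
  intro i j
  fin_cases i <;> fin_cases j <;> simp [this]

theorem slL_mem_slBall (hR : 1 ≤ R) : slL 1 ∈ slBall R := by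
  rw [mem_slBall]
  have : (1 : ℤ) ≤ R := by exact_mod_cast hR
  intro i j
  fin_cases i <;> fin_cases j <;> simp [this]

theorem card_slBall_pos (hR : 1 ≤ R) : (0 : ℝ) < (slBall R).card := by
  exact_mod_cast Finset.card_pos.2 ⟨_, slU_mem_slBall hR⟩

theorem const_of_one_le (hR : 1 ≤ R) {f : SL₂ (ZMod N) → ℂ} {x : ℝ} (hx : 1 ≤ x)
    (hf : slOp N R f = ((x * (slBall R).card : ℝ) : ℂ) • f) (g : SL₂ (ZMod N)) : f g = f 1 := by
  have hB := card_slBall_pos hR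
  have h1 : ∑ y, ∑ b ∈ slBall R, ‖f (slRed N b * y) - f y‖ ^ 2 ≤ 0 := by
    rw [dirichlet_eq, hf]
    have h2 : (∑ y, (starRingEnd ℂ) (f y) * (((x * (slBall R).card : ℝ) : ℂ) • f) y) =
        ((x * (slBall R).card * ∑ y, ‖f y‖ ^ 2 : ℝ) : ℂ) := by
      rw [Complex.ofReal_mul _ (∑ y, ‖f y‖ ^ 2), Complex.ofReal_sum, Finset.mul_sum]
      refine Finset.sum_congr rfl fun y _ ↦ ?_
      rw [Pi.smul_apply, smul_eq_mul, mul_left_comm, Complex.conj_mul', Complex.ofReal_pow]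
    rw [h2, Complex.ofReal_re]
    have h3 : 0 ≤ ∑ y, ‖f y‖ ^ 2 := Finset.sum_nonneg fun _ _ ↦ by positivity
    have h4 : 0 ≤ (x - 1) * ((slBall R).card * ∑ y, ‖f y‖ ^ 2) :=
      mul_nonneg (by linarith) (by positivity)
    linarith
  have h2 : ∀ y, ∀ b ∈ slBall R, f (slRed N b * y) = f y := by
    intro y b hb
    have h3 := (Finset.sum_eq_zero_iff_of_nonneg fun y _ ↦ Finset.sum_nonneg fun b _ ↦ by
      positivity).1 (le_antisymm h1 (Finset.sum_nonneg fun y _ ↦ Finset.sum_nonneg fun b _ ↦ by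
      positivity)) y (Finset.mem_univ _)
    have h4 := (Finset.sum_eq_zero_iff_of_nonneg fun b _ ↦ by positivity).1 h3 b hb
    exact sub_eq_zero.1 (norm_eq_zero.1 (pow_eq_zero_iff (two_ne_zero) |>.1 h4))
  let H : Subgroup (SL₂ (ZMod N)) :=
    { carrier := {h | ∀ y, f (h * y) = f y}
      mul_mem' := fun {a b} ha hb y ↦ by rw [mul_assoc, ha, hb]
      one_mem' := fun y ↦ by rw [one_mul]
      inv_mem' := fun {a} ha y ↦ by rw [← ha (a⁻¹ * y), mul_inv_cancel_left] }
  have hH : H = ⊤ := by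
    refine subgroup_eq_top_of_slU_slL H (fun y ↦ ?_) fun y ↦ ?_
    · have := h2 y _ (slU_mem_slBall hR)
      rwa [slRed_slU, Int.cast_one] at this
    · have := h2 y _ (slL_mem_slBall hR)
      rwa [slRed_slL, Int.cast_one] at this
  have hg : g ∈ H := hH ▸ Subgroup.mem_top g
  have := hg 1
  rwa [mul_one] at this

/-- Eigenvalues strictly between `θ` and `1` do not occur. -/
theorem exists_gap_of_lt (hR : 1 ≤ R) (M : ℕ) : ∃ θ : ℝ, 0 < θ ∧ θ < 1 ∧ ∀ (N : ℕ) [NeZero N],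
    N < M → ∀ (x : ℝ) (f : SL₂ (ZMod N) → ℂ), θ < x → x < 1 →
      slOp N R f = ((x * (slBall R).card : ℝ) : ℂ) • f → f = 0 := by
  induction M with
  | zero => exact ⟨1 / 2, by norm_num, by norm_num, fun N _ h ↦ absurd h (Nat.not_lt_zero N)⟩
  | succ M ih =>
    obtain ⟨θ, hθ0, hθ1, hθ⟩ := ih
    rcases Nat.eq_zero_or_pos M with rfl | hM
    · exact ⟨1 / 2, by norm_num, by norm_num, fun N hN h ↦
        absurd (Nat.lt_one_iff.1 h) (NeZero.ne N)⟩
    have : NeZero M := ⟨hM.ne'⟩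
    have hB := card_slBall_pos hR
    have hfin : {x : ℝ | Module.End.HasEigenvalue (slOp M R)
        ((x * (slBall R).card : ℝ) : ℂ)}.Finite := by
      refine (Module.End.finite_hasEigenvalue (slOp M R)).preimage fun x _ y _ hxy ↦ ?_
      exact mul_right_cancel₀ hB.ne' (Complex.ofReal_injective hxy)
    set S := hfin.toFinset.filter (· < 1) with hS
    refine ⟨(insert θ S).max' (Finset.insert_nonempty _ _), ?_, ?_, ?_⟩
    · exact hθ0.trans_le (Finset.le_max' _ _ (Finset.mem_insert_self _ _))
    · rw [Finset.max'_lt_iff]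
      intro y hy
      rcases Finset.mem_insert.1 hy with rfl | hy
      · exact hθ1
      · exact (Finset.mem_filter.1 hy).2
    · intro N _ hN x f hx hx1 hf
      rcases Nat.lt_succ_iff_lt_or_eq.1 hN with h | rfl
      · exact hθ N h x f ((Finset.le_max' _ _ (Finset.mem_insert_self _ _)).trans_lt hx) hx1 hf
      · by_contra h0
        have : x ∈ S := Finset.mem_filter.2 ⟨hfin.mem_toFinset.2
          (Module.End.hasEigenvalue_of_hasEigenvector (Module.End.hasEigenvector_iff.2
            ⟨Module.End.mem_eigenspace_iff.2 hf, h0⟩)), hx1⟩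
        exact (Finset.le_max' _ _ (Finset.mem_insert_of_mem this)).not_gt hx

/-- A function invariant under the congruence subgroup of level `N / p` comes from level
`N / p`. -/
theorem exists_descent {p : ℕ} (hp : p ∣ N) {f : SL₂ (ZMod N) → ℂ}
    (hf : ∀ (κ : SL₂ (ZMod N)) (a b c d : ZMod N),
      κ 0 0 = 1 + ((N / p : ℕ) : ZMod N) * a → κ 0 1 = ((N / p : ℕ) : ZMod N) * b →
      κ 1 0 = ((N / p : ℕ) : ZMod N) * c → κ 1 1 = 1 + ((N / p : ℕ) : ZMod N) * d →
      ∀ x, f (x * κ) = f x) :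
    ∃ f' : SL₂ (ZMod (N / p)) → ℂ, ∀ x, f' (slRed (N / p) x) = f (slRed N x) := by
  have hM : N / p ≠ 0 := (Nat.div_pos (Nat.le_of_dvd (NeZero.pos N) hp)
    (Nat.pos_of_dvd_of_pos hp (NeZero.pos N))).ne'
  have : NeZero (N / p) := ⟨hM⟩
  choose s hs using slRed_surjective (N / p)
  refine ⟨fun y ↦ f (slRed N (s y)), fun x ↦ ?_⟩
  simp only
  set y := s (slRed (N / p) x) with hy
  have h1 : slRed (N / p) (y⁻¹ * x) = 1 := by rw [map_mul, map_inv, hs, inv_mul_cancel]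
  obtain ⟨a, b, c, d, ha, hb, hc, hd⟩ := exists_of_slRed_eq_one h1
  have h2 : slRed N x = slRed N y * slRed N (y⁻¹ * x) := by rw [← map_mul, mul_inv_cancel_left]
  rw [h2]
  refine (hf _ a b c d ?_ ?_ ?_ ?_ _).symm
  · rw [slRed_apply, ha, Int.cast_add, Int.cast_one, Int.cast_mul, Int.cast_natCast]
  · rw [slRed_apply, hb, Int.cast_mul, Int.cast_natCast]
  · rw [slRed_apply, hc, Int.cast_mul, Int.cast_natCast]
  · rw [slRed_apply, hd, Int.cast_add, Int.cast_one, Int.cast_mul, Int.cast_natCast]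

end Gap

theorem exists_eigenvalue_gap : ∃ R : ℕ, 1 ≤ R ∧ ∃ θ : ℝ, 0 < θ ∧ θ < 1 ∧ ∀ (N : ℕ) [NeZero N]
    (x : ℝ) (f : SL₂ (ZMod N) → ℂ), θ < x → x < 1 →
      slOp N R f = ((x * (slBall R).card : ℝ) : ℂ) • f → f = 0 := by
  obtain ⟨R, hR, θ₁, h₁0, h₁1, N₁, h₁⟩ := exists_trace_bound
  obtain ⟨θ₂, h₂0, h₂1, h₂⟩ := exists_gap_of_lt hR N₁
  have hB := card_slBall_pos hR
  refine ⟨R, hR, max θ₁ θ₂, lt_max_of_lt_left h₁0, max_lt h₁1 h₂1, fun N ↦ ?_⟩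
  induction N using Nat.strong_induction_on with
  | _ N ih =>
  intro _ x f hx hx1 hf
  by_cases hN : N < N₁
  · exact h₂ N hN x f ((le_max_right _ _).trans_lt hx) hx1 hf
  by_contra hf0
  set y : ℝ := x * (slBall R).card with hy
  set V : Submodule ℂ (SL₂ (ZMod N) → ℂ) := Module.End.eigenspace (slOp N R) (y : ℂ) with hVdef
  have hne : V ≠ ⊥ :=
    (Submodule.ne_bot_iff _).2 ⟨f, Module.End.mem_eigenspace_iff.2 hf, hf0⟩
  have hprim : ∃ f ∈ V, f ≠ 0 ∧ ∃ k : ZMod N, IsUnit k ∧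
      ∀ x y, f (x * slU y) = ZMod.stdAddChar (k * y) * f x := by
    refine exists_primitive ?_ hne ?_
    · intro f hf g
      rw [hVdef, Module.End.mem_eigenspace_iff] at hf ⊢
      rw [slOp_right_translate, hf]
      rfl
    · intro p hp f hf hinv
      obtain ⟨hp1, hp2, -⟩ := Nat.mem_primeFactors.1 hp
      obtain ⟨f', hf'⟩ := exists_descent hp2 hinv
      have hM : N / p ≠ 0 := (Nat.div_pos (Nat.le_of_dvd (NeZero.pos N) hp2) hp1.pos).ne'
      have : NeZero (N / p) := ⟨hM⟩
      rw [hVdef, Module.End.mem_eigenspace_iff] at hf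
      have h5 : f' = 0 := by
        refine ih (N / p) (Nat.div_lt_self (NeZero.pos N) hp1.one_lt) x f' hx hx1 ?_
        ext z
        obtain ⟨w, rfl⟩ := slRed_surjective (N / p) z
        have h6 := congrFun hf (slRed N w)
        rw [slOp_apply, Pi.smul_apply] at h6 ⊢
        simp only [← map_mul, hf'] at h6 ⊢
        exact h6
      ext z
      obtain ⟨w, rfl⟩ := slRed_surjective N z
      rw [← hf', h5]
      rfl
  obtain ⟨f₀, hf₀V, hf₀, k, hk, hfk⟩ := hprim
  obtain ⟨n, hn, hle⟩ := h₁ N (not_lt.1 hN)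
  have hx0 : 0 < x := (h₁0.trans_le (le_max_left _ _)).trans hx
  have h3 := hle y (by positivity) (trace_le R hf₀ hk hfk (Module.End.mem_eigenspace_iff.1 hf₀V) n)
  have h4 := le_of_mul_le_mul_right h3 hB
  exact absurd ((le_max_left θ₁ θ₂).trans_lt hx) (not_lt.2 h4)

open ComplexConjugate in
/-- The uniform spectral gap of `SL₂(ℤ/N)`. -/
theorem exists_spectral_gap : ∃ R : ℕ, 1 ≤ R ∧ ∃ θ : ℝ, θ < 1 ∧ ∀ (N : ℕ) [NeZero N]
    (f : SL₂ (ZMod N) → ℂ), ∑ x, f x = 0 →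
      (∑ x, conj (f x) * slOp N R f x).re ≤ θ * (slBall R).card * ∑ x, ‖f x‖ ^ 2 := by
  obtain ⟨R, hR, θ, hθ0, hθ1, hθ⟩ := exists_eigenvalue_gap
  have hB := card_slBall_pos hR
  refine ⟨R, hR, θ, hθ1, fun N _ f hf ↦ ?_⟩
  let s : EuclideanSpace ℂ (SL₂ (ZMod N)) →ₗ[ℂ] ℂ :=
    { toFun := fun v ↦ ∑ x, v x
      map_add' := fun v w ↦ by simp [Finset.sum_add_distrib]
      map_smul' := fun c v ↦ by simp [Finset.mul_sum] }
  have hinv : ∀ v ∈ LinearMap.ker s, slOpE N R v ∈ LinearMap.ker s := by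
    intro v hv
    rw [LinearMap.mem_ker] at hv ⊢
    change ∑ x, v x = 0 at hv
    change ∑ x, ∑ b ∈ slBall R, v (slRed N b * x) = 0
    rw [Finset.sum_comm]
    refine Finset.sum_eq_zero fun b _ ↦ ?_
    rw [← hv]
    exact Equiv.sum_comp (Equiv.mulLeft (slRed N b)) fun x ↦ v x
  have hsymm := (slOpE_isSymmetric (N := N) R).restrict_invariant hinv
  have h1 := re_inner_le_of_eigenvalues_le hsymm (c := θ * (slBall R).card) ?_
    ⟨WithLp.toLp 2 f, hf⟩
  · rw [Submodule.coe_inner, inner_euclidean_eq, Submodule.coe_norm, EuclideanSpace.norm_eq,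
      Real.sq_sqrt (Finset.sum_nonneg fun _ _ ↦ by positivity)] at h1
    exact h1
  · intro x v hv hxv
    by_contra! hlt
    set x' := x / (slBall R).card with hx'
    have hxx' : x = x' * (slBall R).card := by rw [hx']; field_simp
    have hθx' : θ < x' := by rwa [hx', lt_div_iff₀ hB]
    have heig : slOp N R v.1.ofLp = ((x' * (slBall R).card : ℝ) : ℂ) • v.1.ofLp := by
      rw [← hxx']
      have := congrArg (fun w : LinearMap.ker s ↦ w.1.ofLp) hxv
      exact this
    apply hv
    suffices v.1.ofLp = 0 from Subtype.ext (WithLp.ofLp_injective 2 this)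
    rcases lt_or_ge x' 1 with h | h
    · exact hθ N x' _ hθx' h heig
    · have hconst := const_of_one_le hR h heig
      have hs : ∑ y, v.1.ofLp y = 0 := v.2
      rw [Finset.sum_congr rfl fun y _ ↦ hconst y, Finset.sum_const, nsmul_eq_mul] at hs
      have h1 : v.1.ofLp 1 = 0 := (mul_eq_zero.1 hs).resolve_left
        (Nat.cast_ne_zero.2 (Finset.card_ne_zero_of_mem (Finset.mem_univ 1)))
      ext y
      rw [hconst, h1]
      rfl

section Boundary

variable {G : Type*} [Group G] [DecidableEq G]

/-- The number of elements of `Q` which left multiplication by `x` moves out of `Q`. -/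
def exitCount (Q : Finset G) (x : G) : ℕ := (Q.filter fun y ↦ x * y ∉ Q).card

theorem exitCount_one (Q : Finset G) : exitCount Q 1 = 0 := by
  rw [exitCount, Finset.card_eq_zero, Finset.filter_eq_empty_iff]
  intro y hy
  simpa using hy

theorem exitCount_mul_le (Q : Finset G) (x y : G) :
    exitCount Q (x * y) ≤ exitCount Q x + exitCount Q y := by
  have h : (Q.filter fun z ↦ x * y * z ∉ Q) ⊆
      ((Q.filter fun z ↦ x * z ∉ Q).image fun z ↦ y⁻¹ * z) ∪ Q.filter fun z ↦ y * z ∉ Q := by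
    intro z hz
    simp only [Finset.mem_union, Finset.mem_image, Finset.mem_filter] at hz ⊢
    by_cases hy : y * z ∈ Q
    · exact Or.inl ⟨y * z, ⟨hy, by rw [← mul_assoc]; exact hz.2⟩, inv_mul_cancel_left y z⟩
    · exact Or.inr ⟨hz.1, hy⟩
  exact (Finset.card_le_card h).trans ((Finset.card_union_le _ _).trans
    (Nat.add_le_add_right Finset.card_image_le _))

theorem exitCount_inv (Q : Finset G) (x : G) : exitCount Q x⁻¹ = exitCount Q x := by
  have h1 : (Q.filter fun y ↦ x⁻¹ * y ∈ Q).card = (Q.filter fun y ↦ x * y ∈ Q).card := by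
    refine Finset.card_bij' (fun y _ ↦ x⁻¹ * y) (fun y _ ↦ x * y) ?_ ?_ ?_ ?_
    · intro y hy
      simpa [and_comm] using hy
    · intro y hy
      simpa [and_comm] using hy
    · simp
    · simp
  have h2 := Q.card_filter_add_card_filter_not fun y ↦ x⁻¹ * y ∈ Q
  have h3 := Q.card_filter_add_card_filter_not fun y ↦ x * y ∈ Q
  rw [exitCount, exitCount]
  omega

theorem exitCount_add_card_le {Q S : Finset G} {x : G} (hQ : Q ⊆ S) (hx : ∀ y ∈ Q, x * y ∈ S) :
    exitCount Q x + Q.card ≤ S.card := by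
  rw [← Finset.card_sdiff_add_card_eq_card hQ]
  refine Nat.add_le_add_right (Finset.card_le_card_of_injOn (fun y ↦ x * y) ?_
    (mul_right_injective x).injOn) _
  intro y hy
  have hy := Finset.mem_filter.1 hy
  exact Finset.mem_sdiff.2 ⟨hx y hy.1, hy.2⟩

end Boundary

theorem exists_exitCount_le (b : SL₂ ℤ) : ∃ L : ℕ, ∀ (N : ℕ) (Q : Finset (SL₂ (ZMod N))),
    exitCount Q (slRed N b) ≤ L * (exitCount Q (slU 1) + exitCount Q (slL 1)) := by
  let H : Subgroup (SL₂ ℤ) :=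
    { carrier := {b | ∃ L : ℕ, ∀ (N : ℕ) (Q : Finset (SL₂ (ZMod N))),
        exitCount Q (slRed N b) ≤ L * (exitCount Q (slU 1) + exitCount Q (slL 1))}
      mul_mem' := by
        rintro a b ⟨L, hL⟩ ⟨M, hM⟩
        refine ⟨L + M, fun N Q ↦ ?_⟩
        rw [map_mul, add_mul]
        exact (exitCount_mul_le _ _ _).trans (Nat.add_le_add (hL N Q) (hM N Q))
      one_mem' := ⟨0, fun N Q ↦ by rw [map_one, exitCount_one]; exact Nat.zero_le _⟩
      inv_mem' := by
        rintro a ⟨L, hL⟩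
        refine ⟨L, fun N Q ↦ ?_⟩
        rw [map_inv, exitCount_inv]
        exact hL N Q }
  have hH : H = ⊤ := by
    refine subgroup_int_eq_top H ⟨1, fun N Q ↦ ?_⟩ ⟨1, fun N Q ↦ ?_⟩
    · rw [slRed_slU, Int.cast_one]; omega
    · rw [slRed_slL, Int.cast_one]; omega
  exact (hH ▸ Subgroup.mem_top b : b ∈ H)

theorem sum_norm_indicator_sub_sq {G : Type*} [Group G] [DecidableEq G] [Fintype G]
    (Q : Finset G) (c : ℂ) (b : G) :
    ∑ x, ‖((if b * x ∈ Q then (1 : ℂ) else 0) - c) - ((if x ∈ Q then (1 : ℂ) else 0) - c)‖ ^ 2 =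
      2 * exitCount Q b := by
  have h1 : ∀ x : G,
      ‖((if b * x ∈ Q then (1 : ℂ) else 0) - c) - ((if x ∈ Q then (1 : ℂ) else 0) - c)‖ ^ 2 =
        (if x ∈ Q ∧ b * x ∉ Q then (1 : ℝ) else 0) + if x ∉ Q ∧ b * x ∈ Q then (1 : ℝ) else 0 := by
    intro x
    rw [sub_sub_sub_cancel_right]
    by_cases h : x ∈ Q <;> by_cases h' : b * x ∈ Q <;> simp [h, h']
  have h2 : (Finset.univ.filter fun x : G ↦ x ∈ Q ∧ b * x ∉ Q).card = exitCount Q b := by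
    rw [exitCount]
    congr 1
    ext x
    simp
  have h3 : (Finset.univ.filter fun x : G ↦ x ∉ Q ∧ b * x ∈ Q).card = exitCount Q b := by
    rw [← exitCount_inv, exitCount]
    refine Finset.card_bij' (fun y _ ↦ b * y) (fun y _ ↦ b⁻¹ * y) ?_ ?_ ?_ ?_
    · intro y hy
      simpa [and_comm] using hy
    · intro y hy
      simpa [and_comm] using hy
    · simp
    · simp
  rw [Finset.sum_congr rfl fun x _ ↦ h1 x, Finset.sum_add_distrib, Finset.sum_boole,
    Finset.sum_boole, h2, h3]
  ring

theorem sum_indicator_sub_mean {G : Type*} [DecidableEq G] [Fintype G] [Nonempty G]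
    (Q : Finset G) :
    ∑ x, ((if x ∈ Q then (1 : ℂ) else 0) - (Q.card / Fintype.card G : ℝ)) = 0 := by
  have hG : (Fintype.card G : ℂ) ≠ 0 := Nat.cast_ne_zero.2 Fintype.card_ne_zero
  rw [Finset.sum_sub_distrib, Finset.sum_boole, Finset.sum_const, Finset.card_univ, nsmul_eq_mul]
  simp only [Finset.filter_univ_mem]
  push_cast
  field_simp
  ring

theorem card_le_sum_norm_indicator_sub_mean_sq {G : Type*} [DecidableEq G] [Fintype G] [Nonempty G]
    (Q : Finset G) (hQ : 2 * Q.card ≤ Fintype.card G) :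
    (Q.card : ℝ) ≤
      2 * ∑ x, ‖(if x ∈ Q then (1 : ℂ) else 0) - (Q.card / Fintype.card G : ℝ)‖ ^ 2 := by
  have hG : (0 : ℝ) < Fintype.card G := Nat.cast_pos.2 Fintype.card_pos
  set c : ℝ := Q.card / Fintype.card G with hc
  have hc' : c ≤ 1 / 2 := by
    rw [hc, div_le_iff₀ hG]
    have : (2 : ℝ) * Q.card ≤ Fintype.card G := by exact_mod_cast hQ
    linarith
  have hcG : c * Fintype.card G = Q.card := by rw [hc]; field_simp
  have h1 : ∀ x : G, ‖(if x ∈ Q then (1 : ℂ) else 0) - (c : ℂ)‖ ^ 2 =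
      (if x ∈ Q then (1 : ℝ) else 0) * (1 - 2 * c) + c ^ 2 := by
    intro x
    by_cases h : x ∈ Q
    · rw [if_pos h, if_pos h, ← Complex.ofReal_one, ← Complex.ofReal_sub, Complex.norm_real,
        Real.norm_eq_abs, sq_abs]
      ring
    · rw [if_neg h, if_neg h, zero_sub, norm_neg, Complex.norm_real, Real.norm_eq_abs, sq_abs]
      ring
  rw [Finset.sum_congr rfl fun x _ ↦ h1 x, Finset.sum_add_distrib, ← Finset.sum_mul,
    Finset.sum_boole, Finset.sum_const, Finset.card_univ, nsmul_eq_mul]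
  simp only [Finset.filter_univ_mem]
  have h2 : (0 : ℝ) ≤ Q.card := Nat.cast_nonneg _
  nlinarith

/-- The Cayley graphs of `SL₂(ℤ/N)` with respect to `A` and `D` have uniform edge expansion. -/
theorem exists_expansion : ∃ c : ℝ, 0 < c ∧ ∀ (N : ℕ) [NeZero N] (Q : Finset (SL₂ (ZMod N))),
    2 * Q.card ≤ Fintype.card (SL₂ (ZMod N)) →
      c * Q.card ≤ exitCount Q (slU 1) + exitCount Q (slL 1) := by
  obtain ⟨R, hR, θ, hθ, hgap⟩ := exists_spectral_gap
  choose L hL using exists_exitCount_le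
  have hB := card_slBall_pos hR
  set K : ℝ := ∑ b ∈ slBall R, (L b : ℝ) with hK
  have hK0 : 0 ≤ K := Finset.sum_nonneg fun _ _ ↦ Nat.cast_nonneg _
  refine ⟨(1 - θ) * (slBall R).card / (2 * (K + 1)),
    div_pos (mul_pos (by linarith) hB) (by linarith), fun N _ Q hQ ↦ ?_⟩
  set d : ℝ := exitCount Q (slU 1) + exitCount Q (slL 1) with hd
  have hd0 : 0 ≤ d := by positivity
  set f : SL₂ (ZMod N) → ℂ := fun x ↦
    (if x ∈ Q then (1 : ℂ) else 0) - (Q.card / Fintype.card (SL₂ (ZMod N)) : ℝ) with hf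
  have h1 := hgap N f (sum_indicator_sub_mean Q)
  have h2 := dirichlet_eq (R := R) f
  have h3 : ∑ x, ∑ b ∈ slBall R, ‖f (slRed N b * x) - f x‖ ^ 2 ≤ 2 * (K * d) := by
    rw [Finset.sum_comm, hK, Finset.sum_mul, Finset.mul_sum]
    refine Finset.sum_le_sum fun b _ ↦ ?_
    have : (exitCount Q (slRed N b) : ℝ) ≤ L b * d := by
      rw [hd]; exact_mod_cast hL b N Q
    exact (sum_norm_indicator_sub_sq Q _ (slRed N b)).trans_le (by linarith)
  have h4 : (Q.card : ℝ) ≤ 2 * ∑ x, ‖f x‖ ^ 2 := card_le_sum_norm_indicator_sub_mean_sq Q hQ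
  rw [div_mul_eq_mul_div, div_le_iff₀ (by linarith)]
  have h5 : 0 ≤ (1 - θ) * (slBall R).card := (mul_pos (by linarith) hB).le
  have h6 := mul_le_mul_of_nonneg_left h4 h5
  linarith

section Growth

variable {N : ℕ}

/-- `x` is a product of `k` factors, each of them `AD` or `A²D`. -/
def IsWord (k : ℕ) (x : SL₂ (ZMod N)) : Prop :=
  ∃ l : List ℕ, l.length = k ∧ (∀ e ∈ l, e = 1 ∨ e = 2) ∧
    (l.map fun e ↦ slU 1 ^ e * slL 1).prod = x

theorem IsWord.one : IsWord 0 (1 : SL₂ (ZMod N)) := ⟨[], rfl, by simp, rfl⟩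

theorem IsWord.mul {j k : ℕ} {x y : SL₂ (ZMod N)} (hx : IsWord j x) (hy : IsWord k y) :
    IsWord (j + k) (x * y) := by
  obtain ⟨l, rfl, hl, rfl⟩ := hx
  obtain ⟨m, rfl, hm, rfl⟩ := hy
  refine ⟨l ++ m, List.length_append, fun e he ↦ ?_, by rw [List.map_append, List.prod_append]⟩
  exact (List.mem_append.1 he).elim (hl e) (hm e)

theorem isWord_single {e : ℕ} (he : e = 1 ∨ e = 2) :
    IsWord 1 (slU 1 ^ e * slL 1 : SL₂ (ZMod N)) :=
  ⟨[e], rfl, by simpa using he, by simp⟩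

theorem slL_one_inv_eq {R : Type*} [CommRing R] :
    (slL 1 : SL₂ R)⁻¹ = (slU 1)⁻¹ * ((slU 1)⁻¹ *
      (slU 1 * slL 1 * slU 1 * (slU 1 * slL 1)⁻¹) * slU 1) * slU 1 := by
  rw [_root_.mul_inv_rev, ← slU_neg, ← slL_neg]
  apply sl_ext <;> simp [sl_mul_apply] <;> ring

theorem exists_growth : ∃ c : ℝ, 0 < c ∧ ∀ (N : ℕ) [NeZero N] (k : ℕ)
    (P : Finset (SL₂ (ZMod N))), (∀ x ∈ P, IsWord k x) →
      2 * P.card ≤ Fintype.card (SL₂ (ZMod N)) →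
      ∃ P' : Finset (SL₂ (ZMod N)), (∀ x ∈ P', IsWord (2 + k) x) ∧
        (1 + c) * P.card ≤ P'.card := by
  obtain ⟨c, hc, hexp⟩ := exists_expansion
  refine ⟨c / 6, by positivity, fun N _ k P hP hcard ↦ ?_⟩
  set g : SL₂ (ZMod N) := slU 1 ^ 1 * slL 1 with hg
  set h : SL₂ (ZMod N) := slU 1 ^ 2 * slL 1 with hh
  have wg : IsWord 1 g := isWord_single (Or.inl rfl)
  have wh : IsWord 1 h := isWord_single (Or.inr rfl)
  set Q := P.image fun x ↦ g * g * x with hQ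
  set S := Q ∪ (P.image (fun x ↦ h * g * x) ∪ P.image (fun x ↦ g * h * x)) with hS
  have hQP : Q.card = P.card := Finset.card_image_of_injective _ (mul_right_injective _)
  have hQS : Q ⊆ S := Finset.subset_union_left
  refine ⟨S, ?_, ?_⟩
  · intro x hx
    simp only [hS, hQ, Finset.mem_union, Finset.mem_image] at hx
    rcases hx with ⟨y, hy, rfl⟩ | ⟨y, hy, rfl⟩ | ⟨y, hy, rfl⟩
    · exact (wg.mul wg).mul (hP y hy)
    · exact (wh.mul wg).mul (hP y hy)
    · exact (wg.mul wh).mul (hP y hy)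
  · have hA : exitCount Q (slU 1) + Q.card ≤ S.card := by
      refine exitCount_add_card_le hQS fun y hy ↦ ?_
      obtain ⟨x, hx, rfl⟩ := Finset.mem_image.1 hy
      refine Finset.mem_union_right _ (Finset.mem_union_left _ (Finset.mem_image.2 ⟨x, hx, ?_⟩))
      simp only [hg, hh]
      group
    have hX : exitCount Q (slU 1 * slL 1 * slU 1 * (slU 1 * slL 1)⁻¹) + Q.card ≤ S.card := by
      refine exitCount_add_card_le hQS fun y hy ↦ ?_
      obtain ⟨x, hx, rfl⟩ := Finset.mem_image.1 hy
      refine Finset.mem_union_right _ (Finset.mem_union_right _ (Finset.mem_image.2 ⟨x, hx, ?_⟩))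
      simp only [hg, hh, pow_two]
      group
    have hD : exitCount Q (slL 1) ≤ 4 * exitCount Q (slU 1) +
        exitCount Q (slU 1 * slL 1 * slU 1 * (slU 1 * slL 1)⁻¹) := by
      rw [← exitCount_inv Q (slL 1), slL_one_inv_eq]
      set X : SL₂ (ZMod N) := slU 1 * slL 1 * slU 1 * (slU 1 * slL 1)⁻¹
      have h1 := exitCount_mul_le Q ((slU 1)⁻¹ * ((slU 1)⁻¹ * X * slU 1)) (slU 1)
      have h2 := exitCount_mul_le Q (slU 1)⁻¹ ((slU 1)⁻¹ * X * slU 1)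
      have h3 := exitCount_mul_le Q ((slU 1)⁻¹ * X) (slU 1)
      have h4 := exitCount_mul_le Q (slU 1)⁻¹ X
      have h5 := exitCount_inv Q (slU 1)
      omega
    have h1 := hexp N Q (by rw [hQP]; exact hcard)
    have h2 : exitCount Q (slU 1) + exitCount Q (slL 1) + 6 * Q.card ≤ 6 * S.card := by omega
    have h3 : (exitCount Q (slU 1) : ℝ) + exitCount Q (slL 1) + 6 * Q.card ≤ 6 * S.card := by
      exact_mod_cast h2
    rw [hQP] at h1 h3
    linarith

theorem exists_large_words : ∃ c : ℝ, 0 < c ∧ ∀ (N : ℕ) [NeZero N] (l : ℕ),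
    ∃ P : Finset (SL₂ (ZMod N)), (∀ x ∈ P, IsWord (2 * l) x) ∧
      ((1 + c) ^ l ≤ P.card ∨ Fintype.card (SL₂ (ZMod N)) < 2 * P.card) := by
  obtain ⟨c, hc, hgrow⟩ := exists_growth
  refine ⟨c, hc, fun N _ l ↦ ?_⟩
  induction l with
  | zero => exact ⟨{1}, fun x hx ↦ Finset.mem_singleton.1 hx ▸ IsWord.one, Or.inl (by simp)⟩
  | succ l ih =>
    obtain ⟨P, hP, h⟩ := ih
    have h2l : 2 * (l + 1) = 2 + 2 * l := by ring
    rw [h2l]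
    rcases le_or_gt (2 * P.card) (Fintype.card (SL₂ (ZMod N))) with hle | hlt
    · obtain ⟨P', hP', hcard⟩ := hgrow N _ P hP hle
      refine ⟨P', hP', Or.inl (le_trans ?_ hcard)⟩
      rw [pow_succ']
      exact mul_le_mul_of_nonneg_left (h.resolve_right hle.not_gt) (by linarith)
    · have wg : IsWord 1 (slU 1 ^ 1 * slL 1 : SL₂ (ZMod N)) := isWord_single (Or.inl rfl)
      refine ⟨P.image fun x ↦ (slU 1 ^ 1 * slL 1) * (slU 1 ^ 1 * slL 1) * x, ?_, Or.inr ?_⟩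
      · intro y hy
        obtain ⟨x, hx, rfl⟩ := Finset.mem_image.1 hy
        exact (wg.mul wg).mul (hP x hx)
      · rwa [Finset.card_image_of_injective _ (mul_right_injective _)]

end Growth

theorem exists_mul_eq_of_card_lt {G : Type*} [Group G] [Fintype G] [DecidableEq G] {P : Finset G}
    (hP : Fintype.card G < 2 * P.card) (g : G) : ∃ x ∈ P, ∃ y ∈ P, x * y = g := by
  have h : ¬ Disjoint P (P.image fun y ↦ g * y⁻¹) := by
    intro h
    have h1 := Finset.card_union_of_disjoint h
    have h3 : (P.image fun y ↦ g * y⁻¹).card = P.card :=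
      Finset.card_image_of_injective _ ((mul_right_injective g).comp inv_injective)
    have h2 := Finset.card_le_univ (P ∪ P.image fun y ↦ g * y⁻¹)
    omega
  obtain ⟨x, hx, hx'⟩ := Finset.not_disjoint_iff.1 h
  obtain ⟨y, hy, rfl⟩ := Finset.mem_image.1 hx'
  exact ⟨_, hx, y, hy, inv_mul_cancel_right g y⟩

theorem exists_isWord_log : ∃ C : ℝ, 0 < C ∧ ∀ N : ℕ, 3 ≤ N → ∃ t : ℕ, (t : ℝ) ≤ C * Real.log N ∧
    ∀ g : SL₂ (ZMod N), IsWord t g := by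
  obtain ⟨c, hc, hlarge⟩ := exists_large_words
  have hlog : 0 < Real.log (1 + c) := Real.log_pos (by linarith)
  refine ⟨4 * (3 / Real.log (1 + c) + 2), by positivity, fun N hN ↦ ?_⟩
  have : NeZero N := ⟨by omega⟩
  have hN3 : (3 : ℝ) ≤ N := by exact_mod_cast hN
  have hlogN : 1 ≤ Real.log N := by
    rw [Real.le_log_iff_exp_le (by linarith)]
    exact Real.exp_one_lt_three.le.trans hN3
  set l := ⌊3 * Real.log N / Real.log (1 + c)⌋₊ + 1 with hl
  have hl1 : 3 * Real.log N / Real.log (1 + c) < l := by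
    rw [hl]; exact_mod_cast Nat.lt_floor_add_one _
  have hl2 : (l : ℝ) ≤ 3 * Real.log N / Real.log (1 + c) + 1 := by
    rw [hl]
    push_cast
    linarith [Nat.floor_le (a := 3 * Real.log N / Real.log (1 + c)) (by positivity)]
  obtain ⟨P, hP, h⟩ := hlarge N l
  have hbig : Fintype.card (SL₂ (ZMod N)) < 2 * P.card := by
    refine h.resolve_left fun hle ↦ ?_
    have h1 : (P.card : ℝ) ≤ (N : ℝ) ^ 3 := by
      exact_mod_cast (Finset.card_le_univ P).trans (card_sl_le N)
    have h2 := Real.log_le_log (by positivity) (hle.trans h1)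
    rw [Real.log_pow, Real.log_pow] at h2
    rw [div_lt_iff₀ hlog] at hl1
    push_cast at h2
    linarith
  refine ⟨2 * l + 2 * l, ?_, fun g ↦ ?_⟩
  · push_cast
    have : 3 / Real.log (1 + c) * Real.log N = 3 * Real.log N / Real.log (1 + c) := by ring
    linarith
  · obtain ⟨x, hx, y, hy, rfl⟩ := exists_mul_eq_of_card_lt hbig g
    exact (hP x hx).mul (hP y hy)

theorem coe_slU_pow_mul_slL {R : Type*} [CommRing R] (e : ℕ) :
    ((slU 1 ^ e * slL 1 : SL₂ R) : Matrix (Fin 2) (Fin 2) R) = matA R ^ e * matD R := by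
  rw [Matrix.SpecialLinearGroup.coe_mul, Matrix.SpecialLinearGroup.coe_pow]
  rfl

theorem coe_list_prod_map {R : Type*} [CommRing R] (l : List ℕ) :
    ((l.map fun e ↦ slU 1 ^ e * slL 1).prod : SL₂ R).1 =
      (l.map fun e ↦ matA R ^ e * matD R).prod := by
  induction l with
  | nil => rfl
  | cons e l ih =>
    rw [List.map_cons, List.prod_cons, List.map_cons, List.prod_cons, ← ih,
      ← coe_slU_pow_mul_slL]
    rfl

theorem IsWord.exists_ofFn {N t : ℕ} {g : SL₂ (ZMod N)} (h : IsWord t g) :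
    ∃ i : Fin t → ℕ, (∀ j, i j = 1 ∨ i j = 2) ∧
      (List.ofFn fun j ↦ matA (ZMod N) ^ (i j) * matD (ZMod N)).prod = g.1 := by
  obtain ⟨l, rfl, hl, rfl⟩ := h
  refine ⟨l.get, fun j ↦ hl _ (l.get_mem j), ?_⟩
  rw [show (fun j ↦ matA (ZMod N) ^ (l.get j) * matD (ZMod N)) =
    (fun e ↦ matA (ZMod N) ^ e * matD (ZMod N)) ∘ l.get from rfl, ← List.map_ofFn, List.ofFn_get,
    coe_list_prod_map]

/-- There is `C > 0` such that for every large enough `N` and all coprime integers `a, b`,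
there are `t ≤ C·log N` and exponents `i₁, …, i_t ∈ {1,2}` with
`(a,b)ᵀ ≡ A^{i₁} D ⋯ A^{i_t} D (1,0)ᵀ (mod N)`. -/
theorem modular_matrix_representation :
    ∃ C : ℝ, 0 < C ∧ ∃ N₀ : ℕ, ∀ N : ℕ, N₀ ≤ N → ∀ a b : ℤ, IsCoprime a b →
      ∃ t : ℕ, (t : ℝ) ≤ C * Real.log N ∧
        ∃ i : Fin t → ℕ, (∀ j, i j = 1 ∨ i j = 2) ∧
          (List.ofFn fun j => matA (ZMod N) ^ (i j) * matD (ZMod N)).prod *ᵥ ![1, 0] =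
            ![(a : ZMod N), (b : ZMod N)] := by
  obtain ⟨C, hC, hword⟩ := exists_isWord_log
  refine ⟨C, hC, 3, fun N hN a b hab ↦ ?_⟩
  obtain ⟨t, ht, hw⟩ := hword N hN
  obtain ⟨u, v, huv⟩ := hab
  obtain ⟨i, hi, hprod⟩ :=
    (hw (slRed N (slMk a (-v) b u (by linear_combination huv)))).exists_ofFn
  refine ⟨t, ht, i, hi, ?_⟩
  rw [hprod]
  ext j
  fin_cases j <;> simp [Matrix.mulVec, dotProduct] <;> rfl
end

section
/- Let n and N be positive integers. If the set of n-feasible pairs (t,u) has cardinality at least N, then the number of distinct values taken by τ(G), as G ranges over finite simple graphs on at most n vertices, is at least √N. -/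
/-- The number of spanning trees of a finite simple graph `G`: the number of
subgraphs `T ≤ G` (on the same vertex set) that are trees. -/
noncomputable def numSpanningTrees {V : Type} [Fintype V] (G : SimpleGraph V) : ℕ :=
  Set.ncard {T : SimpleGraph V | T ≤ G ∧ T.IsTree}

/-- A pair `(t, u)` of nonnegative integers is `n`-feasible if there is a simple graph `G`
on at most `n` vertices with an edge `e` such that `t` is the number of spanning trees of
`G` containing `e` and `u` is the number of spanning trees of `G` not containing `e`. -/
def EdgeFeasible (n t u : ℕ) : Prop :=
  ∃ (m : ℕ) (G : SimpleGraph (Fin m)) (e : Sym2 (Fin m)),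
    m ≤ n ∧ e ∈ G.edgeSet ∧
    t = Set.ncard {T : SimpleGraph (Fin m) | T ≤ G ∧ T.IsTree ∧ e ∈ T.edgeSet} ∧
    u = Set.ncard {T : SimpleGraph (Fin m) | T ≤ G ∧ T.IsTree ∧ e ∉ T.edgeSet}

theorem numSpanningTrees_eq_add {V : Type} [Fintype V] (G : SimpleGraph V) (e : Sym2 V) :
    numSpanningTrees G =
      Set.ncard {T : SimpleGraph V | T ≤ G ∧ T.IsTree ∧ e ∈ T.edgeSet} +
      Set.ncard {T : SimpleGraph V | T ≤ G ∧ T.IsTree ∧ e ∉ T.edgeSet} := by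
  classical
  rw [numSpanningTrees, ← Set.ncard_union_eq
    (Set.disjoint_left.2 fun T h₁ h₂ => h₂.2.2 h₁.2.2) (Set.toFinite _) (Set.toFinite _)]
  congr 1
  ext T
  simp only [Set.mem_ofPred_eq, Set.mem_union]
  tauto

theorem numSpanningTrees_deleteEdges_singleton {V : Type} [Fintype V] (G : SimpleGraph V)
    (e : Sym2 V) :
    numSpanningTrees (G.deleteEdges {e}) =
      Set.ncard {T : SimpleGraph V | T ≤ G ∧ T.IsTree ∧ e ∉ T.edgeSet} := by
  rw [numSpanningTrees]
  congr 1
  ext T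
  have key : T ≤ G.deleteEdges {e} ↔ T ≤ G ∧ e ∉ T.edgeSet := by
    rw [← SimpleGraph.edgeSet_subset_edgeSet, SimpleGraph.edgeSet_deleteEdges, Set.subset_sdiff,
      SimpleGraph.edgeSet_subset_edgeSet, Set.disjoint_singleton_right]
  simp only [Set.mem_ofPred_eq, key]
  tauto

theorem finite_numSpanningTrees_values (n : ℕ) :
    {k : ℕ | ∃ (m : ℕ) (G : SimpleGraph (Fin m)), m ≤ n ∧ numSpanningTrees G = k}.Finite := by
  refine ((Set.finite_Iic n).biUnion fun m _ =>
    Set.finite_range (fun G : SimpleGraph (Fin m) => numSpanningTrees G)).subset ?_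
  rintro k ⟨m, G, hm, rfl⟩
  exact Set.mem_biUnion (Set.mem_Iic.2 hm) ⟨G, rfl⟩

/-- If there are at least `N` distinct `n`-feasible pairs, then `τ` takes at least `√N`
distinct values on simple graphs with at most `n` vertices. -/
theorem sqrt_many_tree_values (n N : ℕ) (hn : 0 < n) (hN : 0 < N)
    (h : N ≤ Set.ncard {p : ℕ × ℕ | EdgeFeasible n p.1 p.2}) :
    Real.sqrt N ≤
      (Set.ncard {k : ℕ | ∃ (m : ℕ) (G : SimpleGraph (Fin m)),
        m ≤ n ∧ numSpanningTrees G = k} : ℝ) := by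
  have hfin := finite_numSpanningTrees_values n
  set S := {k : ℕ | ∃ (m : ℕ) (G : SimpleGraph (Fin m)), m ≤ n ∧ numSpanningTrees G = k}
  have hcard : N ≤ S.ncard * S.ncard := by
    rw [← Set.ncard_prod]
    refine h.trans (Set.ncard_le_ncard_of_injOn (fun p : ℕ × ℕ => (p.1 + p.2, p.2)) ?_ ?_
      (hfin.prod hfin))
    · rintro ⟨t, u⟩ ⟨m, G, e, hm, -, ht, hu⟩
      dsimp only at ht hu
      subst ht hu
      exact ⟨⟨m, G, hm, numSpanningTrees_eq_add G e⟩,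
        ⟨m, G.deleteEdges {e}, hm, numSpanningTrees_deleteEdges_singleton G e⟩⟩
    · rintro ⟨t, u⟩ - ⟨t', u'⟩ - heq
      simp only [Prod.mk.injEq] at heq ⊢
      lia
  refine Real.sqrt_le_iff.2 ⟨Nat.cast_nonneg _, ?_⟩
  rw [sq]
  exact_mod_cast hcard
end

section
/- If the pair (t,u) of nonnegative integers is n-feasible, then the pair (t+u, u) is (n+1)-feasible. -/
namespace SimpleGraph

variable {m : ℕ}

/-- The graph obtained from `F` by attaching a new vertex `0` as a leaf at `a`. -/
def attachLeaf (F : SimpleGraph (Fin m)) (a : Fin m) : SimpleGraph (Fin (m + 1)) :=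
  F.map (Fin.succEmb m) ⊔ edge 0 a.succ

/-- The graph obtained from `H` by replacing the edge `s(a, b)` by a path of length two
through a new vertex `0`. -/
def subdivideEdge (H : SimpleGraph (Fin m)) (a b : Fin m) : SimpleGraph (Fin (m + 1)) :=
  (H.deleteEdges {s(a, b)}).attachLeaf a ⊔ edge 0 b.succ

@[simp]
lemma attachLeaf_adj_succ_succ {F : SimpleGraph (Fin m)} {a x y : Fin m} :
    (F.attachLeaf a).Adj x.succ y.succ ↔ F.Adj x y := by
  rw [attachLeaf, sup_adj, map_adj]
  simp [edge_adj, Fin.succ_ne_zero]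

@[simp]
lemma attachLeaf_adj_zero_succ {F : SimpleGraph (Fin m)} {a x : Fin m} :
    (F.attachLeaf a).Adj 0 x.succ ↔ x = a := by
  rw [attachLeaf, sup_adj, map_adj]
  simp [edge_adj, Fin.succ_ne_zero, (Fin.succ_ne_zero _).symm]

@[simp]
lemma subdivideEdge_adj_succ_succ {H : SimpleGraph (Fin m)} {a b x y : Fin m} :
    (H.subdivideEdge a b).Adj x.succ y.succ ↔ H.Adj x y ∧ s(x, y) ≠ s(a, b) := by
  simp [subdivideEdge, edge_adj, Fin.succ_ne_zero]

@[simp]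
lemma subdivideEdge_adj_zero_succ {H : SimpleGraph (Fin m)} {a b x : Fin m} :
    (H.subdivideEdge a b).Adj 0 x.succ ↔ x = a ∨ x = b := by
  simp [subdivideEdge, edge_adj, (Fin.succ_ne_zero _).symm]

/-- To compare two graphs on `Fin (m + 1)`, it suffices to treat separately the edges at `0`
and those avoiding `0`. -/
lemma le_of_fin_succ {S T : SimpleGraph (Fin (m + 1))}
    (h₀ : ∀ x : Fin m, S.Adj 0 x.succ → T.Adj 0 x.succ)
    (h₁ : ∀ x y : Fin m, S.Adj x.succ y.succ → T.Adj x.succ y.succ) : S ≤ T := by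
  intro v w h
  cases v using Fin.cases with
  | zero =>
    cases w using Fin.cases with
    | zero => exact absurd h S.irrefl
    | succ y => exact h₀ y h
  | succ x =>
    cases w using Fin.cases with
    | zero => exact (h₀ x h.symm).symm
    | succ y => exact h₁ x y h

lemma ext_fin_succ {S T : SimpleGraph (Fin (m + 1))}
    (h₀ : ∀ x : Fin m, S.Adj 0 x.succ ↔ T.Adj 0 x.succ)
    (h₁ : ∀ x y : Fin m, S.Adj x.succ y.succ ↔ T.Adj x.succ y.succ) : S = T :=
  le_antisymm (le_of_fin_succ (fun x ↦ (h₀ x).1) fun x y ↦ (h₁ x y).1)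
    (le_of_fin_succ (fun x ↦ (h₀ x).2) fun x y ↦ (h₁ x y).2)

/-- Connectedness transfers along a map sending adjacent vertices to reachable ones and
meeting every component. -/
lemma Connected.of_adj_reachable {V W : Type*} {S : SimpleGraph V} {T : SimpleGraph W}
    (hS : S.Connected) (f : V → W) (hf : ∀ v w, S.Adj v w → T.Reachable (f v) (f w))
    (hsurj : ∀ w, ∃ v, T.Reachable (f v) w) : T.Connected := by
  have key : ∀ v w, S.Reachable v w → T.Reachable (f v) (f w) := by
    rintro v w ⟨p⟩
    induction p with
    | nil => rfl
    | cons h _ ih => exact (hf _ _ h).trans ih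
  obtain ⟨v₀⟩ := hS.nonempty
  have : Nonempty W := ⟨f v₀⟩
  refine ⟨fun x y ↦ ?_⟩
  obtain ⟨v, hv⟩ := hsurj x
  obtain ⟨w, hw⟩ := hsurj y
  exact hv.symm.trans ((key v w (hS.preconnected v w)).trans hw)

lemma natCard_edgeSet_sup_edge {V : Type*} [Finite V] {S : SimpleGraph V} {s t : V}
    (hn : ¬S.Adj s t) (h : s ≠ t) :
    Nat.card (S ⊔ edge s t).edgeSet = Nat.card S.edgeSet + 1 := by
  classical
  have := Fintype.ofFinite V
  simpa [edgeFinset] using S.card_edgeFinset_sup_edge hn h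

lemma natCard_edgeSet_attachLeaf (F : SimpleGraph (Fin m)) (a : Fin m) :
    Nat.card (F.attachLeaf a).edgeSet = Nat.card F.edgeSet + 1 := by
  rw [attachLeaf, natCard_edgeSet_sup_edge (by rw [map_adj]; simp [Fin.succ_ne_zero])
    (Fin.succ_ne_zero a).symm, edgeSet_map, Nat.card_image_of_injective (Fin.succEmb m).sym2Map.injective]

lemma connected_attachLeaf_iff {F : SimpleGraph (Fin m)} {a : Fin m} :
    (F.attachLeaf a).Connected ↔ F.Connected := by
  constructor <;> intro h
  · refine h.of_adj_reachable (Fin.cases a id) (fun v w hvw ↦ ?_) fun w ↦ ⟨w.succ, .rfl⟩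
    cases v using Fin.cases <;> cases w using Fin.cases
    · rfl
    · simp_all
    · have := hvw.symm
      simp_all
    · exact (attachLeaf_adj_succ_succ.1 hvw).reachable
  · refine h.of_adj_reachable Fin.succ
      (fun v w hvw ↦ (attachLeaf_adj_succ_succ.2 hvw).reachable) fun w ↦ ?_
    cases w using Fin.cases with
    | zero => exact ⟨a, (attachLeaf_adj_zero_succ.2 rfl).symm.reachable⟩
    | succ w => exact ⟨w, .rfl⟩

lemma isTree_attachLeaf_iff {F : SimpleGraph (Fin m)} {a : Fin m} :
    (F.attachLeaf a).IsTree ↔ F.IsTree := by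
  rw [isTree_iff_connected_and_card, isTree_iff_connected_and_card, connected_attachLeaf_iff,
    natCard_edgeSet_attachLeaf]
  simp

lemma deleteEdges_sup_edge {V : Type*} {H : SimpleGraph V} {a b : V} (h : H.Adj a b) :
    H.deleteEdges {s(a, b)} ⊔ edge a b = H := by
  ext x y
  simp only [sup_adj, deleteEdges_adj, Set.mem_singleton_iff, adj_edge]
  constructor
  · rintro (h' | ⟨h', -⟩)
    · exact h'.1
    · rwa [← mem_edgeSet, ← h']
  · intro h'
    by_cases he : s(x, y) = s(a, b)
    · exact .inr ⟨he.symm, h'.ne⟩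
    · exact .inl ⟨h', he⟩

lemma natCard_edgeSet_subdivideEdge {H : SimpleGraph (Fin m)} {a b : Fin m} (h : H.Adj a b) :
    Nat.card (H.subdivideEdge a b).edgeSet = Nat.card H.edgeSet + 1 := by
  rw [subdivideEdge, natCard_edgeSet_sup_edge (by simpa using h.ne')
    (Fin.succ_ne_zero b).symm, natCard_edgeSet_attachLeaf]
  conv_rhs => rw [← deleteEdges_sup_edge h, natCard_edgeSet_sup_edge (by simp) h.ne]

lemma connected_subdivideEdge_iff {H : SimpleGraph (Fin m)} {a b : Fin m} (h : H.Adj a b) :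
    (H.subdivideEdge a b).Connected ↔ H.Connected := by
  constructor <;> intro hc
  · have key : ∀ x, (H.subdivideEdge a b).Adj 0 (Fin.succ x) → H.Reachable a x := by
      intro x hx
      rcases subdivideEdge_adj_zero_succ.1 hx with rfl | rfl
      · rfl
      · exact h.reachable
    refine hc.of_adj_reachable (Fin.cases a id) (fun v w hvw ↦ ?_) fun w ↦ ⟨w.succ, .rfl⟩
    cases v using Fin.cases <;> cases w using Fin.cases
    · rfl
    · exact key _ hvw
    · exact (key _ hvw.symm).symm
    · exact (subdivideEdge_adj_succ_succ.1 hvw).1.reachable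
  · have ha : (H.subdivideEdge a b).Adj 0 a.succ := by simp
    have hb : (H.subdivideEdge a b).Adj 0 b.succ := by simp
    have hab := ha.symm.reachable.trans hb.reachable
    refine hc.of_adj_reachable Fin.succ (fun v w hvw ↦ ?_) fun w ↦ ?_
    · by_cases he : s(v, w) = s(a, b)
      · rcases Sym2.eq_iff.1 he with ⟨rfl, rfl⟩ | ⟨rfl, rfl⟩
        · exact hab
        · exact hab.symm
      · exact (subdivideEdge_adj_succ_succ.2 ⟨hvw, he⟩).reachable
    · cases w using Fin.cases with
      | zero => exact ⟨a, ha.symm.reachable⟩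
      | succ w => exact ⟨w, .rfl⟩

lemma isTree_subdivideEdge_iff {H : SimpleGraph (Fin m)} {a b : Fin m} (h : H.Adj a b) :
    (H.subdivideEdge a b).IsTree ↔ H.IsTree := by
  rw [isTree_iff_connected_and_card, isTree_iff_connected_and_card,
    connected_subdivideEdge_iff h, natCard_edgeSet_subdivideEdge h]
  simp

lemma attachLeaf_injective (a : Fin m) :
    Function.Injective fun F : SimpleGraph (Fin m) ↦ F.attachLeaf a := by
  intro F F' h
  ext x y
  rw [← attachLeaf_adj_succ_succ (a := a), ← attachLeaf_adj_succ_succ (a := a)]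
  exact iff_of_eq (congrArg (fun S ↦ S.Adj x.succ y.succ) h)

lemma injOn_subdivideEdge (a b : Fin m) :
    Set.InjOn (fun H : SimpleGraph (Fin m) ↦ H.subdivideEdge a b) {H | H.Adj a b} := by
  intro H hH H' hH' h
  rw [← deleteEdges_sup_edge hH, ← deleteEdges_sup_edge hH']
  congr 1
  ext x y
  have := iff_of_eq (congrArg (fun S ↦ S.Adj x.succ y.succ) h)
  simpa using this

lemma eq_attachLeaf {T : SimpleGraph (Fin (m + 1))} {a : Fin m}
    (h : ∀ x : Fin m, T.Adj 0 x.succ ↔ x = a) : T = (T.comap Fin.succ).attachLeaf a :=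
  ext_fin_succ (by simp [h]) (by simp)

lemma eq_subdivideEdge {T : SimpleGraph (Fin (m + 1))} {a b : Fin m}
    (hab : ¬T.Adj a.succ b.succ) (h : ∀ x : Fin m, T.Adj 0 x.succ ↔ x = a ∨ x = b) :
    T = (T.comap Fin.succ ⊔ edge a b).subdivideEdge a b := by
  refine ext_fin_succ (by simp [h]) fun x y ↦ ?_
  have : T.Adj x.succ y.succ → s(x, y) ≠ s(a, b) := by
    intro hxy he
    rcases Sym2.eq_iff.1 he with ⟨rfl, rfl⟩ | ⟨rfl, rfl⟩
    · exact hab hxy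
    · exact hab hxy.symm
  simp only [subdivideEdge_adj_succ_succ, sup_adj, comap_adj, adj_edge]
  grind

lemma attachLeaf_le_subdivideEdge {F G : SimpleGraph (Fin m)} {a b c : Fin m}
    (hc : c = a ∨ c = b) (hF : F ≤ G) (hn : ¬F.Adj a b) :
    F.attachLeaf c ≤ G.subdivideEdge a b := by
  refine le_of_fin_succ ?_ fun x y h ↦ ?_
  · simpa using hc
  · rw [attachLeaf_adj_succ_succ] at h
    refine subdivideEdge_adj_succ_succ.2 ⟨hF h, fun he ↦ hn ?_⟩
    rwa [← mem_edgeSet, ← he]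

lemma subdivideEdge_mono {H G : SimpleGraph (Fin m)} (h : H ≤ G) (a b : Fin m) :
    H.subdivideEdge a b ≤ G.subdivideEdge a b :=
  le_of_fin_succ (by simp) fun x y hxy ↦ by
    rw [subdivideEdge_adj_succ_succ] at hxy ⊢
    exact ⟨h hxy.1, hxy.2⟩

lemma comap_succ_le_of_le_subdivideEdge {T : SimpleGraph (Fin (m + 1))}
    {G : SimpleGraph (Fin m)} {a b : Fin m} (h : T ≤ G.subdivideEdge a b) :
    T.comap Fin.succ ≤ G :=
  fun _ _ hxy ↦ (subdivideEdge_adj_succ_succ.1 (h hxy)).1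

lemma not_adj_of_le_subdivideEdge {T : SimpleGraph (Fin (m + 1))}
    {G : SimpleGraph (Fin m)} {a b : Fin m} (h : T ≤ G.subdivideEdge a b) :
    ¬T.Adj a.succ b.succ :=
  fun hab ↦ (subdivideEdge_adj_succ_succ.1 (h hab)).2 rfl

lemma spanningTrees_subdivideEdge_not_adj {G : SimpleGraph (Fin m)} {a b : Fin m}
    (hab : G.Adj a b) :
    {T | T ≤ G.subdivideEdge a b ∧ T.IsTree ∧ ¬T.Adj 0 a.succ} =
      (fun F ↦ F.attachLeaf b) '' {F | F ≤ G ∧ F.IsTree ∧ ¬F.Adj a b} := by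
  ext T
  constructor
  · rintro ⟨hle, hT, ha⟩
    have hb : T.Adj 0 b.succ := by
      have : Nontrivial (Fin (m + 1)) := ⟨0, a.succ, (Fin.succ_ne_zero a).symm⟩
      obtain ⟨w, hw⟩ := hT.connected.preconnected.exists_adj_of_nontrivial 0
      cases w using Fin.cases with
      | zero => exact absurd hw T.irrefl
      | succ w =>
        rcases subdivideEdge_adj_zero_succ.1 (hle hw) with rfl | rfl
        · exact absurd hw ha
        · exact hw
    have hT' : T = (T.comap Fin.succ).attachLeaf b := eq_attachLeaf fun x ↦ by
      refine ⟨fun hx ↦ ?_, by rintro rfl; exact hb⟩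
      rcases subdivideEdge_adj_zero_succ.1 (hle hx) with rfl | rfl
      · exact absurd hx ha
      · rfl
    exact ⟨_, ⟨comap_succ_le_of_le_subdivideEdge hle, isTree_attachLeaf_iff.1 (hT' ▸ hT),
      not_adj_of_le_subdivideEdge hle⟩, hT'.symm⟩
  · rintro ⟨F, ⟨hle, hF, hn⟩, rfl⟩
    exact ⟨attachLeaf_le_subdivideEdge (.inr rfl) hle hn, isTree_attachLeaf_iff.2 hF,
      by simpa using hab.ne⟩

lemma spanningTrees_subdivideEdge_adj {G : SimpleGraph (Fin m)} {a b : Fin m}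
    (hab : G.Adj a b) :
    {T | T ≤ G.subdivideEdge a b ∧ T.IsTree ∧ T.Adj 0 a.succ} =
      (fun H ↦ H.subdivideEdge a b) '' {H | H ≤ G ∧ H.IsTree ∧ H.Adj a b} ∪
        (fun F ↦ F.attachLeaf a) '' {F | F ≤ G ∧ F.IsTree ∧ ¬F.Adj a b} := by
  ext T
  constructor
  · rintro ⟨hle, hT, ha⟩
    by_cases hb : T.Adj 0 b.succ
    · left
      have hT' := eq_subdivideEdge (not_adj_of_le_subdivideEdge hle) fun x ↦
        ⟨fun hx ↦ subdivideEdge_adj_zero_succ.1 (hle hx), by rintro (rfl | rfl) <;> assumption⟩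
      have hadj : (T.comap Fin.succ ⊔ edge a b).Adj a b := .inr (by simp [edge_adj, hab.ne])
      refine ⟨_, ⟨sup_le (comap_succ_le_of_le_subdivideEdge hle) ?_,
        (isTree_subdivideEdge_iff hadj).1 (hT' ▸ hT), hadj⟩, hT'.symm⟩
      rw [edge_le_iff]
      exact .inr hab
    · right
      have hT' : T = (T.comap Fin.succ).attachLeaf a := eq_attachLeaf fun x ↦ by
        refine ⟨fun hx ↦ ?_, by rintro rfl; exact ha⟩
        rcases subdivideEdge_adj_zero_succ.1 (hle hx) with rfl | rfl
        · rfl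
        · exact absurd hx hb
      exact ⟨_, ⟨comap_succ_le_of_le_subdivideEdge hle, isTree_attachLeaf_iff.1 (hT' ▸ hT),
        not_adj_of_le_subdivideEdge hle⟩, hT'.symm⟩
  · rintro (⟨H, ⟨hle, hH, hadj⟩, rfl⟩ | ⟨F, ⟨hle, hF, hn⟩, rfl⟩)
    · exact ⟨subdivideEdge_mono hle a b, (isTree_subdivideEdge_iff hadj).2 hH, by simp⟩
    · exact ⟨attachLeaf_le_subdivideEdge (.inl rfl) hle hn, isTree_attachLeaf_iff.2 hF, by simp⟩

lemma disjoint_image_subdivideEdge_image_attachLeaf {a b : Fin m} (hab : a ≠ b)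
    (s t : Set (SimpleGraph (Fin m))) :
    Disjoint ((fun H ↦ H.subdivideEdge a b) '' s) ((fun F ↦ F.attachLeaf a) '' t) := by
  rw [Set.disjoint_left]
  rintro _ ⟨H, -, rfl⟩ ⟨F, -, h⟩
  have := iff_of_eq (congrArg (fun S ↦ S.Adj 0 b.succ) h)
  simp [hab.symm] at this

end SimpleGraph

/-- Subdividing the witness edge: if `(t,u)` is `n`-feasible then `(t+u, u)` is
`(n+1)`-feasible. -/
theorem feasible_subdivide (n t u : ℕ) (h : EdgeFeasible n t u) :
    EdgeFeasible (n + 1) (t + u) u := by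
  obtain ⟨m, G, e, hm, he, rfl, rfl⟩ := h
  induction e using Sym2.ind with
  | _ a b =>
    have hab : G.Adj a b := he
    refine ⟨m + 1, G.subdivideEdge a b, s(0, a.succ), by omega, by simp, ?_, ?_⟩
    · simp only [SimpleGraph.mem_edgeSet]
      rw [SimpleGraph.spanningTrees_subdivideEdge_adj hab,
        Set.ncard_union_eq
          (SimpleGraph.disjoint_image_subdivideEdge_image_attachLeaf hab.ne _ _),
        Set.ncard_image_of_injective _ (SimpleGraph.attachLeaf_injective a),
        Set.InjOn.ncard_image
          ((SimpleGraph.injOn_subdivideEdge a b).mono fun _ hH ↦ hH.2.2)]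
    · simp only [SimpleGraph.mem_edgeSet]
      rw [SimpleGraph.spanningTrees_subdivideEdge_not_adj hab,
        Set.ncard_image_of_injective _ (SimpleGraph.attachLeaf_injective b)]
end
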